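/- Let 𝔤 be a finite-dimensional simple real Lie algebra equipped with a norm making its underlying real vector space a normed space. For every κ > 0 and every σ < dim_ℝ 𝔤 there exist ε > 0 and δ₀ > 0 (depending on 𝔤, κ, σ) such that for all 0 < δ < δ₀ the following holds. Let A ⊆ 𝔤 satisfy: (i) A ⊆ B(0, δ^{-ε}); (ii) for every ρ ≥ δ, N_ρ(A) ≥ δ^ε ρ^{-κ}; (iii) N_δ(A) ≤ δ^{-σ-ε}; (iv) for every proper Lie subalgebra W of 𝔤 there exists a ∈ A with dist(a, W) ≥ δ^ε. Then N_δ(A + A) + N_δ(A + [A,A]) ≥ δ^{-ε} N_δ(A), where [A,A] = {[a,b] : a, b ∈ A}. -/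

import Mathlib

open Pointwise

section SeminormDefs

variable {E : Type*} [AddCommGroup E] [Module ℝ E]

/-- Closed ball of radius `r` around `x`, with respect to the (semi)norm `nm`. -/
def SBall (nm : Seminorm ℝ E) (x : E) (r : ℝ) : Set E := {y | nm (y - x) ≤ r}

/-- Distance from the point `a` to the set `W`, with respect to the (semi)norm `nm`. -/
noncomputable def SDist (nm : Seminorm ℝ E) (a : E) (W : Set E) : ℝ :=
  sInf ((fun w => nm (a - w)) '' W)

/-- Covering number of `S` at scale `δ`: the least number of closed `δ`-balls
(for the norm `nm`) needed to cover `S`. -/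
noncomputable def SCov (nm : Seminorm ℝ E) (δ : ℝ) (S : Set E) : ℕ :=
  sInf {N : ℕ | ∃ F : Finset E, F.card ≤ N ∧ S ⊆ ⋃ x ∈ F, SBall nm x δ}

end SeminormDefs

/-- A finite subset of maximal cardinality with a given property, for bounded cardinalities. -/
theorem exists_max_finset {α : Type*} {p : Finset α → Prop} (h0 : p ∅) {N : ℕ} (hN : ∀ X, p X → X.card ≤ N) :
    ∃ X, p X ∧ ∀ Y, p Y → Y.card ≤ X.card := by
  classical
  have hb : BddAbove {k : ℕ | ∃ X, p X ∧ X.card = k} :=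
    Exists.intro N (by rintro k ⟨X, hX, rfl⟩; exact hN X hX)
  obtain ⟨X, hX, h⟩ := Nat.sSup_mem (s := {k : ℕ | ∃ X, p X ∧ X.card = k}) ⟨0, ∅, h0, rfl⟩ hb
  exact ⟨X, hX, fun Y hY => h ▸ le_csSup hb ⟨Y, hY, rfl⟩⟩

section Covering

variable {V : Type*} [NormedAddCommGroup V]

/-- `S` is contained in the `δ`-neighbourhood of at most `L` translates of `S'`. -/
def Cov (δ L : ℝ) (S S' : Set V) : Prop :=
  ∃ X : Finset V, (X.card : ℝ) ≤ L ∧ ∀ s ∈ S, ∃ x ∈ X, ∃ s' ∈ S', ‖s - (x + s')‖ ≤ δ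

/-- `F` is a `δ`-net of `S`. -/
def IsNet (δ : ℝ) (S : Set V) (F : Finset V) : Prop := ∀ s ∈ S, ∃ x ∈ F, ‖s - x‖ ≤ δ

/-- The covering number of `S` at scale `δ`. -/
noncomputable def cn (δ : ℝ) (S : Set V) : ℕ := sInf {N : ℕ | ∃ F : Finset V, F.card ≤ N ∧ IsNet δ S F}

/-- `S` has finite `δ`-nets at every scale. -/
def TB (S : Set V) : Prop := ∀ δ : ℝ, 0 < δ → ∃ F : Finset V, IsNet δ S F

theorem cn_le {δ : ℝ} {S : Set V} {F : Finset V} (h : IsNet δ S F) : cn δ S ≤ F.card :=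
  Nat.sInf_le ⟨F, le_rfl, h⟩

theorem TB.exists_net {δ : ℝ} (hδ : 0 < δ) {S : Set V} (h : TB S) :
    ∃ F : Finset V, F.card = cn δ S ∧ IsNet δ S F := by
  obtain ⟨F, hF⟩ := h δ hδ
  have : {N : ℕ | ∃ F : Finset V, F.card ≤ N ∧ IsNet δ S F}.Nonempty := ⟨F.card, F, le_rfl, hF⟩
  obtain ⟨G, hG, hn⟩ := Nat.sInf_mem this
  exact ⟨G, le_antisymm hG (cn_le hn), hn⟩

theorem IsNet.mono {δ δ' : ℝ} {S S' : Set V} {F : Finset V} (h : IsNet δ S F) (hS : S' ⊆ S)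
    (hd : δ ≤ δ') : IsNet δ' S' F := fun s hs =>
  let ⟨x, hx, hh⟩ := h s (hS hs); ⟨x, hx, hh.trans hd⟩

theorem TB.mono {S S' : Set V} (h : TB S) (hS : S' ⊆ S) : TB S' := fun δ hδ =>
  let ⟨F, hF⟩ := h δ hδ; ⟨F, hF.mono hS le_rfl⟩

theorem cn_mono {δ δ' : ℝ} (hδ : 0 < δ) {S S' : Set V} (h : TB S) (hS : S' ⊆ S) (hd : δ ≤ δ') :
    cn δ' S' ≤ cn δ S := by
  obtain ⟨F, hF, hn⟩ := h.exists_net hδ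
  rw [← hF]; exact cn_le (hn.mono hS hd)

theorem cn_pos {δ : ℝ} (hδ : 0 < δ) {S : Set V} (h : TB S) (hne : S.Nonempty) : 1 ≤ cn δ S := by
  obtain ⟨F, hF, hn⟩ := h.exists_net hδ
  obtain ⟨s, hs⟩ := hne
  obtain ⟨x, hx, -⟩ := hn s hs
  rw [← hF]; exact Finset.card_pos.2 ⟨x, hx⟩

theorem cn_pos' {δ : ℝ} (hδ : 0 < δ) {S : Set V} (h : TB S) (hne : S.Nonempty) :
    (1 : ℝ) ≤ cn δ S := by exact_mod_cast cn_pos hδ h hne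

theorem Cov.mono {δ δ' L L' : ℝ} {S S' T T' : Set V} (h : Cov δ L S T) (hd : δ ≤ δ') (hL : L ≤ L')
    (hS : S' ⊆ S) (hT : T ⊆ T') : Cov δ' L' S' T' := by
  obtain ⟨X, hX, hc⟩ := h
  refine ⟨X, hX.trans hL, fun s hs => ?_⟩
  obtain ⟨x, hx, t, ht, hh⟩ := hc s (hS hs)
  exact ⟨x, hx, t, hT ht, hh.trans hd⟩

theorem Cov.trans {δ δ' L L' : ℝ} {S T U : Set V} (h : Cov δ L S T) (h' : Cov δ' L' T U) :
    Cov (δ + δ') (L * L') S U := by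
  classical
  obtain ⟨X, hX, hc⟩ := h
  obtain ⟨Y, hY, hc'⟩ := h'
  refine ⟨X + Y, ?_, fun s hs => ?_⟩
  · calc ((X + Y).card : ℝ) ≤ X.card * Y.card := by exact_mod_cast Finset.card_add_le
      _ ≤ L * L' := by gcongr; exact le_trans (by positivity) hX
  · obtain ⟨x, hx, t, ht, h1⟩ := hc s hs
    obtain ⟨y, hy, u, hu, h2⟩ := hc' t ht
    refine ⟨x + y, Finset.add_mem_add hx hy, u, hu, ?_⟩
    calc ‖s - (x + y + u)‖ = ‖(s - (x + t)) + (t - (y + u))‖ := by congr 1; abel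
      _ ≤ _ := (norm_add_le _ _).trans (add_le_add h1 h2)

theorem Cov.add {δ δ' L L' : ℝ} {S T S' T' : Set V} (h : Cov δ L S T) (h' : Cov δ' L' S' T') :
    Cov (δ + δ') (L * L') (S + S') (T + T') := by
  classical
  obtain ⟨X, hX, hc⟩ := h
  obtain ⟨Y, hY, hc'⟩ := h'
  refine ⟨X + Y, ?_, ?_⟩
  · calc ((X + Y).card : ℝ) ≤ X.card * Y.card := by exact_mod_cast Finset.card_add_le
      _ ≤ L * L' := by gcongr; exact le_trans (by positivity) hX
  · rintro _ ⟨s, hs, s', hs', rfl⟩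
    obtain ⟨x, hx, t, ht, h1⟩ := hc s hs
    obtain ⟨y, hy, u, hu, h2⟩ := hc' s' hs'
    refine ⟨x + y, Finset.add_mem_add hx hy, t + u, Set.add_mem_add ht hu, ?_⟩
    calc ‖s + s' - (x + y + (t + u))‖ = ‖(s - (x + t)) + (s' - (y + u))‖ := by congr 1; abel
      _ ≤ _ := (norm_add_le _ _).trans (add_le_add h1 h2)

theorem Cov.refl {δ L : ℝ} (hδ : 0 ≤ δ) (hL : 1 ≤ L) (S : Set V) : Cov δ L S S :=
  ⟨{0}, by simpa using hL, fun s hs => ⟨0, by simp, s, hs, by simpa using hδ⟩⟩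

theorem Cov.image {W : Type*} [NormedAddCommGroup W] {δ L K : ℝ} {S T : Set V} (h : Cov δ L S T)
    (f : V → W) (hf : ∀ x y, f (x + y) = f x + f y) (hK : ∀ x, ‖f x‖ ≤ K * ‖x‖) (hK0 : 0 ≤ K) :
    Cov (K * δ) L (f '' S) (f '' T) := by
  classical
  obtain ⟨X, hX, hc⟩ := h
  refine ⟨X.image f, le_trans (by exact_mod_cast Finset.card_image_le) hX, ?_⟩
  rintro _ ⟨s, hs, rfl⟩
  obtain ⟨x, hx, t, ht, h1⟩ := hc s hs
  refine ⟨f x, Finset.mem_image_of_mem _ hx, f t, ⟨t, ht, rfl⟩, ?_⟩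
  have : f s - (f x + f t) = f (s - (x + t)) := by
    rw [sub_eq_iff_eq_add, ← hf x t, ← hf]; congr 1; abel
  rw [this]
  exact (hK _).trans (by gcongr)

theorem Cov.neg {δ L : ℝ} {S T : Set V} (h : Cov δ L S T) : Cov δ L (-S) (-T) := by
  have := h.image (fun x => -x) (fun x y => neg_add x y) (K := 1) (by simp) (by norm_num)
  simpa using this

theorem Cov.cn_le {δ δ' L : ℝ} {S T : Set V} (h : Cov δ L S T) (hδ : 0 < δ') (hT : TB T) :
    (cn (δ + δ') S : ℝ) ≤ L * cn δ' T := by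
  classical
  obtain ⟨X, hX, hc⟩ := h
  obtain ⟨F, hF, hn⟩ := hT.exists_net hδ
  have : IsNet (δ + δ') S (X + F) := fun s hs => by
    obtain ⟨x, hx, t, ht, h1⟩ := hc s hs
    obtain ⟨y, hy, h2⟩ := hn t ht
    refine ⟨x + y, Finset.add_mem_add hx hy, ?_⟩
    calc ‖s - (x + y)‖ = ‖(s - (x + t)) + (t - y)‖ := by congr 1; abel
      _ ≤ _ := (norm_add_le _ _).trans (by linarith)
  calc (cn (δ + δ') S : ℝ) ≤ (X + F).card := by exact_mod_cast _root_.cn_le this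
    _ ≤ X.card * F.card := by exact_mod_cast Finset.card_add_le
    _ ≤ L * cn δ' T := by rw [hF]; gcongr

/-- Sets of translates which are pairwise `2δ`-separated. -/
theorem card_mul_cn_le {δ : ℝ} (hδ : 0 < δ) {S T : Set V} {X : Finset V} (hT : TB T)
    (hX : ∀ x ∈ X, ∀ s ∈ S, x + s ∈ T)
    (hsep : ∀ x ∈ X, ∀ y ∈ X, ∀ s ∈ S, ∀ t ∈ S, ‖(x + s) - (y + t)‖ ≤ 2 * δ → x = y) :
    X.card * cn δ S ≤ cn δ T := by
  classical
  obtain ⟨F, hF, hn⟩ := hT.exists_net hδ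
  let G : V → Finset V := fun x => F.filter fun f => ∃ s ∈ S, ‖x + s - f‖ ≤ δ
  have h1 : ∀ x ∈ X, cn δ S ≤ (G x).card := fun x hx => by
    have : IsNet δ S ((G x).image fun f => f - x) := fun s hs => by
      obtain ⟨f, hf, h⟩ := hn _ (hX x hx s hs)
      refine ⟨f - x, Finset.mem_image_of_mem _ (Finset.mem_filter.2 ⟨hf, s, hs, h⟩), ?_⟩
      rwa [show s - (f - x) = x + s - f by abel]
    exact (cn_le this).trans Finset.card_image_le
  have h2 : (X : Set V).PairwiseDisjoint G := fun x hx y hy hxy => by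
    refine Finset.disjoint_left.2 fun f hf hf' => hxy ?_
    obtain ⟨-, s, hs, h⟩ := Finset.mem_filter.1 hf
    obtain ⟨-, t, ht, h'⟩ := Finset.mem_filter.1 hf'
    refine hsep x hx y hy s hs t ht ?_
    calc ‖(x + s) - (y + t)‖ = ‖(x + s - f) - (y + t - f)‖ := by congr 1; abel
      _ ≤ _ := (norm_sub_le _ _).trans (by linarith)
  calc X.card * cn δ S = ∑ x ∈ X, cn δ S := by simp
    _ ≤ ∑ x ∈ X, (G x).card := Finset.sum_le_sum h1
    _ = (X.biUnion G).card := (Finset.card_biUnion h2).symm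
    _ ≤ F.card := Finset.card_le_card (Finset.biUnion_subset.2 fun x _ => Finset.filter_subset _ _)
    _ = _ := hF

/-- Ruzsa covering. -/
theorem ruzsa_cov {δ : ℝ} (hδ : 0 < δ) {S S' : Set V} (hT : TB (S + S')) (hS' : TB S')
    (hne : S'.Nonempty) : Cov (2 * δ) (cn δ (S + S') / cn δ S') S (S' - S') := by
  classical
  let p : Finset V → Prop := fun X => (∀ x ∈ X, x ∈ S) ∧
    ∀ x ∈ X, ∀ y ∈ X, ∀ s ∈ S', ∀ t ∈ S', ‖(x + s) - (y + t)‖ ≤ 2 * δ → x = y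
  have key : ∀ X, p X → X.card * cn δ S' ≤ cn δ (S + S') := fun X hX =>
    card_mul_cn_le hδ hT (fun x hx s hs => Set.add_mem_add (hX.1 x hx) hs) hX.2
  have h1 := cn_pos hδ hS' hne
  obtain ⟨X, hX, hmax⟩ := exists_max_finset (p := p) (by simp [p]) (N := cn δ (S + S'))
    (fun X hX => le_trans (Nat.le_mul_of_pos_right _ h1) (key X hX))
  refine ⟨X, ?_, fun s hs => ?_⟩
  · rw [le_div_iff₀ (by exact_mod_cast h1)]; exact_mod_cast key X hX
  by_contra! hcon
  have hsX : s ∉ X := fun h => by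
    obtain ⟨t, ht⟩ := hne
    have := hcon s h (t - t) (Set.sub_mem_sub ht ht)
    simp at this; linarith
  have : p (insert s X) := by
    refine ⟨fun x hx => ?_, fun x hx y hy a ha b hb hab => ?_⟩
    · rcases Finset.mem_insert.1 hx with rfl | hx
      exacts [hs, hX.1 x hx]
    · rcases Finset.mem_insert.1 hx with rfl | hx' <;> rcases Finset.mem_insert.1 hy with rfl | hy'
      · rfl
      · have := hcon y hy' (b - a) (Set.sub_mem_sub hb ha)
        rw [show x - (y + (b - a)) = x + a - (y + b) by abel] at this
        linarith
      · have := hcon x hx' (a - b) (Set.sub_mem_sub ha hb)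
        rw [show y - (x + (a - b)) = -(x + a - (y + b)) by abel, norm_neg] at this
        linarith
      · exact hX.2 x hx' y hy' a ha b hb hab
  have := hmax _ this
  rw [Finset.card_insert_of_notMem hsX] at this
  omega

/-- A maximal separated subset. -/
theorem exists_sep {ρ : ℝ} (hρ : 0 < ρ) {S : Set V} (hS : TB S) :
    ∃ X : Finset V, (∀ x ∈ X, x ∈ S) ∧ (∀ x ∈ X, ∀ y ∈ X, ‖x - y‖ ≤ ρ → x = y) ∧
      IsNet ρ S X := by
  classical
  let p : Finset V → Prop := fun X => (∀ x ∈ X, x ∈ S) ∧ ∀ x ∈ X, ∀ y ∈ X, ‖x - y‖ ≤ ρ → x = y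
  have key : ∀ X, p X → X.card ≤ cn (ρ / 2) S := fun X hX => by
    have h := card_mul_cn_le (δ := ρ / 2) (S := {0}) (T := S) (by positivity) hS
      (fun x hx s hs => by simpa [Set.mem_singleton_iff.1 hs] using hX.1 x hx) (X := X)
      (fun x hx y hy s hs t ht h => hX.2 x hx y hy (by
        rw [Set.mem_singleton_iff.1 hs, Set.mem_singleton_iff.1 ht] at h
        simpa [mul_div_cancel₀] using h))
    have h1 : 1 ≤ cn (ρ / 2) ({0} : Set V) := cn_pos (by positivity)
      (fun δ hδ => ⟨{0}, fun s hs => ⟨0, by simp, by simp_all [hδ.le]⟩⟩) ⟨0, rfl⟩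
    nlinarith
  obtain ⟨X, hX, hmax⟩ := exists_max_finset (p := p) (by simp [p]) key
  refine ⟨X, hX.1, hX.2, fun s hs => ?_⟩
  by_contra! hcon
  have hsX : s ∉ X := fun h => by
    have := hcon s h
    simp at this; linarith
  have : p (insert s X) := by
    refine ⟨fun x hx => ?_, fun x hx y hy hab => ?_⟩
    · rcases Finset.mem_insert.1 hx with rfl | hx
      exacts [hs, hX.1 x hx]
    · rcases Finset.mem_insert.1 hx with rfl | hx' <;> rcases Finset.mem_insert.1 hy with rfl | hy'
      · rfl
      · have := hcon y hy'
        linarith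
      · have := hcon x hx'
        rw [norm_sub_rev] at this
        linarith
      · exact hX.2 x hx' y hy' hab
  have := hmax _ this
  rw [Finset.card_insert_of_notMem hsX] at this
  omega

theorem cn_mul_cn_le {δ ρ : ℝ} (hδ : 0 < δ) (hρ : δ ≤ ρ) {S P : Set V} (hS : TB S)
    (hT : TB (S + P)) : cn (4 * ρ) S * cn δ (P ∩ {p | ‖p‖ ≤ ρ}) ≤ cn δ (S + P) := by
  obtain ⟨X, hX, hsep, hnet⟩ := exists_sep (ρ := 4 * ρ) (by linarith) hS
  calc _ ≤ X.card * cn δ (P ∩ {p | ‖p‖ ≤ ρ}) := Nat.mul_le_mul_right _ (cn_le hnet)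
    _ ≤ _ := card_mul_cn_le hδ hT (fun x hx s hs => Set.add_mem_add (hX x hx) hs.1) ?_
  intro x hx y hy s hs t ht h
  refine hsep x hx y hy ?_
  calc ‖x - y‖ = ‖((x + s) - (y + t)) + (t - s)‖ := by congr 1; abel
    _ ≤ 2 * δ + (ρ + ρ) := (norm_add_le _ _).trans
      (add_le_add h ((norm_sub_le _ _).trans (add_le_add ht.2 hs.2)))
    _ ≤ _ := by linarith

theorem TB.cn_le_mul {δ ρ : ℝ} (hδ : 0 < δ) (hρ : 0 < ρ) {S : Set V} (hS : TB S)
    (hT : TB (S - S)) : cn δ S ≤ cn ρ S * cn δ ((S - S) ∩ {p | ‖p‖ ≤ 2 * ρ}) := by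
  classical
  obtain ⟨F, hF, hn⟩ := hS.exists_net hρ
  have hT' : TB ((S - S) ∩ {p | ‖p‖ ≤ 2 * ρ}) := hT.mono Set.inter_subset_left
  obtain ⟨G, hG, hnG⟩ := hT'.exists_net hδ
  by_cases hne : S.Nonempty
  swap
  · rw [Set.not_nonempty_iff_eq_empty.1 hne]
    exact (cn_le (F := ∅) (fun s hs => hs.elim)).trans (by simp)
  obtain ⟨s0, hs0⟩ := hne
  have : ∀ f : V, ∃ s ∈ S, (∃ t ∈ S, ‖t - f‖ ≤ ρ) → ‖s - f‖ ≤ ρ := fun f => by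
    by_cases h : ∃ t ∈ S, ‖t - f‖ ≤ ρ
    · obtain ⟨t, ht, h'⟩ := h; exact ⟨t, ht, fun _ => h'⟩
    · exact ⟨s0, hs0, fun h' => (h h').elim⟩
  choose g hgS hg using this
  have : IsNet δ S (F.image g + G) := fun s hs => by
    obtain ⟨f, hf, h⟩ := hn s hs
    have h' := hg f ⟨s, hs, h⟩
    obtain ⟨y, hy, hy'⟩ := hnG (s - g f) ⟨Set.sub_mem_sub hs (hgS f), by
      show ‖s - g f‖ ≤ 2 * ρ
      calc ‖s - g f‖ = ‖(s - f) - (g f - f)‖ := by congr 1; abel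
        _ ≤ _ := (norm_sub_le _ _).trans (by linarith)⟩
    exact ⟨g f + y, Finset.add_mem_add (Finset.mem_image_of_mem _ hf) hy, by
      rwa [← sub_sub]⟩
  calc cn δ S ≤ (F.image g + G).card := cn_le this
    _ ≤ (F.image g).card * G.card := Finset.card_add_le
    _ ≤ F.card * G.card := Nat.mul_le_mul_right _ Finset.card_image_le
    _ = _ := by rw [hF, hG]

/-- Localization of a covering to a ball. -/
theorem Cov.local {δ L R : ℝ} {S T : Set V} (h : Cov δ L S T) (hR : ∀ s ∈ S, ‖s‖ ≤ R) :
    Cov (2 * δ) L S ((T - T) ∩ {p | ‖p‖ ≤ 2 * R + 2 * δ}) := by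
  classical
  obtain ⟨X, hX, hc⟩ := h
  have : ∀ x : V, ∃ s t, (∃ s ∈ S, ∃ t ∈ T, ‖s - (x + t)‖ ≤ δ) → s ∈ S ∧ t ∈ T ∧ ‖s - (x + t)‖ ≤ δ :=
    fun x => by
      by_cases h : ∃ s ∈ S, ∃ t ∈ T, ‖s - (x + t)‖ ≤ δ
      · obtain ⟨s, hs, t, ht, h'⟩ := h; exact ⟨s, t, fun _ => ⟨hs, ht, h'⟩⟩
      · exact ⟨0, 0, fun h' => (h h').elim⟩
  choose f g hfg using this
  refine ⟨X.image f, le_trans (by exact_mod_cast Finset.card_image_le) hX, fun s hs => ?_⟩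
  obtain ⟨x, hx, t, ht, h1⟩ := hc s hs
  obtain ⟨h2, h3, h4⟩ := hfg x ⟨s, hs, t, ht, h1⟩
  have h5 : ‖s - f x - (t - g x)‖ ≤ 2 * δ := by
    calc ‖s - f x - (t - g x)‖ = ‖(s - (x + t)) - (f x - (x + g x))‖ := by congr 1; abel
        _ ≤ _ := (norm_sub_le _ _).trans (by linarith)
  refine ⟨f x, Finset.mem_image_of_mem _ hx, t - g x, ⟨Set.sub_mem_sub ht h3, ?_⟩, by
    rwa [← sub_sub]⟩
  show ‖t - g x‖ ≤ 2 * R + 2 * δ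
  calc ‖t - g x‖ = ‖s - f x - (s - f x - (t - g x))‖ := by congr 1; abel
    _ ≤ (R + R) + 2 * δ := (norm_sub_le _ _).trans
      (add_le_add ((norm_sub_le _ _).trans (add_le_add (hR s hs) (hR _ h2))) h5)
    _ = _ := by ring

theorem TB.add {S T : Set V} (hS : TB S) (hT : TB T) : TB (S + T) := by
  classical
  intro δ hδ
  obtain ⟨F, hF⟩ := hS (δ / 2) (by positivity)
  obtain ⟨G, hG⟩ := hT (δ / 2) (by positivity)
  refine ⟨F + G, ?_⟩
  rintro _ ⟨s, hs, t, ht, rfl⟩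
  obtain ⟨x, hx, h1⟩ := hF s hs
  obtain ⟨y, hy, h2⟩ := hG t ht
  refine ⟨x + y, Finset.add_mem_add hx hy, ?_⟩
  calc ‖s + t - (x + y)‖ = ‖(s - x) + (t - y)‖ := by congr 1; abel
    _ ≤ _ := (norm_add_le _ _).trans (by linarith)

theorem TB.neg {S : Set V} (hS : TB S) : TB (-S) := by
  classical
  intro δ hδ
  obtain ⟨F, hF⟩ := hS δ hδ
  refine ⟨F.image fun x => -x, fun s hs => ?_⟩
  obtain ⟨x, hx, h1⟩ := hF (-s) hs
  exact ⟨-x, Finset.mem_image_of_mem _ hx, by rw [← norm_neg]; simpa [neg_sub, add_comm, sub_eq_add_neg] using h1⟩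

theorem TB.sub {S T : Set V} (hS : TB S) (hT : TB T) : TB (S - T) := by
  rw [sub_eq_add_neg]; exact hS.add hT.neg

variable [NormedSpace ℝ V] [FiniteDimensional ℝ V]

theorem tb_of_bounded {S : Set V} {R : ℝ} (h : ∀ s ∈ S, ‖s‖ ≤ R) : TB S := by
  classical
  intro δ hδ
  have : ProperSpace V := FiniteDimensional.proper ℝ V
  have hc : IsCompact (Metric.closedBall (0 : V) R) := isCompact_closedBall 0 R
  obtain ⟨t, ht, htf, hcov⟩ := Metric.totallyBounded_iff.1 hc.totallyBounded δ hδ |>.imp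
    fun t h => (⟨trivial, h.1, h.2⟩ : True ∧ t.Finite ∧ _)
  refine ⟨htf.toFinset, fun s hs => ?_⟩
  obtain ⟨y, hy, h'⟩ := Set.mem_iUnion₂.1 (hcov (mem_closedBall_zero_iff.2 (h s hs)))
  exact ⟨y, htf.mem_toFinset.2 hy, by rw [← dist_eq_norm]; exact (Metric.mem_ball.1 h').le⟩

variable (V) in
/-- Polynomial growth of the covering numbers of balls. -/
theorem exists_cn_ball_le : ∃ D : ℕ, ∀ δ R : ℝ, 0 < δ → 1 ≤ R →
    (cn δ {v : V | ‖v‖ ≤ R * δ} : ℝ) ≤ (2 * R) ^ D := by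
  classical
  obtain ⟨F, hF⟩ := tb_of_bounded (V := V) (S := {v | ‖v‖ ≤ 1}) (fun s hs => hs) (1 / 2) (by norm_num)
  obtain ⟨D, hD⟩ : ∃ D : ℕ, F.card ≤ 2 ^ D := ⟨F.card, Nat.lt_two_pow_self.le⟩
  have key : ∀ (k : ℕ) (δ : ℝ), 0 < δ → cn δ {v : V | ‖v‖ ≤ 2 ^ k * δ} ≤ (2 ^ D) ^ k := by
    intro k
    induction k with
    | zero =>
      intro δ hδ
      refine (cn_le (F := {0}) fun s hs => ⟨0, by simp, ?_⟩).trans (by simp)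
      simpa using hs
    | succ k ih =>
      intro δ hδ
      obtain ⟨G, hG, hn⟩ := (tb_of_bounded (V := V) (S := {v | ‖v‖ ≤ 2 ^ k * δ})
        (fun s hs => hs)).exists_net hδ
      have : IsNet δ {v : V | ‖v‖ ≤ 2 ^ (k + 1) * δ} (F.image (fun x => (2 ^ (k + 1) * δ) • x) + G) := by
        intro s hs
        have hp : (0 : ℝ) < 2 ^ (k + 1) * δ := by positivity
        obtain ⟨x, hx, h1⟩ := hF ((2 ^ (k + 1) * δ)⁻¹ • s) (by
          show ‖_‖ ≤ 1
          rw [norm_smul, norm_inv, Real.norm_of_nonneg hp.le, inv_mul_le_iff₀ hp]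
          simpa using hs)
        obtain ⟨y, hy, h2⟩ := hn (s - (2 ^ (k + 1) * δ) • x) (by
          show ‖_‖ ≤ 2 ^ k * δ
          have : s - (2 ^ (k + 1) * δ) • x = (2 ^ (k + 1) * δ) • ((2 ^ (k + 1) * δ)⁻¹ • s - x) := by
            rw [smul_sub, smul_smul, mul_inv_cancel₀ hp.ne', one_smul]
          rw [this, norm_smul, Real.norm_of_nonneg hp.le]
          calc _ ≤ 2 ^ (k + 1) * δ * (1 / 2) := by gcongr
            _ = _ := by ring)
        exact ⟨_, Finset.add_mem_add (Finset.mem_image_of_mem _ hx) hy, by rwa [← sub_sub]⟩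
      calc _ ≤ _ := cn_le this
        _ ≤ _ := Finset.card_add_le
        _ ≤ 2 ^ D * (2 ^ D) ^ k := Nat.mul_le_mul (Finset.card_image_le.trans hD) (hG ▸ ih δ hδ)
        _ = _ := by ring
  refine ⟨D, fun δ R hδ hR => ?_⟩
  obtain ⟨k, hk, hk'⟩ := exists_nat_pow_near hR (one_lt_two)
  calc (cn δ {v : V | ‖v‖ ≤ R * δ} : ℝ) ≤ cn δ {v : V | ‖v‖ ≤ 2 ^ (k + 1) * δ} := by
        refine Nat.cast_le.2 (cn_mono hδ (tb_of_bounded fun s hs => hs) (fun v hv => ?_) le_rfl)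
        exact le_trans (show ‖v‖ ≤ R * δ from hv) (mul_le_mul_of_nonneg_right hk'.le hδ.le)
    _ ≤ ((2 ^ D) ^ (k + 1) : ℕ) := by exact_mod_cast key _ _ hδ
    _ = (2 * 2 ^ k) ^ D := by push_cast; rw [← pow_mul, mul_comm D, pow_mul]; ring
    _ ≤ _ := by gcongr

variable (V) in
/-- A growth exponent of covering numbers of balls. -/
noncomputable def growth : ℕ := (exists_cn_ball_le V).choose

theorem cn_ball_le {δ R : ℝ} (hδ : 0 < δ) (hR : 1 ≤ R) :
    (cn δ {v : V | ‖v‖ ≤ R * δ} : ℝ) ≤ (2 * R) ^ growth V := (exists_cn_ball_le V).choose_spec δ R hδ hR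

theorem Cov.refine {δ L R : ℝ} {S T : Set V} (hδ : 0 < δ) (hR : 1 ≤ R) (h : Cov (R * δ) L S T) :
    Cov δ (L * (2 * R) ^ growth V) S T := by
  have h1 : Cov (R * δ) L S (T + {0}) := by simpa using h
  obtain ⟨F, hF, hn⟩ := (tb_of_bounded (V := V) (S := {v | ‖v‖ ≤ R * δ}) (fun s hs => hs)).exists_net hδ
  classical
  obtain ⟨X, hX, hc⟩ := h
  refine ⟨X + F, ?_, fun s hs => ?_⟩
  · calc ((X + F).card : ℝ) ≤ X.card * F.card := by exact_mod_cast Finset.card_add_le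
      _ ≤ L * (2 * R) ^ growth V := by
        rw [hF]; gcongr
        exacts [le_trans (by positivity) hX, cn_ball_le hδ hR]
  · obtain ⟨x, hx, t, ht, h1⟩ := hc s hs
    obtain ⟨y, hy, h2⟩ := hn _ h1
    refine ⟨x + y, Finset.add_mem_add hx hy, t, ht, ?_⟩
    rwa [show s - (x + y + t) = s - (x + t) - y by abel]

theorem cn_refine {δ R : ℝ} {S : Set V} (hδ : 0 < δ) (hR : 1 ≤ R) (hS : TB S) :
    (cn δ S : ℝ) ≤ cn (R * δ) S * (2 * R) ^ growth V := by
  obtain ⟨F, hF, hn⟩ := hS.exists_net (δ := R * δ) (by positivity)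
  have h : Cov (R * δ) (cn (R * δ) S) S {0} := ⟨F, by rw [hF], fun s hs => by
    obtain ⟨x, hx, h⟩ := hn s hs; exact ⟨x, hx, 0, rfl, by simpa using h⟩⟩
  obtain ⟨X, hX, hc⟩ := h.refine hδ hR
  refine le_trans ?_ hX
  exact_mod_cast cn_le fun s hs => by
    obtain ⟨x, hx, t, ht, h⟩ := hc s hs
    rw [Set.mem_singleton_iff.1 ht, add_zero] at h
    exact ⟨x, hx, h⟩

end Covering

section FreimanGrowth

variable {V : Type*} [NormedAddCommGroup V]

/-- A collision produced by a small sumset. -/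
theorem exists_collision {δ : ℝ} (hδ : 0 < δ) {H : Set V} {f : V → V} {B : Finset V}
    (hB : ∀ b ∈ B, b ∈ H) (hT : TB (H + f '' H)) (hlt : cn δ (H + f '' H) < B.card * cn δ H) :
    ∃ b ∈ B, ∃ b' ∈ B, b ≠ b' ∧ ∃ h ∈ H, ∃ h' ∈ H, ‖(f b - f b') - (h' - h)‖ ≤ 2 * δ := by
  classical
  by_contra! hcon
  have hinj : Set.InjOn f B := fun b hb b' hb' h => by
    by_contra hne
    obtain hH | ⟨x, hx⟩ := H.eq_empty_or_nonempty
    · exact (by simpa [hH] using hB b hb : False)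
    · have := hcon b hb b' hb' hne x hx x hx
      simp [h] at this; linarith
  have := card_mul_cn_le hδ (S := H) (T := H + f '' H) (X := B.image f) hT (fun x hx s hs => by
    obtain ⟨b, hb, rfl⟩ := Finset.mem_image.1 hx
    exact Set.mem_add.2 ⟨s, hs, f b, ⟨b, hB b hb, rfl⟩, add_comm _ _⟩) (fun x hx y hy s hs t ht h => by
    obtain ⟨b, hb, rfl⟩ := Finset.mem_image.1 hx
    obtain ⟨b', hb', rfl⟩ := Finset.mem_image.1 hy
    by_contra hne
    have := hcon b hb b' hb' (fun h => hne (by rw [h])) s hs t ht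
    rw [show f b - f b' - (t - s) = f b + s - (f b' + t) by abel] at this
    linarith)
  rw [Finset.card_image_of_injOn hinj] at this
  omega

variable {𝕜 : Type*} [RCLike 𝕜] [NormedSpace 𝕜 V] [NormedSpace ℝ V] [FiniteDimensional ℝ V]

theorem cn_smul_le {δ : ℝ} (hδ : 0 < δ) {S : Set V} (hS : TB S) (c : 𝕜) :
    cn (‖c‖ * δ) ((fun v => c • v) '' S) ≤ cn δ S := by
  classical
  obtain ⟨F, hF, hn⟩ := hS.exists_net hδ
  rw [← hF]
  refine (cn_le (F := F.image fun v => c • v) ?_).trans Finset.card_image_le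
  rintro _ ⟨s, hs, rfl⟩
  obtain ⟨x, hx, h⟩ := hn s hs
  refine ⟨_, Finset.mem_image_of_mem _ hx, ?_⟩
  rw [← smul_sub, norm_smul]; gcongr

/-- Data at a scale `δ` with loss `M`. -/
structure Scale (δ M α : ℝ) (H : Set V) : Prop where
  hδ : 0 < δ
  hM : 10 ≤ M
  hα : 0 ≤ α
  zero_mem : (0 : V) ∈ H
  neg_mem : ∀ h ∈ H, -h ∈ H
  bdd : ∀ h ∈ H, ‖h‖ ≤ M
  dbl : Cov δ M (H + H) H
  low : ∀ ρ, δ ≤ ρ → ρ ≤ 1 → 1 ≤ M * ρ ^ α * cn ρ H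
  upp : δ ^ α * cn δ H ≤ M

namespace Scale

variable {δ M α : ℝ} {H : Set V} {d : ℕ}

theorem tb (h : Scale δ M α H) : TB H := tb_of_bounded h.bdd

theorem nonempty (h : Scale δ M α H) : H.Nonempty := ⟨0, h.zero_mem⟩

theorem sub_eq (h : Scale δ M α H) : H - H = H + H := by
  ext v; constructor
  · rintro ⟨a, ha, b, hb, rfl⟩; exact ⟨a, ha, -b, h.neg_mem b hb, (sub_eq_add_neg a b).symm⟩
  · rintro ⟨a, ha, b, hb, rfl⟩; exact ⟨a, ha, -b, h.neg_mem b hb, sub_neg_eq_add a b⟩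

theorem low' (h : Scale δ M α H) {ρ : ℝ} (hρ : δ ≤ ρ) : 1 ≤ M * ρ ^ α * cn ρ H := by
  have hM := h.hM
  have hδ := h.hδ
  by_cases h1 : ρ ≤ 1
  · exact h.low ρ hρ h1
  · have h2 : (1 : ℝ) ≤ ρ ^ α := Real.one_le_rpow (by linarith) h.hα
    have h3 := cn_pos' (by linarith : 0 < ρ) h.tb h.nonempty
    calc (1 : ℝ) ≤ 10 * 1 * 1 := by norm_num
      _ ≤ _ := by gcongr

theorem M_rpow_le (h : Scale δ M α H) (hd : α ≤ d) : M ^ α ≤ M ^ d := by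
  have hM := h.hM
  rw [← Real.rpow_natCast]
  exact Real.rpow_le_rpow_of_exponent_le (by linarith) hd

theorem const_pow_le {M : ℝ} (hM : 10 ≤ M) {c : ℝ} (hc0 : 0 ≤ c) (hc : c ≤ 100) (g : ℕ) :
    c ^ g ≤ M ^ (2 * g) := by
  rw [pow_mul]; gcongr; nlinarith

theorem pow_le_pow' {M : ℝ} (hM : 10 ≤ M) {a b : ℕ} (hab : a ≤ b) : M ^ a ≤ M ^ b :=
  pow_le_pow_right₀ (by linarith) hab

theorem dbl' (h : Scale δ M α H) {ρ : ℝ} (hρ : δ ≤ ρ) : Cov ρ M (H + H) H :=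
  h.dbl.mono hρ le_rfl subset_rfl subset_rfl

theorem cn_add_dbl_le (h : Scale δ M α H) {ρ : ℝ} (hρ : δ ≤ ρ) {T : Set V} (hT : TB T) :
    (cn ρ (T + (H + H)) : ℝ) ≤ M ^ (1 + 2 * growth V) * cn ρ (T + H) := by
  have hδ := h.hδ
  have hM := h.hM
  have hρ0 : 0 < ρ := hδ.trans_le hρ
  have h1 : Cov (ρ + ρ) (1 * M) (T + (H + H)) (T + H) := (Cov.refl hρ0.le le_rfl T).add (h.dbl' hρ)
  have h2 := h1.cn_le hρ0 (hT.add h.tb)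
  have h3 := cn_refine hρ0 (by norm_num : (1 : ℝ) ≤ 3) (hT.add (h.tb.add h.tb))
  rw [show ρ + ρ + ρ = 3 * ρ by ring] at h2
  calc (cn ρ (T + (H + H)) : ℝ) ≤ _ := h3
    _ ≤ (1 * M * cn ρ (T + H)) * M ^ (2 * growth V) := by
      gcongr; exact const_pow_le hM (by norm_num) (by norm_num) _
    _ = _ := by ring

theorem cn_add_add_dbl_le (h : Scale δ M α H) {ρ : ℝ} (hρ : δ ≤ ρ) {T : Set V} (hT : TB T) :
    (cn ρ (T + H + (H + H)) : ℝ) ≤ M ^ (2 + 4 * growth V) * cn ρ (T + H) := by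
  have hM := h.hM
  calc _ ≤ M ^ (1 + 2 * growth V) * cn ρ (T + H + H) := h.cn_add_dbl_le hρ (hT.add h.tb)
    _ ≤ M ^ (1 + 2 * growth V) * (M ^ (1 + 2 * growth V) * cn ρ (T + H)) := by
      rw [add_assoc T]; gcongr; exact h.cn_add_dbl_le hρ hT
    _ = _ := by ring

theorem tb_smul (h : Scale δ M α H) (c : 𝕜) : TB ((fun v => c • v) '' H) := by
  refine tb_of_bounded (R := ‖c‖ * M) ?_
  rintro _ ⟨s, hs, rfl⟩
  simpa only [norm_smul] using mul_le_mul_of_nonneg_left (h.bdd s hs) (norm_nonneg c)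

/-- Quotients of good multipliers are good multipliers at a coarser scale. -/
theorem cov_div (h : Scale δ M α H) (hd : α ≤ d) {m : ℕ} {z z' : 𝕜} (hz : Cov δ M ((fun v => z • v) '' H) H)
    (hz' : Cov δ M ((fun v => z' • v) '' H) H) (hzm : 1 ≤ M ^ m * ‖z‖) (hzM : ‖z‖ ≤ M ^ 3)
    (hzz : ‖z'‖ ≤ 3 * ‖z‖) (hm : M ^ m * δ ≤ 1) :
    Cov (M ^ (m + 3) * δ) (M ^ (11 + 6 * d + 12 * growth V)) ((fun v => (z' / z) • v) '' H) H := by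
  have hδ := h.hδ
  have hM := h.hM
  have hα := h.hα
  have hM0 : 0 < M := by linarith
  set g := growth V
  have hz0 : 0 < ‖z‖ := by
    by_contra hc
    have : ‖z‖ = 0 := le_antisymm (not_lt.1 hc) (norm_nonneg _)
    rw [this] at hzm; norm_num at hzm
  have hδz : δ ≤ ‖z‖ := by
    have : M ^ m * δ ≤ M ^ m * ‖z‖ := hm.trans hzm
    exact le_of_mul_le_mul_left this (by positivity)
  set Z := (fun v => z • v) '' H + (fun v => z' • v) '' H with hZ
  have hZtb : TB Z := (h.tb_smul z).add (h.tb_smul z')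
  set R := 4 * M * ‖z‖ with hR
  set R' := 2 * R + 2 * (3 * δ) with hR'
  set P := H + H with hP
  have hPtb : TB P := h.tb.add h.tb
  -- covering of the sum at scale `δ`
  have e1 : (cn (7 * δ) Z : ℝ) ≤ M ^ 3 * cn δ (P ∩ {p | ‖p‖ ≤ R'}) := by
    have c1 : Cov (δ + δ + δ) (M * M * M) Z H := (hz.add hz').trans h.dbl
    have c2 := c1.local (R := R) (by
      rintro _ ⟨_, ⟨a, ha, rfl⟩, _, ⟨b, hb, rfl⟩, rfl⟩
      calc ‖z • a + z' • b‖ ≤ ‖z‖ * ‖a‖ + ‖z'‖ * ‖b‖ := by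
            rw [← norm_smul, ← norm_smul]; exact norm_add_le _ _
        _ ≤ ‖z‖ * M + (3 * ‖z‖) * M := by
            gcongr
            exacts [h.bdd a ha, h.bdd b hb]
        _ = R := by rw [hR]; ring)
    rw [h.sub_eq, show δ + δ + δ = 3 * δ by ring] at c2
    have c3 := c2.cn_le hδ (hPtb.mono Set.inter_subset_left)
    rw [show 2 * (3 * δ) + δ = 7 * δ by ring] at c3
    rw [show M ^ 3 = M * M * M by ring]
    exact c3
  have e2 : (cn (4 * R') H : ℝ) * cn δ (P ∩ {p | ‖p‖ ≤ R'}) ≤ M ^ (2 + 4 * g) * cn δ H := by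
    have hδR : δ ≤ R' := by
      have : 0 < R := by positivity
      linarith
    have c1 := cn_mul_cn_le hδ hδR h.tb (h.tb.add hPtb)
    have c2 := h.cn_add_add_dbl_le le_rfl (T := {0}) (tb_of_bounded (R := 0) (by simp))
    rw [Set.singleton_zero, zero_add] at c2
    calc (cn (4 * R') H : ℝ) * cn δ (P ∩ {p | ‖p‖ ≤ R'}) ≤ cn δ (H + P) := by exact_mod_cast c1
      _ ≤ _ := c2
  have hMα := h.M_rpow_le hd
  have hMα0 : 0 < M ^ α := by positivity
  have e3 : 1 ≤ M ^ (1 + 3 * d) * ‖z‖ ^ α * cn (4 * R') H := by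
    have c1 : δ ≤ 4 * R' := by
      have : 0 < R := by positivity
      linarith
    have c2 : 4 * R' ≤ M * M * M * ‖z‖ := by
      have : 4 * R' ≤ 56 * M * ‖z‖ := by rw [hR', hR]; nlinarith
      refine this.trans ?_
      gcongr; nlinarith
    calc 1 ≤ M * (4 * R') ^ α * cn (4 * R') H := h.low' c1
      _ ≤ M * (M * M * M * ‖z‖) ^ α * cn (4 * R') H := by gcongr
      _ = M * (M ^ α * M ^ α * M ^ α * ‖z‖ ^ α) * cn (4 * R') H := by
        rw [Real.mul_rpow (by positivity) (by positivity), Real.mul_rpow (by positivity) (by positivity),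
          Real.mul_rpow (by positivity) (by positivity)]
      _ ≤ M * (M ^ d * M ^ d * M ^ d * ‖z‖ ^ α) * cn (4 * R') H := by gcongr
      _ = _ := by ring
  have e4 : δ ^ α * cn (7 * δ) Z ≤ M ^ (7 + 3 * d + 4 * g) * ‖z‖ ^ α := by
    set u := (cn δ (P ∩ {p | ‖p‖ ≤ R'}) : ℝ)
    calc δ ^ α * cn (7 * δ) Z ≤ δ ^ α * (M ^ 3 * u) * 1 := by rw [mul_one]; gcongr
      _ ≤ δ ^ α * (M ^ 3 * u) * (M ^ (1 + 3 * d) * ‖z‖ ^ α * cn (4 * R') H) := by gcongr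
      _ = M ^ (4 + 3 * d) * ‖z‖ ^ α * δ ^ α * (cn (4 * R') H * u) := by ring
      _ ≤ M ^ (4 + 3 * d) * ‖z‖ ^ α * δ ^ α * (M ^ (2 + 4 * g) * cn δ H) := by gcongr
      _ = M ^ (6 + 3 * d + 4 * g) * ‖z‖ ^ α * (δ ^ α * cn δ H) := by ring
      _ ≤ M ^ (6 + 3 * d + 4 * g) * ‖z‖ ^ α * M := by gcongr; exact h.upp
      _ = _ := by ring
  set f := z' / z with hf
  set δ1 := ‖z‖⁻¹ * δ with hδ1
  have hδ10 : 0 < δ1 := by positivity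
  set δ2 := M * M * M * δ1 with hδ2
  have hδ20 : 0 < δ2 := by positivity
  have hδδ2 : δ ≤ δ2 := by
    calc δ = ‖z‖ * δ1 := by rw [hδ1]; field_simp
      _ ≤ M ^ 3 * δ1 := by gcongr
      _ = δ2 := by rw [hδ2]; ring
  have hft := h.tb_smul f
  set Q := (fun v => f • v) '' H with hQ
  have hQH : TB (Q + H) := hft.add h.tb
  have hzne : z ≠ 0 := norm_pos_iff.1 hz0
  have e5 : δ2 ^ α * cn δ2 (Q + H) ≤ M ^ (7 + 6 * d + 4 * g) := by
    have c1 : (cn δ2 (Q + H) : ℝ) ≤ cn (7 * δ) Z := by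
      have c0 : Q + H ⊆ (fun v => z⁻¹ • v) '' Z := by
        rintro _ ⟨_, ⟨a, ha, rfl⟩, b, hb, rfl⟩
        refine ⟨z • b + z' • a, Set.add_mem_add ⟨b, hb, rfl⟩ ⟨a, ha, rfl⟩, ?_⟩
        simp only [smul_add, smul_smul]
        rw [inv_mul_cancel₀ hzne, one_smul, add_comm, hf, div_eq_inv_mul]
      have c2 := cn_smul_le (by positivity : 0 < 7 * δ) hZtb z⁻¹
      have c3 : TB ((fun v => z⁻¹ • v) '' Z) := by
        refine tb_of_bounded (R := ‖z⁻¹‖ * (‖z‖ * M + ‖z'‖ * M)) ?_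
        rintro _ ⟨_, ⟨_, ⟨a, ha, rfl⟩, _, ⟨b, hb, rfl⟩, rfl⟩, rfl⟩
        simp only [norm_smul]
        gcongr
        refine (norm_add_le _ _).trans ?_
        rw [norm_smul, norm_smul]
        gcongr
        exacts [h.bdd a ha, h.bdd b hb]
      have c4 := cn_mono (δ := ‖z⁻¹‖ * (7 * δ)) (δ' := δ2) (by rw [norm_inv]; positivity) c3 c0 (by
        rw [norm_inv, hδ2, show ‖z‖⁻¹ * (7 * δ) = 7 * δ1 by rw [hδ1]; ring]
        gcongr; nlinarith)
      exact_mod_cast c4.trans c2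
    have c5 : δ2 ^ α = M ^ α * M ^ α * M ^ α * ((‖z‖ ^ α)⁻¹ * δ ^ α) := by
      rw [hδ2, hδ1, Real.mul_rpow (by positivity) (by positivity), Real.mul_rpow (by positivity) (by positivity),
          Real.mul_rpow (by positivity) (by positivity), Real.mul_rpow (by positivity) (by positivity),
          Real.inv_rpow (by positivity)]
    calc δ2 ^ α * cn δ2 (Q + H) ≤ δ2 ^ α * cn (7 * δ) Z := by gcongr
      _ = M ^ α * M ^ α * M ^ α * (‖z‖ ^ α)⁻¹ * (δ ^ α * cn (7 * δ) Z) := by rw [c5]; ring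
      _ ≤ M ^ d * M ^ d * M ^ d * (‖z‖ ^ α)⁻¹ * (M ^ (7 + 3 * d + 4 * g) * ‖z‖ ^ α) := by gcongr
      _ = (M ^ d * M ^ d * M ^ d * M ^ (7 + 3 * d + 4 * g)) * ((‖z‖ ^ α)⁻¹ * ‖z‖ ^ α) := by ring
      _ = _ := by rw [inv_mul_cancel₀ (by positivity)]; ring
  set δs := M ^ (m + 3) * δ with hδs
  have hδs0 : 0 < δs := by positivity
  have hδ2s : δ2 ≤ δs := by
    rw [hδ2, hδs, hδ1]
    have : ‖z‖⁻¹ ≤ M ^ m := by rw [inv_le_iff_one_le_mul₀ hz0]; exact hzm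
    calc M * M * M * (‖z‖⁻¹ * δ) ≤ M * M * M * (M ^ m * δ) := by gcongr
      _ = _ := by ring
  have e6 : (cn (8 * δs) (Q + H) : ℝ) ≤ M ^ (10 + 6 * d + 8 * g) * cn δs H := by
    set b := (cn δ2 (P ∩ {p | ‖p‖ ≤ 2 * δs}) : ℝ) with hb
    have c1 : (cn (8 * δs) (Q + H) : ℝ) * b ≤ cn δ2 (Q + H + P) := by
      have := cn_mul_cn_le (ρ := 2 * δs) hδ20 (by linarith) hQH (hQH.add hPtb)
      rw [show 4 * (2 * δs) = 8 * δs by ring] at this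
      rw [hb]; exact_mod_cast this
    have c2 := h.cn_add_add_dbl_le hδδ2 hft
    have c3 : (cn δ2 H : ℝ) ≤ cn δs H * b := by
      have := h.tb.cn_le_mul hδ20 hδs0 (h.tb.sub h.tb)
      rw [h.sub_eq] at this
      rw [hb]; exact_mod_cast this
    have c4 := h.low' hδδ2
    set X := (cn (8 * δs) (Q + H) : ℝ)
    calc X = X * 1 := (mul_one _).symm
      _ ≤ X * (M * δ2 ^ α * cn δ2 H) := by gcongr
      _ ≤ X * (M * δ2 ^ α * (cn δs H * b)) := by gcongr
      _ = M * δ2 ^ α * cn δs H * (X * b) := by ring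
      _ ≤ M * δ2 ^ α * cn δs H * (M ^ (2 + 4 * g) * cn δ2 (Q + H)) :=
        mul_le_mul_of_nonneg_left (c1.trans c2) (by positivity)
      _ = M ^ (3 + 4 * g) * cn δs H * (δ2 ^ α * cn δ2 (Q + H)) := by ring
      _ ≤ M ^ (3 + 4 * g) * cn δs H * M ^ (7 + 6 * d + 4 * g) := by gcongr
      _ = _ := by ring
  have e7 : (cn δs H : ℝ) ≤ cn (8 * δs) H * M ^ (2 * g) :=
    (cn_refine hδs0 (by norm_num : (1 : ℝ) ≤ 8) h.tb).trans (by
      gcongr; exact const_pow_le hM (by norm_num) (by norm_num) _)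
  have e8 := ruzsa_cov (δ := 8 * δs) (by positivity) hQH h.tb h.nonempty
  rw [h.sub_eq] at e8
  have e9 : (cn (8 * δs) (Q + H) : ℝ) / cn (8 * δs) H ≤ M ^ (10 + 6 * d + 10 * g) := by
    have := cn_pos' (by positivity : 0 < 8 * δs) h.tb h.nonempty
    rw [div_le_iff₀ (by linarith)]
    calc _ ≤ _ := e6
      _ ≤ M ^ (10 + 6 * d + 8 * g) * (cn (8 * δs) H * M ^ (2 * g)) := by gcongr
      _ = _ := by ring
  have e10 : Cov (17 * δs) (M ^ (11 + 6 * d + 10 * g)) Q H :=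
    (e8.trans (h.dbl' (hδδ2.trans hδ2s))).mono (by linarith) (by
      calc _ ≤ M ^ (10 + 6 * d + 10 * g) * M := by gcongr
        _ = _ := by ring) subset_rfl subset_rfl
  refine (e10.refine hδs0 (by norm_num : (1 : ℝ) ≤ 17)).mono le_rfl ?_ subset_rfl subset_rfl
  calc _ ≤ M ^ (11 + 6 * d + 10 * g) * M ^ (2 * g) := by
        gcongr; exact const_pow_le hM (by norm_num) (by norm_num) _
    _ = _ := by ring

end Scale

end FreimanGrowth

section FreimanGrowth

variable {V : Type*} [NormedAddCommGroup V]
variable {𝕜 : Type*} [RCLike 𝕜] [NormedSpace 𝕜 V] [NormedSpace ℝ V] [FiniteDimensional ℝ V]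

/-- Functionals whose values on `H + H` are good multipliers. -/
structure Functionals (𝕜 : Type*) [RCLike 𝕜] [NormedSpace 𝕜 V] {ι : Type*} (δ M : ℝ) (H : Set V)
    (l : ι → V →L[𝕜] 𝕜) : Prop where
  bdd : ∀ i v, ‖l i v‖ ≤ M * ‖v‖
  nondeg : ∀ v, ∃ i, ‖v‖ ≤ M * ‖l i v‖
  cov : ∀ i, ∀ w ∈ H + H, Cov δ M ((fun v => l i w • v) '' H) H

namespace Scale

variable {δ M α : ℝ} {H : Set V} {d : ℕ}

theorem add_bdd (h : Scale δ M α H) : ∀ v ∈ H + H, ‖v‖ ≤ 2 * M := by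
  rintro _ ⟨a, ha, b, hb, rfl⟩
  exact (norm_add_le _ _).trans (by linarith [h.bdd a ha, h.bdd b hb])

/-- `f` is a good multiplier of size at most `3`. -/
def Good (M : ℝ) (m c : ℕ) (δ : ℝ) (H : Set V) (f : 𝕜) : Prop :=
  ‖f‖ ≤ 3 ∧ Cov (M ^ (m + 3) * δ) (M ^ c) ((fun v => f • v) '' H) H

theorem exists_good_near (h : Scale δ M α H) (hd : α ≤ d) {κ : ℝ} (hκα : κ ≤ α) {ι : Type*}
    {l : ι → V →L[𝕜] 𝕜} (hl : Functionals 𝕜 δ M H l) {m : ℕ}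
    (hm : 16 + 6 * d + 14 * growth V ≤ κ * m) (hMδ : M ^ (2 * m + 8) * δ ≤ 1)
    {f e : 𝕜} (hf : Good M (m + 1) (11 + 6 * d + 12 * growth V) δ H f) (he : e = 0 ∨ e = 1) :
    ∃ f' : 𝕜, Good M (m + 1) (11 + 6 * d + 12 * growth V) δ H f' ∧
      ‖(f + e) / 2 - f'‖ ≤ M ^ (2 * m + 7) * δ := by
  have hδ := h.hδ
  have hM := h.hM
  have hα := h.hα
  have hM0 : 0 < M := by linarith
  set g := growth V
  set c1 := 11 + 6 * d + 12 * g with hc1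
  set δs := M ^ (m + 1 + 3) * δ with hδs
  have hδs0 : 0 < δs := by positivity
  have hδδs : δ ≤ δs := le_mul_of_one_le_left hδ.le (one_le_pow₀ (by linarith))
  set k := (f + e) / 2 with hk
  have hft := h.tb_smul f
  have hkt := h.tb_smul k
  have he1 : ‖e‖ ≤ 1 := by rcases he with rfl | rfl <;> simp
  have hk2 : ‖k‖ ≤ 2 := by
    rw [hk, norm_div, RCLike.norm_ofNat, div_le_iff₀ (by norm_num)]
    exact (norm_add_le _ _).trans (by linarith [hf.1])
  set T := (H + H) + ((fun v => f • v) '' H + H) with hT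
  have hTt : TB T := (h.tb.add h.tb).add (hft.add h.tb)
  have hsub : H + (fun v => k • v) '' H ⊆ (fun v => (2⁻¹ : 𝕜) • v) '' T := by
    rintro _ ⟨a, ha, _, ⟨b, hb, rfl⟩, rfl⟩
    refine ⟨(a + a) + (f • b + e • b), Set.add_mem_add (Set.add_mem_add ha ha)
      (Set.add_mem_add ⟨b, hb, rfl⟩ ?_), ?_⟩
    · rcases he with rfl | rfl
      · rw [zero_smul]; exact h.zero_mem
      · rwa [one_smul]
    · show (2⁻¹ : 𝕜) • ((a + a) + (f • b + e • b)) = a + k • b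
      rw [← two_smul 𝕜 a, ← add_smul, smul_add, smul_smul, smul_smul, inv_mul_cancel₀ two_ne_zero,
        one_smul, hk, div_eq_inv_mul]
  have e1 : Cov (5 * δs) (M ^ (c1 + 3)) T H := by
    have c1 := (hf.2.add (Cov.refl hδs0.le le_rfl H)).trans (h.dbl' hδδs)
    have c2 := ((h.dbl' hδδs).add c1).trans (h.dbl' hδδs)
    refine c2.mono (le_of_eq (by ring)) (le_of_eq (by ring)) subset_rfl subset_rfl
  have e2 : (cn δs (H + (fun v => k • v) '' H) : ℝ) ≤ M ^ (14 + 6 * d + 14 * g) * cn δs H := by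
    have c1' := e1.cn_le hδs0 h.tb
    have c2 := cn_smul_le (by positivity : 0 < 6 * δs) hTt (2⁻¹ : 𝕜)
    have c3 : TB ((fun v => (2⁻¹ : 𝕜) • v) '' T) := by
      refine tb_of_bounded (R := 2 * M + 2 * M + ‖f‖ * M + M) ?_
      rintro _ ⟨_, ⟨a, ha, _, ⟨_, ⟨b, hb, rfl⟩, b', hb', rfl⟩, rfl⟩, rfl⟩
      simp only [norm_smul]
      have h1 : ‖(2⁻¹ : 𝕜)‖ ≤ 1 := by rw [norm_inv, RCLike.norm_ofNat]; norm_num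
      have h2 : ‖a + (f • b + b')‖ ≤ 2 * M + (‖f‖ * M + M) := by
        refine (norm_add_le _ _).trans (add_le_add (h.add_bdd a ha) ((norm_add_le _ _).trans ?_))
        rw [norm_smul]; gcongr
        exacts [h.bdd b hb, h.bdd b' hb']
      calc _ ≤ 1 * (2 * M + (‖f‖ * M + M)) := by gcongr
        _ ≤ _ := by linarith
    have hn : ‖(2⁻¹ : 𝕜)‖ * (6 * δs) = 3 * δs := by
      rw [norm_inv, RCLike.norm_ofNat]; ring
    rw [hn] at c2
    have c4 := (cn_mono (by positivity) c3 hsub le_rfl).trans c2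
    have c5 := cn_refine hδs0 (by norm_num : (1 : ℝ) ≤ 3) (h.tb.add hkt)
    calc (cn δs (H + (fun v => k • v) '' H) : ℝ) ≤ _ := c5
      _ ≤ cn (6 * δs) T * M ^ (2 * g) := by
        gcongr
        exact const_pow_le hM (by norm_num) (by norm_num) _
      _ ≤ (M ^ (c1 + 3) * cn δs H) * M ^ (2 * g) := by
        gcongr
        rwa [show 5 * δs + δs = 6 * δs by ring] at c1'
      _ = _ := by rw [hc1]; ring
  set ρ := (M ^ m)⁻¹ with hρ
  have hρ0 : 0 < ρ := by positivity
  have hρ1 : ρ ≤ 1 := inv_le_one_of_one_le₀ (one_le_pow₀ (by linarith))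
  have hδρ : δ ≤ ρ := by
    rw [hρ, ← one_div, le_div_iff₀ (by positivity), mul_comm]
    refine le_trans ?_ hMδ
    gcongr
    · linarith
    · omega
  obtain ⟨B, hBH, hsep, hnet⟩ := exists_sep hρ0 h.tb
  have e3 : M ^ (14 + 6 * d + 14 * g) < B.card := by
    have c1 := h.low' hδρ
    have c2 : ρ ^ α ≤ (M ^ (16 + 6 * d + 14 * g))⁻¹ := by
      calc ρ ^ α ≤ ρ ^ κ := Real.rpow_le_rpow_of_exponent_ge hρ0 hρ1 hκα
        _ = (M ^ (κ * m))⁻¹ := by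
          rw [hρ, Real.inv_rpow (by positivity), ← Real.rpow_natCast, ← Real.rpow_mul hM0.le, mul_comm]
        _ ≤ _ := by
          rw [← Real.rpow_natCast]
          gcongr
          · linarith
          · push_cast; exact hm
    have c3 : (cn ρ H : ℝ) ≤ B.card := by exact_mod_cast cn_le hnet
    have c4 : 1 ≤ M * (M ^ (16 + 6 * d + 14 * g))⁻¹ * B.card := by
      refine c1.trans ?_
      gcongr
    have c5 : M ^ (16 + 6 * d + 14 * g) ≤ M * B.card := by
      calc M ^ (16 + 6 * d + 14 * g) ≤ M ^ (16 + 6 * d + 14 * g) * (M * (M ^ (16 + 6 * d + 14 * g))⁻¹ * B.card) :=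
            le_mul_of_one_le_right (by positivity) c4
        _ = _ := by field_simp
    have c6 : M ^ (15 + 6 * d + 14 * g) ≤ B.card := by
      refine le_of_mul_le_mul_left ?_ hM0
      calc _ = M ^ (16 + 6 * d + 14 * g) := by ring
        _ ≤ _ := c5
    refine lt_of_lt_of_le ?_ c6
    exact pow_lt_pow_right₀ (by linarith) (by omega)
  have e4 : cn δs (H + (fun v => k • v) '' H) < B.card * cn δs H := by
    have c1 := cn_pos' hδs0 h.tb h.nonempty
    have : (cn δs (H + (fun v => k • v) '' H) : ℝ) < B.card * cn δs H :=
      lt_of_le_of_lt e2 (by gcongr)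
    exact_mod_cast this
  obtain ⟨b, hb, b', hb', hne, a, ha, a', ha', hcol⟩ :=
    exists_collision hδs0 hBH (h.tb.add hkt) e4
  have hw : b - b' ∈ H + H := h.sub_eq ▸ Set.sub_mem_sub (hBH b hb) (hBH b' hb')
  have hw' : a' - a ∈ H + H := h.sub_eq ▸ Set.sub_mem_sub ha' ha
  set w := b - b'
  set w' := a' - a
  have hwρ : ρ < ‖w‖ := not_le.1 fun hc => hne (hsep b hb b' hb' hc)
  obtain ⟨i, hi⟩ := hl.nondeg w
  set z := l i w
  set z' := l i w'
  have hz1 : 1 ≤ M ^ (m + 1) * ‖z‖ := by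
    calc 1 = M ^ m * ρ := by rw [hρ, mul_inv_cancel₀ (by positivity)]
      _ ≤ M ^ m * (M * ‖z‖) := by gcongr; exact hwρ.le.trans hi
      _ = _ := by ring
  have hz0 : z ≠ 0 := fun hc => by rw [hc] at hz1; norm_num at hz1
  have hzp : 0 < ‖z‖ := norm_pos_iff.2 hz0
  have hzM : ‖z‖ ≤ M ^ 3 := by
    calc ‖z‖ ≤ M * ‖w‖ := hl.bdd i w
      _ ≤ M * (2 * M) := by gcongr; exact h.add_bdd w hw
      _ ≤ _ := by nlinarith [sq_nonneg M, mul_pos hM0 hM0]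
  have hzz : ‖k * z - z'‖ ≤ M * (2 * δs) := by
    have : k * z - z' = l i ((fun v => k • v) b - (fun v => k • v) b' - w') := by
      simp only [map_sub, map_smul, smul_eq_mul, z, z', w]
      ring
    rw [this]
    exact (hl.bdd i _).trans (by gcongr)
  have hr : ‖k - z' / z‖ ≤ M ^ (2 * m + 7) * δ := by
    have : k - z' / z = (k * z - z') / z := by field_simp
    rw [this, norm_div, div_le_iff₀ hzp]
    calc _ ≤ M * (2 * δs) * 1 := by rw [mul_one]; exact hzz
      _ ≤ M * (2 * δs) * (M ^ (m + 1) * ‖z‖) := by gcongr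
      _ = 2 * (M ^ (2 * m + 6) * δ * ‖z‖) := by rw [hδs]; ring
      _ ≤ M * (M ^ (2 * m + 6) * δ * ‖z‖) := by gcongr; linarith
      _ = _ := by ring
  have hr1 : M ^ (2 * m + 7) * δ ≤ 1 :=
    (mul_le_mul_of_nonneg_right (pow_le_pow' hM (by omega)) hδ.le).trans hMδ
  have hf3 : ‖z' / z‖ ≤ 3 := by
    calc ‖z' / z‖ = ‖k - (k - z' / z)‖ := by congr 1; abel
      _ ≤ 2 + 1 := (norm_sub_le _ _).trans (add_le_add hk2 (hr.trans hr1))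
      _ = 3 := by norm_num
  refine ⟨z' / z, ⟨hf3, ?_⟩, hr⟩
  refine h.cov_div hd (hl.cov i w hw) (hl.cov i w' hw') hz1 hzM ?_ ?_
  · rwa [norm_div, div_le_iff₀ hzp] at hf3
  · exact (mul_le_mul_of_nonneg_right (pow_le_pow' hM (by omega)) hδ.le).trans hMδ

theorem exists_good_near_real (h : Scale δ M α H) (hd : α ≤ d) {κ : ℝ} (hκα : κ ≤ α) {ι : Type*}
    {l : ι → V →L[𝕜] 𝕜} (hl : Functionals 𝕜 δ M H l) {m : ℕ}
    (hm : 16 + 6 * d + 14 * growth V ≤ κ * m) (hMδ : M ^ (2 * m + 8) * δ ≤ 1)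
    {t : ℝ} (ht : t ∈ Set.Icc (0 : ℝ) 1) :
    ∃ f : 𝕜, Good M (m + 1) (11 + 6 * d + 12 * growth V) δ H f ∧
      ‖(t : 𝕜) - f‖ ≤ 3 * (M ^ (2 * m + 7) * δ) := by
  have hδ := h.hδ
  have hM := h.hM
  have hM0 : 0 < M := by linarith
  set r := M ^ (2 * m + 7) * δ with hr
  have hr0 : 0 < r := by positivity
  have key : ∀ (k : ℕ) (t : ℝ), t ∈ Set.Icc (0 : ℝ) 1 →
      ∃ f : 𝕜, Good M (m + 1) (11 + 6 * d + 12 * growth V) δ H f ∧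
      ‖(t : 𝕜) - f‖ ≤ (1 / 2) ^ k + 2 * r := by
    intro k
    induction k with
    | zero =>
      intro t ht
      refine ⟨0, ⟨by simp, ?_⟩, ?_⟩
      · refine (Cov.refl (L := M ^ (11 + 6 * d + 12 * growth V)) (by positivity)
          (one_le_pow₀ (by linarith)) H).mono le_rfl le_rfl ?_ subset_rfl
        rintro _ ⟨v, -, rfl⟩
        simpa using h.zero_mem
      · rw [sub_zero, RCLike.norm_ofReal, abs_of_nonneg ht.1]
        have := ht.2
        simp only [pow_zero]; linarith
    | succ k ih =>
      intro t ht
      obtain ⟨s, hs, e, he, hte⟩ : ∃ s ∈ Set.Icc (0 : ℝ) 1, ∃ e : 𝕜, (e = 0 ∨ e = 1) ∧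
          (t : 𝕜) = ((s : 𝕜) + e) / 2 := by
        rcases le_total t (1 / 2) with h1 | h1
        · exact ⟨2 * t, ⟨by linarith [ht.1], by linarith⟩, 0, Or.inl rfl, by push_cast; ring⟩
        · exact ⟨2 * t - 1, ⟨by linarith, by linarith [ht.2]⟩, 1, Or.inr rfl, by push_cast; ring⟩
      obtain ⟨f, hf, hfs⟩ := ih s hs
      obtain ⟨f', hf', hff⟩ := h.exists_good_near hd hκα hl hm hMδ hf he
      refine ⟨f', hf', ?_⟩
      have h2 : ‖((s : 𝕜) - f) / 2‖ ≤ ((1 / 2) ^ k + 2 * r) / 2 := by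
        rw [norm_div, RCLike.norm_ofNat]; gcongr
      calc ‖(t : 𝕜) - f'‖ = ‖((s : 𝕜) - f) / 2 + ((f + e) / 2 - f')‖ := by
            rw [hte]; congr 1; ring
        _ ≤ ((1 / 2) ^ k + 2 * r) / 2 + r := (norm_add_le _ _).trans (add_le_add h2 hff)
        _ = _ := by ring
  obtain ⟨k, hk⟩ := exists_pow_lt_of_lt_one hr0 (by norm_num : (1 / 2 : ℝ) < 1)
  obtain ⟨f, hf, hft⟩ := key k t ht
  exact ⟨f, hf, hft.trans (by linarith)⟩

theorem cov_real_smul (h : Scale δ M α H) (hd : α ≤ d) {κ : ℝ} (hκα : κ ≤ α) {ι : Type*}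
    {l : ι → V →L[𝕜] 𝕜} (hl : Functionals 𝕜 δ M H l) {m : ℕ}
    (hm : 16 + 6 * d + 14 * growth V ≤ κ * m) (hMδ : M ^ (2 * m + 8) * δ ≤ 1)
    {t : ℝ} (ht : t ∈ Set.Icc (0 : ℝ) 1) :
    Cov (M ^ (2 * m + 9) * δ) (M ^ (11 + 6 * d + 12 * growth V))
      ((fun v => (t : 𝕜) • v) '' H) H := by
  have hδ := h.hδ
  have hM := h.hM
  have hM0 : 0 < M := by linarith
  obtain ⟨f, ⟨-, X, hX, hc⟩, hf⟩ := h.exists_good_near_real hd hκα hl hm hMδ ht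
  refine ⟨X, hX, ?_⟩
  rintro _ ⟨v, hv, rfl⟩
  obtain ⟨x, hx, s', hs', hh⟩ := hc _ ⟨v, hv, rfl⟩
  refine ⟨x, hx, s', hs', ?_⟩
  calc ‖(t : 𝕜) • v - (x + s')‖ = ‖((t : 𝕜) - f) • v + (f • v - (x + s'))‖ := by
        rw [sub_smul]; congr 1; abel
    _ ≤ 3 * (M ^ (2 * m + 7) * δ) * M + M ^ (m + 1 + 3) * δ := by
      refine (norm_add_le _ _).trans (add_le_add ?_ hh)
      rw [norm_smul]
      gcongr
      exact h.bdd v hv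
    _ ≤ 3 * (M ^ (2 * m + 7) * δ) * M + M ^ (2 * m + 8) * δ :=
      add_le_add le_rfl (mul_le_mul_of_nonneg_right
        (pow_le_pow' hM (show m + 1 + 3 ≤ 2 * m + 8 by omega)) hδ.le)
    _ = 4 * (M ^ (2 * m + 8) * δ) := by ring
    _ ≤ M * (M ^ (2 * m + 8) * δ) := by gcongr; linarith
    _ = _ := by ring

end Scale

end FreimanGrowth

section FreimanGrowth

open MeasureTheory in
theorem volume_slab_le {V : Type*} [NormedAddCommGroup V] [NormedSpace ℝ V] [FiniteDimensional ℝ V]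
    {J : Type*} [Fintype J] (T : (J → ℝ) →ₗ[ℝ] V) {a s : ℝ} (ha : 0 < a) (hs : 0 < s)
    (hT : ∀ v : V, ‖v‖ ≤ a → ∃ γ : J → ℝ, T γ = v ∧ ∀ j, |γ j| ≤ 1) (y : V) :
    volume.real {t : J → ℝ | t ∈ Set.Icc 0 1 ∧ ‖T t - y‖ ≤ s} * a ^ Module.finrank ℝ V ≤
      3 ^ Fintype.card J * (3 * s) ^ Module.finrank ℝ V := by
  classical
  let _ : MeasurableSpace V := borel V
  have _ : BorelSpace V := ⟨rfl⟩
  set d := Module.finrank ℝ V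
  set E := {t : J → ℝ | t ∈ Set.Icc 0 1 ∧ ‖T t - y‖ ≤ s} with hE
  have hTc : Continuous T := T.continuous_of_finiteDimensional
  have hEm : MeasurableSet E := by
    refine IsClosed.measurableSet (isClosed_Icc.inter ?_)
    exact isClosed_le (hTc.sub continuous_const).norm continuous_const
  obtain ⟨Λ, hΛ, hsep, hnet⟩ := exists_sep (V := V) (ρ := 3 * s) (S := {v | ‖v‖ ≤ a}) (by positivity)
    (tb_of_bounded fun v hv => hv)
  have hcard : a ^ d ≤ Λ.card * (3 * s) ^ d := by
    set μ := (Measure.addHaar : Measure V)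
    have hc : Metric.closedBall (0 : V) a ⊆ ⋃ x ∈ Λ, Metric.closedBall x (3 * s) := fun v hv => by
      obtain ⟨x, hx, h⟩ := hnet v (mem_closedBall_zero_iff.1 hv)
      exact Set.mem_iUnion₂.2 ⟨x, hx, by rwa [Metric.mem_closedBall, dist_eq_norm]⟩
    have h1 := (measure_mono hc).trans (measure_biUnion_finset_le (μ := μ) Λ _)
    simp only [Measure.addHaar_closedBall μ _ ha.le, Measure.addHaar_closedBall μ _
      (by positivity : 0 ≤ 3 * s), Finset.sum_const, nsmul_eq_mul] at h1
    rw [← mul_assoc] at h1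
    have h0 : μ (Metric.ball 0 1) ≠ 0 := (Metric.measure_ball_pos μ _ one_pos).ne'
    have h0' : μ (Metric.ball 0 1) ≠ ⊤ := measure_ball_lt_top.ne
    have h2 := (ENNReal.mul_le_mul_iff_left h0 h0').1 h1
    rw [← ENNReal.ofReal_natCast, ← ENNReal.ofReal_mul (by positivity)] at h2
    exact (ENNReal.ofReal_le_ofReal_iff (by positivity)).1 h2
  have hγ : ∀ v : V, ∃ γ : J → ℝ, ‖v‖ ≤ a → T γ = v ∧ ∀ j, |γ j| ≤ 1 := fun v => by
    by_cases hv : ‖v‖ ≤ a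
    · obtain ⟨γ, h⟩ := hT v hv; exact ⟨γ, fun _ => h⟩
    · exact ⟨0, fun h => (hv h).elim⟩
  choose γ hγ using hγ
  have hvol : Λ.card * volume.real E ≤ 3 ^ Fintype.card J := by
    have hd : (Λ : Set V).PairwiseDisjoint fun v => (fun t : J → ℝ => t - γ v) ⁻¹' E := by
      intro v hv v' hv' hne
      refine Set.disjoint_left.2 fun t ht ht' => hne (hsep v hv v' hv' ?_)
      have h1 := ht.2
      have h2 := ht'.2
      rw [map_sub, (hγ v (hΛ v hv)).1] at h1
      rw [map_sub, (hγ v' (hΛ v' hv')).1] at h2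
      calc ‖v - v'‖ = ‖(T t - v' - y) - (T t - v - y)‖ := by congr 1; abel
        _ ≤ s + s := (norm_sub_le _ _).trans (add_le_add h2 h1)
        _ ≤ _ := by linarith
    have hsub : (⋃ v ∈ Λ, (fun t : J → ℝ => t - γ v) ⁻¹' E) ⊆ Set.Icc (-1) 2 := by
      refine Set.iUnion₂_subset fun v hv t ht => ?_
      have h1 := ht.1
      have h2 := (hγ v (hΛ v hv)).2
      constructor <;> intro j
      · have := h1.1 j; have := (abs_le.1 (h2 j)).1; simp at *; linarith
      · have := h1.2 j; have := (abs_le.1 (h2 j)).2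
        simp at *; linarith
    have h3 : volume (Set.Icc (-1 : J → ℝ) 2) = ENNReal.ofReal (3 ^ Fintype.card J) := by
      rw [Real.volume_Icc_pi]
      simp only [Pi.ofNat_apply, Pi.neg_apply]
      rw [Finset.prod_const, ← ENNReal.ofReal_pow (by norm_num), Finset.card_univ]
      norm_num
    have h4 : ∀ v, volume ((fun t : J → ℝ => t - γ v) ⁻¹' E) = volume E := fun v => by
      exact (measurePreserving_sub_right volume (γ v)).measure_preimage hEm.nullMeasurableSet
    have h5 := measure_mono (μ := (volume : Measure (J → ℝ))) hsub
    rw [measure_biUnion_finset hd fun v _ => hEm.preimage (by fun_prop), h3] at h5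
    simp only [h4, Finset.sum_const, nsmul_eq_mul] at h5
    have h6 := ENNReal.toReal_mono ENNReal.ofReal_ne_top h5
    rwa [ENNReal.toReal_mul, ENNReal.toReal_natCast, ENNReal.toReal_ofReal (by positivity)] at h6
  calc volume.real E * a ^ d ≤ volume.real E * (Λ.card * (3 * s) ^ d) := by gcongr
    _ = Λ.card * volume.real E * (3 * s) ^ d := by ring
    _ ≤ _ := by gcongr

variable {V : Type*} [NormedAddCommGroup V]
variable {𝕜 : Type*} [RCLike 𝕜] [NormedSpace 𝕜 V] [NormedSpace ℝ V] [FiniteDimensional ℝ V]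
  [IsScalarTower ℝ 𝕜 V]

/-- A family of good operators which spans all operators. -/
structure Operators {J : Type*} [Fintype J] (δ M : ℝ) (H : Set V) (r : J → V →L[𝕜] V) : Prop where
  bdd : ∀ j, ‖r j‖ ≤ M
  cov : ∀ j, Cov δ M (r j '' H) H
  span : ∀ G : V →L[𝕜] V, ∃ γ : J → ℝ, G = ∑ j, (γ j : 𝕜) • r j ∧ ∀ j, |γ j| ≤ M * ‖G‖

namespace Scale

variable {δ M α : ℝ} {H : Set V} {d : ℕ}

theorem exists_preimage {J : Type*} [Fintype J] {r : J → V →L[𝕜] V} (hr : Operators δ M H r)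
    (hM : 0 < M) {w : V} {ρ : ℝ} (hρ : 0 < ρ) (hw : ρ < ‖w‖) {v : V} (hv : ‖v‖ ≤ ρ / M) :
    ∃ γ : J → ℝ, ∑ j, (γ j : 𝕜) • r j w = v ∧ ∀ j, |γ j| ≤ 1 := by
  have hw0 : w ≠ 0 := fun h => by rw [h, norm_zero] at hw; linarith
  have hwp : 0 < ‖w‖ := hρ.trans hw
  obtain ⟨g, hg, hgw⟩ := exists_dual_vector 𝕜 w hwp.ne'
  set G : V →L[𝕜] V := ((‖w‖⁻¹ : ℝ) : 𝕜) • g.smulRight v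
  obtain ⟨γ, hγ, hb⟩ := hr.span G
  refine ⟨γ, ?_, fun j => (hb j).trans ?_⟩
  · have h1 := congrArg (fun F : V →L[𝕜] V => F w) hγ
    simp only [_root_.sum_apply, _root_.smul_apply] at h1
    rw [← h1]
    simp only [G, _root_.smul_apply, ContinuousLinearMap.smulRight_apply, hgw, smul_smul]
    rw [← RCLike.ofReal_mul, inv_mul_cancel₀ hwp.ne', RCLike.ofReal_one, one_smul]
  · have h2 : ‖G‖ ≤ ‖w‖⁻¹ * ‖v‖ := by
      rw [norm_smul, ContinuousLinearMap.norm_smulRight_apply, hg, one_mul, RCLike.norm_ofReal,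
        abs_of_pos (by positivity)]
    calc M * ‖G‖ ≤ M * (ρ⁻¹ * (ρ / M)) := by gcongr; exact h2.trans (by gcongr)
      _ = 1 := by field_simp

theorem cov_sum (h : Scale δ M α H) {J : Type*} [Fintype J] {r : J → V →L[𝕜] V}
    (hr : Operators δ M H r) {m c : ℕ} (hdil : ∀ t ∈ Set.Icc (0 : ℝ) 1,
      Cov (M ^ m * δ) (M ^ c) ((fun v => (t : 𝕜) • v) '' H) H) {t : J → ℝ} (ht : t ∈ Set.Icc 0 1)
    (s : Finset J) : Cov (s.card * (2 * (M ^ (m + 2) * δ))) (M ^ ((c + 2) * s.card))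
      ((fun v => ∑ j ∈ s, (t j : 𝕜) • r j v) '' H) H := by
  classical
  have hδ := h.hδ
  have hM := h.hM
  have hM0 : 0 < M := by linarith
  induction s using Finset.induction_on with
  | empty =>
    refine (Cov.refl le_rfl le_rfl H).mono (by simp) (by simp) ?_ subset_rfl
    rintro _ ⟨v, -, rfl⟩
    simpa using h.zero_mem
  | insert i s his ih =>
    set η := M ^ (m + 2) * δ with hη
    have hδη : δ ≤ η := le_mul_of_one_le_left hδ.le (one_le_pow₀ (by linarith))
    have e1 : Cov η (M ^ (c + 1)) ((r i) '' ((fun v => (t i : 𝕜) • v) '' H)) H := by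
      refine (((hdil (t i) ⟨ht.1 i, ht.2 i⟩).image (r i) (fun x y => map_add _ _ _)
        (fun x => ((r i).le_opNorm x).trans (mul_le_mul_of_nonneg_right (hr.bdd i) (norm_nonneg _)))
        hM0.le).trans (hr.cov i)).mono ?_ (le_of_eq (pow_succ _ _).symm) subset_rfl subset_rfl
      have : δ ≤ M ^ (m + 1) * δ := le_mul_of_one_le_left hδ.le (one_le_pow₀ (by linarith))
      calc M * (M ^ m * δ) + δ ≤ M * (M ^ m * δ) + M ^ (m + 1) * δ := by gcongr
        _ = 2 * (M ^ (m + 1) * δ) := by ring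
        _ ≤ M * (M ^ (m + 1) * δ) := by gcongr; linarith
        _ = _ := by rw [hη]; ring
    have e2 := (e1.add ih).trans (h.dbl' hδη)
    rw [Finset.card_insert_of_notMem his]
    refine e2.mono (le_of_eq (by push_cast; ring)) (le_of_eq (by ring)) ?_ subset_rfl
    rintro _ ⟨v, hv, rfl⟩
    refine Set.mem_add.2 ⟨_, ⟨_, ⟨v, hv, rfl⟩, rfl⟩, _, ⟨v, hv, rfl⟩, ?_⟩
    simp only [Finset.sum_insert his, map_smul]

end Scale

end FreimanGrowth

section FreimanGrowth

variable {V : Type*} [NormedAddCommGroup V]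
variable {𝕜 : Type*} [RCLike 𝕜] [NormedSpace 𝕜 V] [NormedSpace ℝ V] [FiniteDimensional ℝ V]
  [IsScalarTower ℝ 𝕜 V]

namespace Scale

variable {δ M α : ℝ} {H : Set V} {d : ℕ}

/-- A set with many good multipliers and operators has full dimension. -/
theorem rpow_le (h : Scale δ M α H) (hd : α ≤ Module.finrank ℝ V) {κ : ℝ} (hκα : κ ≤ α) {ι : Type*}
    {l : ι → V →L[𝕜] 𝕜} (hl : Functionals 𝕜 δ M H l) {J : Type*} [Fintype J] {r : J → V →L[𝕜] V}
    (hr : Operators δ M H r) (hJ : (3 : ℝ) ^ Fintype.card J ≤ M) {m m2 : ℕ}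
    (hm : 16 + 6 * Module.finrank ℝ V + 14 * growth V ≤ κ * m)
    (hm2 : (13 + 6 * Module.finrank ℝ V + 12 * growth V) * Fintype.card J + 4 + 2 * growth V ≤ κ * m2)
    (hMδ : M ^ (2 * m + m2 + 8) * δ ≤ 1) :
    δ ^ α ≤ M ^ (2 * ((13 + 6 * Module.finrank ℝ V + 12 * growth V) * Fintype.card J + 2 + 2 * growth V)
      + 3 + Module.finrank ℝ V * (2 * m + m2 + 16)) * δ ^ Module.finrank ℝ V := by
  classical
  have hδ := h.hδ
  have hM := h.hM
  have hα := h.hα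
  have hM0 : 0 < M := by linarith
  set d := Module.finrank ℝ V with hdd
  set g := growth V
  set n := Fintype.card J with hn
  set N := (13 + 6 * d + 12 * g) * n with hN
  have hδle : ∀ k ≤ 2 * m + m2 + 8, M ^ k * δ ≤ 1 := fun k hk =>
    (mul_le_mul_of_nonneg_right (pow_le_pow' hM hk) hδ.le).trans hMδ
  set δ3 := M ^ (2 * m + 13) * δ with hδ3
  have hδ30 : 0 < δ3 := by positivity
  have hδδ3 : δ ≤ δ3 := le_mul_of_one_le_left hδ.le (one_le_pow₀ (by linarith))
  have hnM : (n : ℝ) ≤ M := by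
    have : (n : ℝ) ≤ 3 ^ n := by exact_mod_cast (Nat.lt_pow_self (by norm_num)).le
    exact this.trans hJ
  have e1 : ∀ t ∈ Set.Icc (0 : J → ℝ) 1,
      Cov δ3 (M ^ N) ((fun v => ∑ j, (t j : 𝕜) • r j v) '' H) H := fun t ht => by
    refine (h.cov_sum hr (fun s hs => h.cov_real_smul hd hκα hl hm (hδle _ (by omega)) hs) ht
      Finset.univ).mono ?_ (le_of_eq ?_) subset_rfl subset_rfl
    · rw [Finset.card_univ]
      calc (n : ℝ) * (2 * (M ^ (2 * m + 9 + 2) * δ)) ≤ M * (M * (M ^ (2 * m + 9 + 2) * δ)) := by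
            gcongr; linarith
        _ = _ := by rw [hδ3]; ring
    · rw [Finset.card_univ, hN]; congr 1; ring
  have htF : ∀ t : J → ℝ, TB ((fun v => ∑ j, (t j : 𝕜) • r j v) '' H) := fun t => by
    refine tb_of_bounded (R := ‖∑ j, (t j : 𝕜) • r j‖ * M) ?_
    rintro _ ⟨v, hv, rfl⟩
    have h1 : ∑ j, (t j : 𝕜) • r j v = (∑ j, (t j : 𝕜) • r j) v := by simp [_root_.sum_apply]
    show ‖∑ j, (t j : 𝕜) • r j v‖ ≤ _
    rw [h1]
    exact (ContinuousLinearMap.le_opNorm _ _).trans (by gcongr; exact h.bdd v hv)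
  have e2 : ∀ t ∈ Set.Icc (0 : J → ℝ) 1,
      (cn δ3 (H + (fun v => ∑ j, (t j : 𝕜) • r j v) '' H) : ℝ) ≤ M ^ (N + 1 + 2 * g) * cn δ3 H :=
    fun t ht => by
    have c1 := (((Cov.refl hδ30.le le_rfl H).add (e1 t ht)).trans (h.dbl' hδδ3)).cn_le hδ30 h.tb
    rw [show δ3 + δ3 + δ3 + δ3 = 4 * δ3 by ring] at c1
    calc _ ≤ _ := cn_refine hδ30 (by norm_num : (1 : ℝ) ≤ 4) (h.tb.add (htF t))
      _ ≤ (1 * M ^ N * M * cn δ3 H) * M ^ (2 * g) := by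
        gcongr; exact const_pow_le hM (by norm_num) (by norm_num) _
      _ = _ := by ring
  set ρ := (M ^ m2)⁻¹ with hρ
  have hρ0 : 0 < ρ := by positivity
  have hρ1 : ρ ≤ 1 := inv_le_one_of_one_le₀ (one_le_pow₀ (by linarith))
  have hδρ : δ ≤ ρ := by
    rw [hρ, ← one_div, le_div_iff₀ (by positivity), mul_comm]
    exact hδle _ (by omega)
  obtain ⟨B0, hB0H, hsep0, hnet⟩ := exists_sep hρ0 h.tb
  have e3 : M ^ (N + 2 + 2 * g) ≤ B0.card := by
    have c1 := h.low' hδρ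
    have c2 : ρ ^ α ≤ (M ^ (N + 4 + 2 * g))⁻¹ := by
      calc ρ ^ α ≤ ρ ^ κ := Real.rpow_le_rpow_of_exponent_ge hρ0 hρ1 hκα
        _ = (M ^ (κ * m2))⁻¹ := by
          rw [hρ, Real.inv_rpow (by positivity), ← Real.rpow_natCast, ← Real.rpow_mul hM0.le, mul_comm]
        _ ≤ _ := by
          rw [← Real.rpow_natCast]
          gcongr
          · linarith
          · rw [hN]; push_cast; exact hm2
    have c3 : (cn ρ H : ℝ) ≤ B0.card := by exact_mod_cast cn_le hnet
    have c4 : 1 ≤ M * (M ^ (N + 4 + 2 * g))⁻¹ * B0.card := by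
      refine c1.trans ?_
      gcongr
    have c5 : M ^ (N + 4 + 2 * g) ≤ M * B0.card := by
      calc M ^ (N + 4 + 2 * g) ≤ M ^ (N + 4 + 2 * g) * (M * (M ^ (N + 4 + 2 * g))⁻¹ * B0.card) :=
            le_mul_of_one_le_right (by positivity) c4
        _ = _ := by field_simp
    have c6 : M ^ (N + 3 + 2 * g) ≤ B0.card := by
      refine le_of_mul_le_mul_left ?_ hM0
      calc _ = M ^ (N + 4 + 2 * g) := by ring
        _ ≤ _ := c5
    exact (pow_le_pow' hM (by omega)).trans c6
  obtain ⟨B, hBB, hBlow, hBupp⟩ : ∃ B ⊆ B0, M ^ (N + 1 + 2 * g) < B.card ∧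
      (B.card : ℝ) ≤ M ^ (N + 2 + 2 * g) := by
    have hone : (1 : ℝ) ≤ M ^ (N + 1 + 2 * g) := one_le_pow₀ (by linarith)
    have hk : ((⌊M ^ (N + 1 + 2 * g)⌋₊ + 1 : ℕ) : ℝ) ≤ M ^ (N + 2 + 2 * g) := by
      push_cast
      calc _ ≤ M ^ (N + 1 + 2 * g) + M ^ (N + 1 + 2 * g) := by
            gcongr; exact Nat.floor_le (by positivity)
        _ = 2 * M ^ (N + 1 + 2 * g) := by ring
        _ ≤ M * M ^ (N + 1 + 2 * g) := by gcongr; linarith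
        _ = _ := by ring
    obtain ⟨B, hB, hc⟩ := Finset.exists_subset_card_eq
      (show ⌊M ^ (N + 1 + 2 * g)⌋₊ + 1 ≤ B0.card by exact_mod_cast hk.trans e3)
    refine ⟨B, hB, ?_, hc ▸ hk⟩
    rw [hc]; exact_mod_cast Nat.lt_floor_add_one _
  have hcol : ∀ t ∈ Set.Icc (0 : J → ℝ) 1, ∃ p ∈ B.offDiag, ∃ w' ∈ H + H,
      ‖∑ j, (t j : 𝕜) • r j (p.1 - p.2) - w'‖ ≤ 2 * δ3 := fun t ht => by
    have c1 := cn_pos' hδ30 h.tb h.nonempty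
    have c2 : (cn δ3 (H + (fun v => ∑ j, (t j : 𝕜) • r j v) '' H) : ℝ) < B.card * cn δ3 H :=
      lt_of_le_of_lt (e2 t ht) (by gcongr)
    obtain ⟨b, hb, b', hb', hne, a, ha, a', ha', hc⟩ := exists_collision hδ30
      (fun b hb => hB0H b (hBB hb)) (h.tb.add (htF t)) (by exact_mod_cast c2)
    refine ⟨(b, b'), Finset.mem_offDiag.2 ⟨hb, hb', hne⟩, a' - a,
      h.sub_eq ▸ Set.sub_mem_sub ha' ha, ?_⟩
    simpa only [map_sub, smul_sub, Finset.sum_sub_distrib] using hc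
  have hPt := h.tb.add h.tb
  obtain ⟨Y, hYc, hYn⟩ := hPt.exists_net (δ := 2 * δ) (by positivity)
  have hY : δ ^ α * Y.card ≤ M ^ 2 := by
    have c1 := h.dbl.cn_le hδ h.tb
    rw [show δ + δ = 2 * δ by ring, ← hYc] at c1
    calc δ ^ α * Y.card ≤ δ ^ α * (M * cn δ H) := by gcongr
      _ = M * (δ ^ α * cn δ H) := by ring
      _ ≤ M * M := by gcongr; exact h.upp
      _ = _ := by ring
  let E : (V × V) × V → Set (J → ℝ) := fun q =>
    {t | t ∈ Set.Icc 0 1 ∧ ‖∑ j, (t j : 𝕜) • r j (q.1.1 - q.1.2) - q.2‖ ≤ 3 * δ3}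
  have hcov : Set.Icc (0 : J → ℝ) 1 ⊆ ⋃ q ∈ B.offDiag ×ˢ Y, E q := fun t ht => by
    obtain ⟨p, hp, w', hw', hc⟩ := hcol t ht
    obtain ⟨y, hy, hyw⟩ := hYn w' hw'
    refine Set.mem_iUnion₂.2 ⟨(p, y), Finset.mem_product.2 ⟨hp, hy⟩, ht, ?_⟩
    have : 2 * δ ≤ δ3 := by
      calc 2 * δ ≤ M ^ 1 * δ := by gcongr; linarith
        _ ≤ δ3 := mul_le_mul_of_nonneg_right (pow_le_pow' hM (by omega)) hδ.le
    calc ‖∑ j, (t j : 𝕜) • r j (p.1 - p.2) - y‖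
        = ‖(∑ j, (t j : 𝕜) • r j (p.1 - p.2) - w') + (w' - y)‖ := by congr 1; abel
      _ ≤ _ := (norm_add_le _ _).trans (by linarith)
  have hE : ∀ q ∈ B.offDiag ×ˢ Y, MeasureTheory.volume.real (E q) ≤
      M ^ (1 + d * (2 * m + m2 + 16)) * δ ^ d := fun q hq => by
    obtain ⟨hb, hb', hne⟩ := Finset.mem_offDiag.1 (Finset.mem_product.1 hq).1
    have hw : ρ < ‖q.1.1 - q.1.2‖ := not_le.1 fun hc => hne (hsep0 _ (hBB hb) _ (hBB hb') hc)
    have c1 := volume_slab_le (Fintype.linearCombination ℝ fun j => r j (q.1.1 - q.1.2))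
      (a := ρ / M) (s := 3 * δ3) (by positivity) (by positivity) (fun v hv => by
        obtain ⟨γ, hγ, hγ1⟩ := exists_preimage hr hM0 hρ0 hw hv
        refine ⟨γ, ?_, hγ1⟩
        simpa only [Fintype.linearCombination_apply, RCLike.real_smul_eq_coe_smul (K := 𝕜)] using hγ) q.2
    simp only [Fintype.linearCombination_apply, RCLike.real_smul_eq_coe_smul (K := 𝕜)] at c1
    have hp : 0 < (ρ / M) ^ d := by positivity
    refine le_of_mul_le_mul_right (c1.trans ?_) hp
    calc (3 : ℝ) ^ n * (3 * (3 * δ3)) ^ d ≤ M * (M * δ3) ^ d :=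
          mul_le_mul hJ (pow_le_pow_left₀ (by positivity) (by nlinarith) d) (by positivity) hM0.le
      _ = M * ((M ^ (m2 + 1) * M * δ3) * (ρ / M)) ^ d := by
          have hMρ : M ^ m2 * ρ = 1 := mul_inv_cancel₀ (by positivity)
          congr 2
          calc M * δ3 = (M ^ m2 * ρ) * (M * δ3) := by rw [hMρ, one_mul]
            _ = _ := by rw [pow_succ]; field_simp
      _ ≤ M * ((M ^ (2 * m + m2 + 16) * δ) * (ρ / M)) ^ d := by
          gcongr ?_ * (?_ * ?_) ^ d
          rw [hδ3]
          calc M ^ (m2 + 1) * M * (M ^ (2 * m + 13) * δ) = M ^ (2 * m + m2 + 15) * δ := by ring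
            _ ≤ _ := mul_le_mul_of_nonneg_right (pow_le_pow' hM (by omega)) hδ.le
      _ = _ := by rw [mul_pow, mul_pow]; ring
  have hvol : (1 : ℝ) ≤ (B.offDiag ×ˢ Y).card * (M ^ (1 + d * (2 * m + m2 + 16)) * δ ^ d) := by
    have c0 : MeasureTheory.volume.real (Set.Icc (0 : J → ℝ) 1) = 1 := by
      simp [MeasureTheory.measureReal_def, Real.volume_Icc_pi]
    have hlt : MeasureTheory.volume (⋃ q ∈ B.offDiag ×ˢ Y, E q) ≠ ⊤ := by
      refine ne_top_of_le_ne_top ?_ (MeasureTheory.measure_mono (t := Set.Icc (0 : J → ℝ) 1)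
        (Set.iUnion₂_subset fun q hq t ht => ht.1))
      exact isCompact_Icc.measure_lt_top.ne
    calc (1 : ℝ) ≤ MeasureTheory.volume.real (⋃ q ∈ B.offDiag ×ˢ Y, E q) := by
          rw [← c0]; exact MeasureTheory.measureReal_mono hcov hlt
      _ ≤ ∑ q ∈ B.offDiag ×ˢ Y, MeasureTheory.volume.real (E q) :=
          MeasureTheory.measureReal_biUnion_finset_le _ _
      _ ≤ ∑ q ∈ B.offDiag ×ˢ Y, M ^ (1 + d * (2 * m + m2 + 16)) * δ ^ d := Finset.sum_le_sum hE
      _ = _ := by rw [Finset.sum_const, nsmul_eq_mul]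
  have hcard : ((B.offDiag ×ˢ Y).card : ℝ) ≤ (M ^ (N + 2 + 2 * g)) ^ 2 * Y.card := by
    rw [Finset.card_product]
    push_cast
    gcongr
    have : B.offDiag.card ≤ B.card ^ 2 := by
      rw [Finset.offDiag_card, sq]; exact Nat.sub_le _ _
    calc (B.offDiag.card : ℝ) ≤ (B.card : ℝ) ^ 2 := by exact_mod_cast this
      _ ≤ _ := by gcongr
  calc δ ^ α = δ ^ α * 1 := (mul_one _).symm
    _ ≤ δ ^ α * ((M ^ (N + 2 + 2 * g)) ^ 2 * Y.card * (M ^ (1 + d * (2 * m + m2 + 16)) * δ ^ d)) := by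
      gcongr
      exact hvol.trans (by gcongr)
    _ = (δ ^ α * Y.card) * (M ^ (N + 2 + 2 * g)) ^ 2 * (M ^ (1 + d * (2 * m + m2 + 16)) * δ ^ d) := by
      ring
    _ ≤ M ^ 2 * (M ^ (N + 2 + 2 * g)) ^ 2 * (M ^ (1 + d * (2 * m + m2 + 16)) * δ ^ d) := by gcongr
    _ = _ := by ring

end Scale

end FreimanGrowth

section Subpolynomial

open Filter

variable {ℓ : Ultrafilter ℕ} {δ : ℕ → ℝ}

/-- A sequence of scales tending to zero along an ultrafilter. -/
structure IsScale (ℓ : Ultrafilter ℕ) (δ : ℕ → ℝ) : Prop where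
  pos : ∀ n, 0 < δ n
  lim : Tendsto δ ℓ (nhds 0)

/-- Sequences growing slower than any negative power of the scale. -/
def Subpoly (ℓ : Ultrafilter ℕ) (δ : ℕ → ℝ) {E : Type*} [Norm E] (x : ℕ → E) : Prop :=
  ∀ η : ℝ, 0 < η → ∀ᶠ n in (ℓ : Filter ℕ), ‖x n‖ ≤ δ n ^ (-η)

/-- Sequences decaying slower than any positive power of the scale. -/
def Substantial (ℓ : Ultrafilter ℕ) (δ : ℕ → ℝ) {E : Type*} [Norm E] (x : ℕ → E) : Prop :=
  ∀ η : ℝ, 0 < η → ∀ᶠ n in (ℓ : Filter ℕ), δ n ^ η ≤ ‖x n‖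

theorem IsScale.le_one (hs : IsScale ℓ δ) : ∀ᶠ n in (ℓ : Filter ℕ), δ n ≤ 1 :=
  (hs.lim.eventually_lt_const one_pos).mono fun _ h => h.le

theorem IsScale.const_le (hs : IsScale ℓ δ) (C : ℝ) {η : ℝ} (hη : 0 < η) :
    ∀ᶠ n in (ℓ : Filter ℕ), C ≤ δ n ^ (-η) := by
  have h1 : Tendsto (fun n => δ n ^ (-η)) ℓ atTop := by
    have : Tendsto δ ℓ (nhdsWithin 0 (Set.Ioi 0)) :=
      tendsto_nhdsWithin_iff.2 ⟨hs.lim, Eventually.of_forall hs.pos⟩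
    exact (tendsto_rpow_neg_nhdsGT_zero (neg_lt_zero.2 hη)).comp this
  exact h1.eventually_ge_atTop C

variable {E F G : Type*} [SeminormedAddCommGroup E] [SeminormedAddCommGroup F]
  [SeminormedAddCommGroup G]

theorem Subpoly.of_mul_le (hs : IsScale ℓ δ) {x : ℕ → E} {y : ℕ → F} {z : ℕ → G}
    (hy : Subpoly ℓ δ y) (hz : Subpoly ℓ δ z) (h : ∀ᶠ n in (ℓ : Filter ℕ), ‖x n‖ ≤ ‖y n‖ * ‖z n‖) :
    Subpoly ℓ δ x := fun η hη => by
  filter_upwards [hy (η / 2) (by positivity), hz (η / 2) (by positivity), h] with n h1 h2 h3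
  have := hs.pos n
  calc ‖x n‖ ≤ δ n ^ (-(η / 2)) * δ n ^ (-(η / 2)) := h3.trans (by gcongr)
    _ = _ := by rw [← Real.rpow_add this]; congr 1; ring

theorem Subpoly.of_le {x : ℕ → E} {y : ℕ → F} (hy : Subpoly ℓ δ y)
    (h : ∀ᶠ n in (ℓ : Filter ℕ), ‖x n‖ ≤ ‖y n‖) : Subpoly ℓ δ x := fun η hη => by
  filter_upwards [hy η hη, h] with n h1 h2 using h2.trans h1

theorem Subpoly.const (hs : IsScale ℓ δ) (c : E) : Subpoly ℓ δ (fun _ => c) := fun _ hη =>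
  hs.const_le _ hη

theorem Subpoly.norm {x : ℕ → E} (hx : Subpoly ℓ δ x) : Subpoly ℓ δ (fun n => ‖x n‖) :=
  hx.of_le (by simp)

theorem Subpoly.add (hs : IsScale ℓ δ) {x y : ℕ → E} (hx : Subpoly ℓ δ x) (hy : Subpoly ℓ δ y) :
    Subpoly ℓ δ (fun n => x n + y n) := fun η hη => by
  filter_upwards [hx (η / 2) (by positivity), hy (η / 2) (by positivity),
    hs.const_le 2 (half_pos hη)] with n h1 h2 h3
  have := hs.pos n
  calc ‖x n + y n‖ ≤ δ n ^ (-(η / 2)) + δ n ^ (-(η / 2)) := (norm_add_le _ _).trans (by gcongr)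
    _ = 2 * δ n ^ (-(η / 2)) := by ring
    _ ≤ δ n ^ (-(η / 2)) * δ n ^ (-(η / 2)) := by gcongr
    _ = _ := by rw [← Real.rpow_add this]; congr 1; ring

theorem Subpoly.neg {x : ℕ → E} (hx : Subpoly ℓ δ x) : Subpoly ℓ δ (fun n => -x n) :=
  hx.of_le (by simp)

theorem Subpoly.sum (hs : IsScale ℓ δ) {ι : Type*} (s : Finset ι) {x : ι → ℕ → E}
    (hx : ∀ i ∈ s, Subpoly ℓ δ (x i)) : Subpoly ℓ δ (fun n => ∑ i ∈ s, x i n) := by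
  classical
  induction s using Finset.induction_on with
  | empty => simpa using Subpoly.const hs (0 : E)
  | insert a s ha ih =>
    simp only [Finset.sum_insert ha]
    exact (hx a (Finset.mem_insert_self _ _)).add hs
      (ih fun i hi => hx i (Finset.mem_insert_of_mem hi))

theorem Subpoly.mul (hs : IsScale ℓ δ) {E : Type*} [SeminormedRing E] {x y : ℕ → E} (hx : Subpoly ℓ δ x)
    (hy : Subpoly ℓ δ y) : Subpoly ℓ δ (fun n => x n * y n) :=
  Subpoly.of_mul_le hs hx hy (Eventually.of_forall fun _ => norm_mul_le _ _)

theorem Subpoly.pow (hs : IsScale ℓ δ) {E : Type*} [SeminormedRing E] {x : ℕ → E} (hx : Subpoly ℓ δ x)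
    (k : ℕ) : Subpoly ℓ δ (fun n => x n ^ k) := by
  induction k with
  | zero => simpa using Subpoly.const hs (1 : E)
  | succ k ih => simpa only [pow_succ] using ih.mul hs hx

theorem Subpoly.smul (hs : IsScale ℓ δ) {𝕜 : Type*} [SeminormedAddCommGroup 𝕜] [SMul 𝕜 E]
    [NormSMulClass 𝕜 E] {c : ℕ → 𝕜} {x : ℕ → E} (hc : Subpoly ℓ δ c) (hx : Subpoly ℓ δ x) :
    Subpoly ℓ δ (fun n => c n • x n) :=
  Subpoly.of_mul_le hs hc hx (Eventually.of_forall fun _ => (norm_smul _ _).le)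

theorem Subpoly.clm_apply (hs : IsScale ℓ δ) {𝕜 : Type*} [NontriviallyNormedField 𝕜] [NormedSpace 𝕜 E]
    [NormedSpace 𝕜 F] {r : ℕ → E →L[𝕜] F} {x : ℕ → E} (hr : Subpoly ℓ δ r)
    (hx : Subpoly ℓ δ x) : Subpoly ℓ δ (fun n => r n (x n)) :=
  Subpoly.of_mul_le hs hr hx (Eventually.of_forall fun _ => ContinuousLinearMap.le_opNorm _ _)

theorem Substantial.inv (hs : IsScale ℓ δ) {𝕜 : Type*} [NormedField 𝕜] {x : ℕ → 𝕜}
    (h : Substantial ℓ δ x) : Subpoly ℓ δ (fun n => (x n)⁻¹) := fun η hη => by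
  filter_upwards [h η hη] with n h1
  rw [norm_inv, Real.rpow_neg (hs.pos n).le]
  exact inv_anti₀ (Real.rpow_pos_of_pos (hs.pos n) _) h1

theorem Substantial.ne_zero (hs : IsScale ℓ δ) {𝕜 : Type*} [NormedField 𝕜] {x : ℕ → 𝕜}
    (h : Substantial ℓ δ x) : ∀ᶠ n in (ℓ : Filter ℕ), x n ≠ 0 := by
  filter_upwards [h 1 one_pos] with n h1
  rw [← norm_pos_iff]
  exact lt_of_lt_of_le (Real.rpow_pos_of_pos (hs.pos n) _) h1

theorem Substantial.of_le_mul (hs : IsScale ℓ δ) {x : ℕ → E} {y : ℕ → F} {z : ℕ → G}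
    (hy : Substantial ℓ δ y) (hz : Subpoly ℓ δ z)
    (h : ∀ᶠ n in (ℓ : Filter ℕ), ‖y n‖ ≤ ‖z n‖ * ‖x n‖) : Substantial ℓ δ x := fun η hη => by
  filter_upwards [hy (η / 2) (by positivity), hz (η / 2) (by positivity), h] with n h1 h2 h3
  have hp := hs.pos n
  calc δ n ^ η = δ n ^ (η / 2) * δ n ^ (η / 2) := by rw [← Real.rpow_add hp]; congr 1; ring
    _ ≤ δ n ^ (η / 2) * (δ n ^ (-(η / 2)) * ‖x n‖) := by
      gcongr; exact h1.trans (h3.trans (by gcongr))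
    _ = _ := by rw [← mul_assoc, ← Real.rpow_add hp]; simp

end Subpolynomial

section SetLe

open Filter

variable {ℓ : Ultrafilter ℕ} {δ : ℕ → ℝ}
variable {V : Type*} [NormedAddCommGroup V]

/-- `S n` is contained in the `δ n`-neighbourhood of subpolynomially many translates of `T n`. -/
def SetLe (ℓ : Ultrafilter ℕ) (δ : ℕ → ℝ) (S T : ℕ → Set V) : Prop :=
  ∀ η : ℝ, 0 < η → ∀ᶠ n in (ℓ : Filter ℕ), Cov (δ n) (δ n ^ (-η)) (S n) (T n)

theorem SetLe.of_cov {S T : ℕ → Set V} {K : ℕ → ℝ} (hK : Subpoly ℓ δ K)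
    (h : ∀ᶠ n in (ℓ : Filter ℕ), Cov (δ n) (K n) (S n) (T n)) : SetLe ℓ δ S T := fun η hη => by
  filter_upwards [h, hK η hη] with n h1 h2
  exact h1.mono le_rfl ((Real.le_norm_self _).trans h2) subset_rfl subset_rfl

theorem SetLe.exists_subpoly {S T : ℕ → Set V} (h : SetLe ℓ δ S T) :
    ∃ K : ℕ → ℝ, Subpoly ℓ δ K ∧ (∀ n, 0 ≤ K n) ∧ ∀ᶠ n in (ℓ : Filter ℕ), Cov (δ n) (K n) (S n) (T n) := by
  classical
  let p : ℕ → ℕ → Prop := fun n N => Cov (δ n) (N : ℝ) (S n) (T n)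
  have key : ∀ {n : ℕ} {L : ℝ}, Cov (δ n) L (S n) (T n) → p n (sInf {N | p n N}) ∧
      ((sInf {N | p n N} : ℕ) : ℝ) ≤ L := fun {n L} ⟨X, hX, hc⟩ => by
    have h1 : p n X.card := ⟨X, le_rfl, hc⟩
    exact ⟨Nat.sInf_mem (s := {N | p n N}) ⟨_, h1⟩, le_trans (by exact_mod_cast Nat.sInf_le h1) hX⟩
  refine ⟨fun n => (sInf {N | p n N} : ℕ), fun η hη => ?_, fun n => Nat.cast_nonneg _, ?_⟩
  · filter_upwards [h η hη] with n h1
    simpa using (key h1).2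
  · filter_upwards [h 1 one_pos] with n h1 using (key h1).1

theorem SetLe.mono {S T S' T' : ℕ → Set V} (h : SetLe ℓ δ S T)
    (hS : ∀ᶠ n in (ℓ : Filter ℕ), S' n ⊆ S n) (hT : ∀ᶠ n in (ℓ : Filter ℕ), T n ⊆ T' n) :
    SetLe ℓ δ S' T' := fun η hη => by
  filter_upwards [h η hη, hS, hT] with n h1 h2 h3 using h1.mono le_rfl le_rfl h2 h3

theorem SetLe.of_subset (hs : IsScale ℓ δ) {S T : ℕ → Set V}
    (h : ∀ᶠ n in (ℓ : Filter ℕ), S n ⊆ T n) : SetLe ℓ δ S T :=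
  SetLe.of_cov (Subpoly.const hs (1 : ℝ)) (h.mono fun n h =>
    (Cov.refl (hs.pos n).le le_rfl (T n)).mono le_rfl le_rfl h subset_rfl)

variable [NormedSpace ℝ V] [FiniteDimensional ℝ V]

theorem SetLe.of_cov_mul (hs : IsScale ℓ δ) {S T : ℕ → Set V} {K R : ℕ → ℝ} (hK : Subpoly ℓ δ K)
    (hR : Subpoly ℓ δ R)
    (h : ∀ᶠ n in (ℓ : Filter ℕ), Cov (R n * δ n) (K n) (S n) (T n)) : SetLe ℓ δ S T := by
  have hR' : Subpoly ℓ δ (fun n => (2 * (1 + ‖R n‖)) ^ growth V) :=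
    ((Subpoly.const hs (2 : ℝ)).mul hs ((Subpoly.const hs (1 : ℝ)).add hs hR.norm)).pow hs _
  refine SetLe.of_cov (hK.mul hs hR') (h.mono fun n h => ?_)
  refine (h.mono (δ' := (1 + ‖R n‖) * δ n) ?_ le_rfl subset_rfl subset_rfl).refine (hs.pos n) ?_
  · have := hs.pos n
    gcongr
    linarith [Real.le_norm_self (R n)]
  · linarith [norm_nonneg (R n)]

theorem SetLe.trans (hs : IsScale ℓ δ) {S T U : ℕ → Set V} (h : SetLe ℓ δ S T) (h' : SetLe ℓ δ T U) :
    SetLe ℓ δ S U := by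
  obtain ⟨K, hK, -, hc⟩ := h.exists_subpoly
  obtain ⟨K', hK', -, hc'⟩ := h'.exists_subpoly
  refine SetLe.of_cov_mul hs (hK.mul hs hK') (Subpoly.const hs (2 : ℝ)) ?_
  filter_upwards [hc, hc'] with n h1 h2
  rw [two_mul]; exact h1.trans h2

theorem SetLe.add (hs : IsScale ℓ δ) {S T S' T' : ℕ → Set V} (h : SetLe ℓ δ S T)
    (h' : SetLe ℓ δ S' T') : SetLe ℓ δ (fun n => S n + S' n) (fun n => T n + T' n) := by
  obtain ⟨K, hK, -, hc⟩ := h.exists_subpoly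
  obtain ⟨K', hK', -, hc'⟩ := h'.exists_subpoly
  refine SetLe.of_cov_mul hs (hK.mul hs hK') (Subpoly.const hs (2 : ℝ)) ?_
  filter_upwards [hc, hc'] with n h1 h2
  rw [two_mul]; exact h1.add h2

theorem SetLe.image (hs : IsScale ℓ δ) {𝕜 : Type*} [RCLike 𝕜] [NormedSpace 𝕜 V] {S T : ℕ → Set V}
    (h : SetLe ℓ δ S T) {r : ℕ → V →L[𝕜] V} (hr : Subpoly ℓ δ r) :
    SetLe ℓ δ (fun n => r n '' S n) (fun n => r n '' T n) := by
  obtain ⟨K, hK, -, hc⟩ := h.exists_subpoly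
  refine SetLe.of_cov_mul hs hK hr.norm ?_
  filter_upwards [hc] with n h1
  exact h1.image (r n) (map_add _) (r n).le_opNorm (norm_nonneg _)

end SetLe

section GoodRing

open Filter

variable {ℓ : Ultrafilter ℕ} {δ : ℕ → ℝ}
variable {V : Type*} [NormedAddCommGroup V] [NormedSpace ℝ V] [FiniteDimensional ℝ V]
variable {𝕜 : Type*} [RCLike 𝕜] [NormedSpace 𝕜 V]

/-- Symmetric subpolynomially bounded sets with small doubling. -/
structure Tame (ℓ : Ultrafilter ℕ) (δ : ℕ → ℝ) (H : ℕ → Set V) : Prop where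
  zero_mem : ∀ n, 0 ∈ H n
  neg_mem : ∀ n, ∀ h ∈ H n, -h ∈ H n
  bdd : ∃ R : ℕ → ℝ, Subpoly ℓ δ R ∧ ∀ n, ∀ h ∈ H n, ‖h‖ ≤ R n
  dbl : SetLe ℓ δ (fun n => H n + H n) H

variable {H : ℕ → Set V}

theorem Tame.tb (hH : Tame ℓ δ H) (n : ℕ) : TB (H n) :=
  let ⟨_, _, h⟩ := hH.bdd; tb_of_bounded (h n)

/-- The ring of sequences of operators almost preserving `H`. -/
def goodRing (𝕜 : Type*) [RCLike 𝕜] [NormedSpace 𝕜 V] (hs : IsScale ℓ δ) (hH : Tame ℓ δ H) :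
    Subring (ℕ → V →L[𝕜] V) where
  carrier := {r | Subpoly ℓ δ r ∧ SetLe ℓ δ (fun n => r n '' H n) H}
  zero_mem' := ⟨Subpoly.const hs 0, SetLe.of_subset hs (Eventually.of_forall fun n => by
    rintro _ ⟨x, -, rfl⟩; simpa using hH.zero_mem n)⟩
  one_mem' := ⟨Subpoly.const hs 1, SetLe.of_subset hs (Eventually.of_forall fun n => by
    rintro _ ⟨x, hx, rfl⟩; simpa using hx)⟩
  neg_mem' := fun {r} hr => ⟨hr.1.neg, hr.2.mono (Eventually.of_forall fun n => by
    rintro _ ⟨x, hx, rfl⟩; exact ⟨-x, hH.neg_mem n x hx, by simp⟩)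
    (Eventually.of_forall fun n => subset_rfl)⟩
  add_mem' := fun {r s} hr hr' => ⟨hr.1.add hs hr'.1, by
    refine ((hr.2.add hs hr'.2).trans hs hH.dbl).mono (Eventually.of_forall fun n => ?_)
      (Eventually.of_forall fun n => subset_rfl)
    rintro _ ⟨x, hx, rfl⟩
    exact ⟨r n x, ⟨x, hx, rfl⟩, s n x, ⟨x, hx, rfl⟩, rfl⟩⟩
  mul_mem' := fun {r s} hr hr' => ⟨hr.1.mul hs hr'.1, by
    refine ((hr'.2.image hs hr.1).trans hs hr.2).mono (Eventually.of_forall fun n => ?_)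
      (Eventually.of_forall fun n => subset_rfl)
    rintro _ ⟨x, hx, rfl⟩
    exact ⟨s n x, ⟨x, hx, rfl⟩, rfl⟩⟩

theorem mem_goodRing {hs : IsScale ℓ δ} {hH : Tame ℓ δ H} {r : ℕ → V →L[𝕜] V} :
    r ∈ goodRing 𝕜 hs hH ↔ Subpoly ℓ δ r ∧ SetLe ℓ δ (fun n => r n '' H n) H := Iff.rfl

/-- The image under a good operator with bounded inverse is almost as large as the set itself. -/
theorem setLe_image_sub_image (hs : IsScale ℓ δ) (hH : Tame ℓ δ H) {r : ℕ → V →L[𝕜] V}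
    (hr : SetLe ℓ δ (fun n => r n '' H n) H) {K : ℕ → ℝ} (hK : Subpoly ℓ δ K)
    (hinv : ∀ᶠ n in (ℓ : Filter ℕ), ∀ v, ‖v‖ ≤ K n * ‖r n v‖) :
    SetLe ℓ δ H (fun n => r n '' H n - r n '' H n) := by
  have hsum : SetLe ℓ δ (fun n => H n + r n '' H n) H :=
    ((SetLe.of_subset hs (Eventually.of_forall fun n => subset_rfl)).add hs hr).trans hs hH.dbl
  obtain ⟨L, hL, hL0, hc⟩ := hsum.exists_subpoly
  have hK' : Subpoly ℓ δ (fun n => 2 * (4 * (1 + ‖K n‖))) :=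
    (Subpoly.const hs (2 : ℝ)).mul hs ((Subpoly.const hs (4 : ℝ)).mul hs
      ((Subpoly.const hs (1 : ℝ)).add hs hK.norm))
  have hLK := hL.mul hs (hK'.pow hs (growth V))
  refine SetLe.of_cov_mul hs (R := fun _ => 4) hLK (Subpoly.const hs (4 : ℝ)) ?_
  filter_upwards [hc, hinv] with n h1 h2
  have hδ := hs.pos n
  have hrtb : TB (r n '' H n) := by
    obtain ⟨R, -, hR⟩ := hH.bdd
    refine tb_of_bounded (R := ‖r n‖ * R n) ?_
    rintro _ ⟨x, hx, rfl⟩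
    exact ((r n).le_opNorm x).trans (by gcongr; exact hR n x hx)
  have hne : (r n '' H n).Nonempty := ⟨_, 0, hH.zero_mem n, rfl⟩
  have h3 := ruzsa_cov (δ := 2 * δ n) (by positivity) ((hH.tb n).add hrtb) hrtb hne
  have hpos := cn_pos' (δ := 2 * δ n) (by positivity) hrtb hne
  refine (h3.mono (by linarith) ?_ subset_rfl subset_rfl)
  rw [div_le_iff₀ (by linarith)]
  have h4 := h1.cn_le hδ (hH.tb n)
  rw [← two_mul] at h4
  have h5 : (cn (δ n) (H n) : ℝ) ≤ cn (2 * δ n) (r n '' H n) * (2 * (4 * (1 + ‖K n‖))) ^ growth V := by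
    refine (cn_refine hδ (by linarith [norm_nonneg (K n)] : 1 ≤ 4 * (1 + ‖K n‖)) (hH.tb n)).trans ?_
    gcongr
    obtain ⟨F, hF, hn⟩ := hrtb.exists_net (δ := 2 * δ n) (by positivity)
    classical
    have hsel : ∀ x : V, ∃ y, (∃ h ∈ H n, ‖r n h - x‖ ≤ 2 * δ n) →
        (y ∈ H n ∧ ‖r n y - x‖ ≤ 2 * δ n) := fun x => by
      by_cases h : ∃ h ∈ H n, ‖r n h - x‖ ≤ 2 * δ n
      · obtain ⟨y, hy, hh⟩ := h
        exact ⟨y, fun _ => ⟨hy, hh⟩⟩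
      · exact ⟨0, fun h' => absurd h' h⟩
    choose p hp using hsel
    have : IsNet (4 * (1 + ‖K n‖) * δ n) (H n) (F.image p) := fun h hh => by
      obtain ⟨x, hx, hxh⟩ := hn _ ⟨h, hh, rfl⟩
      obtain ⟨hy, hy'⟩ := hp x ⟨h, hh, hxh⟩
      refine ⟨p x, Finset.mem_image_of_mem _ hx, ?_⟩
      have e : ‖r n (h - p x)‖ ≤ 4 * δ n := by
        calc ‖r n (h - p x)‖ = ‖(r n h - x) - (r n (p x) - x)‖ := by rw [map_sub]; congr 1; abel
          _ ≤ _ := (norm_sub_le _ _).trans (by linarith)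
      calc ‖h - p x‖ ≤ K n * ‖r n (h - p x)‖ := h2 _
        _ ≤ (1 + ‖K n‖) * (4 * δ n) := by
          gcongr
          linarith [Real.le_norm_self (K n)]
        _ = _ := by ring
    calc _ ≤ _ := cn_le this
      _ ≤ F.card := Finset.card_image_le
      _ = _ := hF
  calc (cn (2 * δ n) (H n + r n '' H n) : ℝ) ≤ L n * cn (δ n) (H n) := h4
    _ ≤ L n * (cn (2 * δ n) (r n '' H n) * (2 * (4 * (1 + ‖K n‖))) ^ growth V) := by
      gcongr; exact hL0 n
    _ = _ := by ring

/-- A multiplier that is good after composing with a good operator with bounded inverse is good. -/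
theorem smul_one_mem_goodRing {hs : IsScale ℓ δ} {hH : Tame ℓ δ H} {r : ℕ → V →L[𝕜] V}
    (hr : r ∈ goodRing 𝕜 hs hH) {K : ℕ → ℝ} (hK : Subpoly ℓ δ K)
    (hinv : ∀ᶠ n in (ℓ : Filter ℕ), ∀ v, ‖v‖ ≤ K n * ‖r n v‖) {t : ℕ → 𝕜} (ht : Subpoly ℓ δ t)
    (htr : (fun n => t n • r n) ∈ goodRing 𝕜 hs hH) :
    (fun n => t n • (1 : V →L[𝕜] V)) ∈ goodRing 𝕜 hs hH := by
  have htt : Subpoly ℓ δ (fun n => t n • (1 : V →L[𝕜] V)) := ht.smul hs (Subpoly.const hs _)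
  rw [mem_goodRing] at hr htr ⊢
  refine ⟨htt, ?_⟩
  have hcov := setLe_image_sub_image hs hH hr.2 hK hinv
  have h1 := hcov.image hs htt
  have h2 := (htr.2.add hs htr.2).trans hs hH.dbl
  refine (h1.trans hs (SetLe.of_subset hs (Eventually.of_forall fun n => ?_))).trans hs h2
  rintro _ ⟨_, ⟨_, ⟨x, hx, rfl⟩, _, ⟨y, hy, rfl⟩, rfl⟩, rfl⟩
  refine Set.mem_add.2 ⟨(t n • r n) x, Set.mem_image_of_mem _ hx, (t n • r n) (-y),
    Set.mem_image_of_mem _ (hH.neg_mem n y hy), ?_⟩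
  simp [sub_eq_add_neg, smul_add]

end GoodRing

section Hull

open Filter

variable {ℓ : Ultrafilter ℕ} {δ : ℕ → ℝ}
variable {𝕜 : Type*} [RCLike 𝕜] {E F G : Type*} [AddCommGroup E] [Module 𝕜 E]
  [AddCommGroup F] [Module 𝕜 F] [AddCommGroup G] [Module 𝕜 G]

/-- Combinations of sequences in `I` with real subpolynomial coefficients. -/
def hull (𝕜 : Type*) [RCLike 𝕜] {E : Type*} [AddCommGroup E] [Module 𝕜 E] (ℓ : Ultrafilter ℕ)
    (δ : ℕ → ℝ) (I : Set (ℕ → E)) : AddSubmonoid (ℕ → E) :=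
  AddSubmonoid.closure {x | ∃ c : ℕ → ℝ, Subpoly ℓ δ c ∧ ∃ r ∈ I, x = fun n => (c n : 𝕜) • r n}

theorem smul_mem_hull {I : Set (ℕ → E)} {c : ℕ → ℝ} (hc : Subpoly ℓ δ c) {r : ℕ → E} (hr : r ∈ I) :
    (fun n => (c n : 𝕜) • r n) ∈ hull 𝕜 ℓ δ I :=
  AddSubmonoid.subset_closure ⟨c, hc, r, hr, rfl⟩

theorem mem_hull (hs : IsScale ℓ δ) {I : Set (ℕ → E)} {r : ℕ → E} (hr : r ∈ I) :
    r ∈ hull 𝕜 ℓ δ I := by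
  simpa using smul_mem_hull (𝕜 := 𝕜) (Subpoly.const hs (1 : ℝ)) hr

theorem hull_bilin (hs : IsScale ℓ δ) (β : ℕ → E →ₗ[𝕜] F →ₗ[𝕜] G) {I : Set (ℕ → E)}
    {J : Set (ℕ → F)} {K : Set (ℕ → G)}
    (h : ∀ a ∈ I, ∀ b ∈ J, (fun n => β n (a n) (b n)) ∈ K) {x : ℕ → E} (hx : x ∈ hull 𝕜 ℓ δ I)
    {y : ℕ → F} (hy : y ∈ hull 𝕜 ℓ δ J) : (fun n => β n (x n) (y n)) ∈ hull 𝕜 ℓ δ K := by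
  induction hx using AddSubmonoid.closure_induction with
  | zero => simp only [Pi.zero_apply, map_zero, LinearMap.zero_apply]; exact zero_mem _
  | add a b _ _ ha hb => simpa using! (hull 𝕜 ℓ δ K).add_mem ha hb
  | mem x hx =>
    obtain ⟨c, hc, a, ha, rfl⟩ := hx
    induction hy using AddSubmonoid.closure_induction with
    | zero => simp only [Pi.zero_apply, map_zero, LinearMap.zero_apply]; exact zero_mem _
    | add a b _ _ ha hb => simpa using! (hull 𝕜 ℓ δ K).add_mem ha hb
    | mem y hy =>
      obtain ⟨d, hd, b, hb, rfl⟩ := hy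
      have := smul_mem_hull (𝕜 := 𝕜) (hc.mul hs hd) (h a ha b hb)
      simpa [smul_smul, mul_comm] using! this

theorem hull_linear (hs : IsScale ℓ δ) (β : ℕ → E →ₗ[𝕜] G) {I : Set (ℕ → E)} {K : Set (ℕ → G)}
    (h : ∀ a ∈ I, (fun n => β n (a n)) ∈ K) {x : ℕ → E} (hx : x ∈ hull 𝕜 ℓ δ I) :
    (fun n => β n (x n)) ∈ hull 𝕜 ℓ δ K := by
  have hone : (fun _ : ℕ => (1 : 𝕜)) ∈ hull 𝕜 ℓ δ ({fun _ => 1} : Set (ℕ → 𝕜)) := mem_hull hs rfl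
  have := hull_bilin hs (fun n => (LinearMap.lsmul 𝕜 G).compl₂ (β n)) (I := {fun _ => 1}) (J := I) (K := K)
    (fun a ha b hb => by obtain rfl := ha; simpa using h b hb) hone hx
  simpa using this

theorem smul_mem_hull_of_mem (hs : IsScale ℓ δ) {I : Set (ℕ → E)} {c : ℕ → ℝ} (hc : Subpoly ℓ δ c)
    {x : ℕ → E} (hx : x ∈ hull 𝕜 ℓ δ I) : (fun n => (c n : 𝕜) • x n) ∈ hull 𝕜 ℓ δ I := by
  have hone : (fun n : ℕ => (c n : 𝕜)) ∈ hull 𝕜 ℓ δ ({fun _ => 1} : Set (ℕ → 𝕜)) := by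
    simpa using smul_mem_hull (𝕜 := 𝕜) hc (Set.mem_singleton (fun _ : ℕ => (1 : 𝕜)))
  have := hull_bilin hs (fun n => LinearMap.lsmul 𝕜 E) (I := {fun _ => 1}) (J := I) (K := I)
    (fun a ha b hb => by obtain rfl := ha; simpa using hb) hone hx
  simpa using this

theorem exists_sum_of_mem_hull {I : Set (ℕ → E)} {x : ℕ → E} (hx : x ∈ hull 𝕜 ℓ δ I) :
    ∃ (J : Type) (_ : Fintype J) (c : J → ℕ → ℝ) (r : J → ℕ → E), (∀ j, Subpoly ℓ δ (c j)) ∧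
      (∀ j, r j ∈ I) ∧ ∀ n, x n = ∑ j, (c j n : 𝕜) • r j n := by
  induction hx using AddSubmonoid.closure_induction with
  | zero => exact ⟨Empty, inferInstance, fun j => j.elim, fun j => j.elim, fun j => j.elim,
      fun j => j.elim, by simp⟩
  | add a b _ _ ha hb =>
    obtain ⟨J, _, c, r, h1, h2, h3⟩ := ha
    obtain ⟨J', _, c', r', h1', h2', h3'⟩ := hb
    refine ⟨J ⊕ J', inferInstance, Sum.elim c c', Sum.elim r r', ?_, ?_, fun n => ?_⟩
    · rintro (j | j)
      exacts [h1 j, h1' j]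
    · rintro (j | j)
      exacts [h2 j, h2' j]
    · simp [h3, h3']
  | mem x hx =>
    obtain ⟨c, hc, a, ha, rfl⟩ := hx
    exact ⟨Unit, inferInstance, fun _ => c, fun _ => a, fun _ => hc, fun _ => ha, by simp⟩

/-- Subpolynomial sequences are combinations of constants. -/
theorem mem_hull_of_const (hs : IsScale ℓ δ) {E : Type*} [NormedAddCommGroup E] [NormedSpace 𝕜 E]
    [FiniteDimensional 𝕜 E] {I : Set (ℕ → E)} (h : ∀ v : E, (fun _ => v) ∈ hull 𝕜 ℓ δ I) {x : ℕ → E}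
    (hx : Subpoly ℓ δ x) : x ∈ hull 𝕜 ℓ δ I := by
  let b := Module.finBasis 𝕜 E
  have hsum : x = ∑ i, ((fun n => ((RCLike.re (b.repr (x n) i) : ℝ) : 𝕜) • b i) +
      fun n => ((RCLike.im (b.repr (x n) i) : ℝ) : 𝕜) • ((RCLike.I : 𝕜) • b i)) := by
    ext n
    rw [Finset.sum_apply]
    conv_lhs => rw [← b.sum_repr (x n)]
    refine Finset.sum_congr rfl fun i _ => ?_
    simp only [Pi.add_apply, smul_smul, ← add_smul, RCLike.re_add_im]
  rw [hsum]
  refine AddSubmonoid.sum_mem _ fun i _ => ?_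
  have hc : Subpoly ℓ δ (fun n => b.repr (x n) i) := by
    let f : E →L[𝕜] 𝕜 := LinearMap.toContinuousLinearMap (b.coord i)
    exact Subpoly.clm_apply hs (Subpoly.const hs f) hx
  exact add_mem (smul_mem_hull_of_mem hs (hc.of_le (Eventually.of_forall fun n => RCLike.norm_re_le_norm _)) (h _))
    (smul_mem_hull_of_mem hs (hc.of_le (Eventually.of_forall fun n => RCLike.norm_im_le_norm _)) (h _))

end Hull

section Sandwich

variable {𝕜 : Type*} [RCLike 𝕜] {V : Type*} [NormedAddCommGroup V] [NormedSpace 𝕜 V]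
  [FiniteDimensional 𝕜 V]

/-- The map `v ↦ P ∘ ad v ∘ Q`, bilinearly in `P` and `Q`. -/
noncomputable def sandwich (ad : V →L[𝕜] V →L[𝕜] V) :
    (V →L[𝕜] V) →ₗ[𝕜] (V →L[𝕜] V) →ₗ[𝕜] (V →L[𝕜] V →L[𝕜] V) :=
  LinearMap.mk₂ 𝕜 (fun P Q => LinearMap.toContinuousLinearMap
    { toFun := fun v => P * ad v * Q
      map_add' := fun v w => by rw [map_add, mul_add, add_mul]
      map_smul' := fun c v => by simp })
    (fun P P' Q => by ext v w; simp) (fun c P Q => by ext v w; simp)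
    (fun P Q Q' => by ext v w; simp) (fun c P Q => by ext v w; simp)

@[simp] theorem sandwich_apply (ad : V →L[𝕜] V →L[𝕜] V) (P Q : V →L[𝕜] V) (v : V) :
    sandwich ad P Q v = P * ad v * Q := rfl

theorem smulRight_one_mem_span_sandwich {ad : V →L[𝕜] V →L[𝕜] V} (hinj : ∀ v, ad v = 0 → v = 0)
    (μ : V →L[𝕜] 𝕜) : ContinuousLinearMap.smulRight μ (1 : V →L[𝕜] V) ∈
      AddSubmonoid.closure {x | ∃ P Q, x = sandwich ad P Q} := by
  let T : Submodule 𝕜 (V →L[𝕜] V →L[𝕜] V) :=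
    { AddSubmonoid.closure {x | ∃ P Q, x = sandwich ad P Q} with
      smul_mem' := fun c x hx => by
        change x ∈ AddSubmonoid.closure _ at hx
        change c • x ∈ AddSubmonoid.closure _
        induction hx using AddSubmonoid.closure_induction with
        | zero => simp
        | add a b _ _ ha hb => rw [smul_add]; exact add_mem ha hb
        | mem x hx =>
          obtain ⟨P, Q, rfl⟩ := hx
          exact AddSubmonoid.subset_closure ⟨c • P, Q, by rw [map_smul]; rfl⟩ }
  let L : Module.Dual 𝕜 V →ₗ[𝕜] (V →L[𝕜] V →L[𝕜] V) :=
    { toFun := fun f => ContinuousLinearMap.smulRight (LinearMap.toContinuousLinearMap f) (1 : V →L[𝕜] V)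
      map_add' := fun f g => by ext v w; simp [add_smul]
      map_smul' := fun c f => by ext v w; simp [smul_smul] }
  let S : Submodule 𝕜 (Module.Dual 𝕜 V) := T.comap L
  have hS : S = ⊤ := by
    rw [← Subspace.dualCoannihilator_dualAnnihilator_eq (W := S)]
    have : S.dualCoannihilator = ⊥ := by
      rw [eq_bot_iff]
      intro v hv
      rw [Submodule.mem_dualCoannihilator] at hv
      refine hinj v ?_
      ext u
      rw [_root_.zero_apply]
      refine (Module.forall_dual_apply_eq_zero_iff 𝕜 _).1 fun ν => ?_
      let b := Module.finBasis 𝕜 V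
      let ν' : V →L[𝕜] 𝕜 := LinearMap.toContinuousLinearMap ν
      refine hv (ν ∘ₗ (LinearMap.applyₗ u) ∘ₗ (ContinuousLinearMap.coeLM 𝕜) ∘ₗ (ad : V →ₗ[𝕜] V →L[𝕜] V)) ?_
      change _ ∈ AddSubmonoid.closure _
      have key : ContinuousLinearMap.smulRight (LinearMap.toContinuousLinearMap
          (ν ∘ₗ (LinearMap.applyₗ u) ∘ₗ (ContinuousLinearMap.coeLM 𝕜) ∘ₗ (ad : V →ₗ[𝕜] V →L[𝕜] V)))
          (1 : V →L[𝕜] V) = ∑ i, sandwich ad (ν'.smulRight (b i))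
            ((LinearMap.toContinuousLinearMap (b.coord i)).smulRight u) := by
        ext v w
        simp only [sum_apply, sandwich_apply]
        simp only [ContinuousLinearMap.smulRight_apply, ContinuousLinearMap.mul_apply', map_smul]
        simp [ν', smul_smul]
        conv_lhs => rw [← b.sum_repr w]
        rw [Finset.smul_sum]
        refine Finset.sum_congr rfl fun i _ => ?_
        rw [smul_smul, mul_comm]
      change ContinuousLinearMap.smulRight _ _ ∈ _
      rw [key]
      exact AddSubmonoid.sum_mem _ fun i _ => AddSubmonoid.subset_closure ⟨_, _, rfl⟩
    rw [this]; simp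
  have h : (μ : V →ₗ[𝕜] 𝕜) ∈ S := hS ▸ Submodule.mem_top
  exact h

end Sandwich

section Determinants

open Filter

variable {𝕜 : Type*} [RCLike 𝕜] {V : Type*} [NormedAddCommGroup V] [NormedSpace 𝕜 V]
  [FiniteDimensional 𝕜 V]

theorem exists_adjugate_bound (𝕜 V : Type*) [RCLike 𝕜] [NormedAddCommGroup V] [NormedSpace 𝕜 V]
    [FiniteDimensional 𝕜 V] : ∃ (C : ℝ) (k : ℕ), ∀ r : V →L[𝕜] V, ∃ a : V →L[𝕜] V,
      a * r = LinearMap.det (r : V →ₗ[𝕜] V) • (1 : V →L[𝕜] V) ∧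
      r * a = LinearMap.det (r : V →ₗ[𝕜] V) • (1 : V →L[𝕜] V) ∧ ‖a‖ ≤ C * (1 + C * ‖r‖) ^ k := by
  classical
  let b := Module.finBasis 𝕜 V
  set d := Module.finrank 𝕜 V
  let T : (Fin d → Fin d → 𝕜) →ₗ[𝕜] (V →L[𝕜] V) :=
    (LinearMap.toContinuousLinearMap : (V →ₗ[𝕜] V) ≃ₗ[𝕜] (V →L[𝕜] V)).toLinearMap ∘ₗ
      (Matrix.toLin b b).toLinearMap
  let T' := LinearMap.toContinuousLinearMap T
  let S : (V →L[𝕜] V) →ₗ[𝕜] (Fin d → Fin d → 𝕜) :=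
    (LinearMap.toMatrix b b).toLinearMap ∘ₗ (ContinuousLinearMap.coeLM 𝕜)
  let S' := LinearMap.toContinuousLinearMap S
  refine ⟨max (‖T'‖ * d.factorial) ‖S'‖, d, fun r => ?_⟩
  set C := max (‖T'‖ * d.factorial) ‖S'‖
  have hC0 : 0 ≤ C := le_trans (norm_nonneg S') (le_max_right _ _)
  let M : Matrix (Fin d) (Fin d) 𝕜 := LinearMap.toMatrix b b (r : V →ₗ[𝕜] V)
  have hM : ∀ i j, ‖M i j‖ ≤ C * ‖r‖ := fun i j => by
    have h1 : ‖S' r‖ ≤ C * ‖r‖ := (S'.le_opNorm r).trans (by gcongr; exact le_max_right _ _)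
    exact ((norm_le_pi_norm (S' r i) j).trans (norm_le_pi_norm (S' r) i)).trans h1
  have hdet : M.det = LinearMap.det (r : V →ₗ[𝕜] V) := LinearMap.det_toMatrix b _
  have hr : Matrix.toLin b b M = (r : V →ₗ[𝕜] V) := Matrix.toLin_toMatrix b b _
  refine ⟨T' M.adjugate, ?_, ?_, ?_⟩
  · apply ContinuousLinearMap.coe_injective
    change Matrix.toLin b b M.adjugate ∘ₗ (r : V →ₗ[𝕜] V) = LinearMap.det (r : V →ₗ[𝕜] V) • LinearMap.id
    rw [← hdet, ← hr, ← Matrix.toLin_mul, Matrix.adjugate_mul, map_smul, Matrix.toLin_one]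
  · apply ContinuousLinearMap.coe_injective
    change (r : V →ₗ[𝕜] V) ∘ₗ Matrix.toLin b b M.adjugate = LinearMap.det (r : V →ₗ[𝕜] V) • LinearMap.id
    rw [← hdet, ← hr, ← Matrix.toLin_mul, Matrix.mul_adjugate, map_smul, Matrix.toLin_one]
  · have h2 : ∀ i j, ‖M.adjugate i j‖ ≤ d.factorial * (1 + C * ‖r‖) ^ d := fun i j => by
      rw [Matrix.adjugate_apply]
      have := Matrix.det_le (A := M.updateRow j (Pi.single i 1)) (abv := NormedField.toAbsoluteValue 𝕜)
        (x := 1 + C * ‖r‖) (fun k l => by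
          have hr0 : 0 ≤ C * ‖r‖ := by positivity
          change ‖_‖ ≤ _
          rw [Matrix.updateRow_apply]
          split_ifs with h
          · rw [Pi.single_apply]
            split_ifs <;> simp <;> linarith
          · linarith [hM k l])
      simpa using! this
    have h3 : ‖T' M.adjugate‖ ≤ ‖T'‖ * (d.factorial * (1 + C * ‖r‖) ^ d) := by
      refine (T'.le_opNorm _).trans ?_
      gcongr
      exact (pi_norm_le_iff_of_nonneg (by positivity)).2 fun i =>
        (pi_norm_le_iff_of_nonneg (by positivity)).2 fun j => h2 i j
    refine h3.trans ?_
    rw [← mul_assoc]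
    gcongr
    exact le_max_left _ _

theorem norm_eval_le_sum {d : ℕ} {p : Polynomial 𝕜} (hp : p.degree < (d + 1 : ℕ)) (c : 𝕜) :
    ‖p.eval c‖ ≤ (1 + d + ‖c‖) ^ d * ∑ k ∈ Finset.range (d + 1), ‖p.eval (k : 𝕜)‖ := by
  classical
  have hinj : Set.InjOn (fun k : ℕ => (k : 𝕜)) (Finset.range (d + 1)) :=
    fun a _ b _ h => Nat.cast_injective h
  have h := Lagrange.eq_interpolate hinj (f := p) (by simpa using hp)
  conv_lhs => rw [h, Lagrange.interpolate_apply, Polynomial.eval_finsetSum]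
  rw [Finset.mul_sum]
  refine norm_sum_le_of_le _ fun k hk => ?_
  rw [Polynomial.eval_mul, Polynomial.eval_C, norm_mul, mul_comm]
  gcongr
  rw [Lagrange.basis, Polynomial.eval_prod, norm_prod]
  have hcard : ((Finset.range (d + 1)).erase k).card = d := by
    rw [Finset.card_erase_of_mem hk]; simp
  calc _ ≤ ∏ j ∈ (Finset.range (d + 1)).erase k, (1 + d + ‖c‖) := by
        refine Finset.prod_le_prod (fun _ _ => norm_nonneg _) fun j hj => ?_
        have hj' := Finset.mem_erase.1 hj
        rw [Lagrange.basisDivisor, Polynomial.eval_mul, Polynomial.eval_C, norm_mul, norm_inv]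
        simp only [Polynomial.eval_sub, Polynomial.eval_X, Polynomial.eval_C]
        have h1 : 1 ≤ ‖(k : 𝕜) - (j : 𝕜)‖ := by
          have : ((k : 𝕜) - (j : 𝕜)) = (((k : ℤ) - (j : ℤ) : ℤ) : 𝕜) := by push_cast; rfl
          rw [this, ← RCLike.ofReal_intCast, RCLike.norm_ofReal]
          have hne : (k : ℤ) - (j : ℤ) ≠ 0 := sub_ne_zero.2 (by exact_mod_cast hj'.1.symm)
          exact_mod_cast Int.one_le_abs hne
        have h2 : ‖c - (j : 𝕜)‖ ≤ ‖c‖ + d := by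
          refine (norm_sub_le _ _).trans ?_
          gcongr
          rw [RCLike.norm_natCast]
          exact_mod_cast Nat.lt_succ_iff.1 (Finset.mem_range.1 hj'.2)
        calc _ ≤ 1 * (‖c‖ + d) := by gcongr; exact inv_le_one_of_one_le₀ h1
          _ ≤ _ := by linarith
    _ = _ := by rw [Finset.prod_const, hcard]

theorem norm_det_add_smul_le (r s : V →L[𝕜] V) (c : 𝕜) :
    ‖LinearMap.det ((r + c • s : V →L[𝕜] V) : V →ₗ[𝕜] V)‖ ≤
      (1 + Module.finrank 𝕜 V + ‖c‖) ^ Module.finrank 𝕜 V *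
      ∑ k ∈ Finset.range (Module.finrank 𝕜 V + 1),
        ‖LinearMap.det ((r + k • s : V →L[𝕜] V) : V →ₗ[𝕜] V)‖ := by
  classical
  let b := Module.finBasis 𝕜 V
  set d := Module.finrank 𝕜 V
  let A := LinearMap.toMatrix b b (s : V →ₗ[𝕜] V)
  let B := LinearMap.toMatrix b b (r : V →ₗ[𝕜] V)
  let p : Polynomial 𝕜 := Matrix.det ((Polynomial.X : Polynomial 𝕜) • A.map (Polynomial.C : 𝕜 →+* Polynomial 𝕜) +
    B.map (Polynomial.C : 𝕜 →+* Polynomial 𝕜))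
  have hp : p.degree < (d + 1 : ℕ) := by
    refine lt_of_le_of_lt Polynomial.degree_le_natDegree ?_
    have := Polynomial.natDegree_det_X_add_C_le A B
    rw [Fintype.card_fin] at this
    exact_mod_cast Nat.lt_succ_of_le this
  have hev : ∀ c : 𝕜, p.eval c = LinearMap.det ((r + c • s : V →L[𝕜] V) : V →ₗ[𝕜] V) := fun c => by
    rw [← LinearMap.det_toMatrix b]
    have h1 : LinearMap.toMatrix b b ((r + c • s : V →L[𝕜] V) : V →ₗ[𝕜] V) = B + c • A := by
      rw [ContinuousLinearMap.toLinearMap_add, ContinuousLinearMap.toLinearMap_smul, map_add, map_smul]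
    rw [h1]
    change (Polynomial.evalRingHom c) (Matrix.det _) = _
    rw [RingHom.map_det]
    congr 1
    ext i j
    simp [add_comm]
    exact mul_comm _ _
  have := norm_eval_le_sum hp c
  simp only [hev] at this
  simpa [Nat.cast_smul_eq_nsmul] using this

end Determinants

section Elimination

open Filter

variable {ℓ : Ultrafilter ℕ} {δ : ℕ → ℝ}
variable {𝕜 : Type*} [RCLike 𝕜]

theorem exists_inverse_bound (hs : IsScale ℓ δ) {V : Type*} [NormedAddCommGroup V] [NormedSpace 𝕜 V]
    [FiniteDimensional 𝕜 V] {r : ℕ → V →L[𝕜] V} (hr : Subpoly ℓ δ r)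
    (hdet : Substantial ℓ δ (fun n => LinearMap.det (r n : V →ₗ[𝕜] V))) :
    ∃ K : ℕ → ℝ, Subpoly ℓ δ K ∧ ∀ᶠ n in (ℓ : Filter ℕ), ∀ v, ‖v‖ ≤ K n * ‖r n v‖ := by
  obtain ⟨C, k, h⟩ := exists_adjugate_bound 𝕜 V
  choose a ha _ hb using fun n => h (r n)
  have ha' : Subpoly ℓ δ a := by
    have h1 : Subpoly ℓ δ (fun n => C * (1 + C * ‖r n‖) ^ k) :=
      (Subpoly.const hs C).mul hs
        (((Subpoly.const hs (1 : ℝ)).add hs ((Subpoly.const hs C).mul hs hr.norm)).pow hs k)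
    exact h1.of_le (Eventually.of_forall fun n => (hb n).trans (Real.le_norm_self _))
  refine ⟨fun n => ‖a n‖ * ‖(LinearMap.det (r n : V →ₗ[𝕜] V))⁻¹‖,
    ha'.norm.mul hs (hdet.inv hs).norm, ?_⟩
  filter_upwards [hdet.ne_zero hs] with n hn v
  have h1 : a n (r n v) = LinearMap.det (r n : V →ₗ[𝕜] V) • v := by
    have := congrArg (fun f : V →L[𝕜] V => f v) (ha n)
    simpa using this
  have h2 : v = (LinearMap.det (r n : V →ₗ[𝕜] V))⁻¹ • a n (r n v) := by
    rw [h1, smul_smul, inv_mul_cancel₀ hn, one_smul]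
  calc ‖v‖ = ‖(LinearMap.det (r n : V →ₗ[𝕜] V))⁻¹‖ * ‖a n (r n v)‖ := by
        conv_lhs => rw [h2]
        exact norm_smul _ _
    _ ≤ ‖(LinearMap.det (r n : V →ₗ[𝕜] V))⁻¹‖ * (‖a n‖ * ‖r n v‖) := by
        gcongr; exact (a n).le_opNorm _
    _ = _ := by ring

theorem Substantial.exists_of_sum (hs : IsScale ℓ δ) {E ι : Type*} [SeminormedAddCommGroup E]
    {s : Finset ι} {x : ι → ℕ → E}
    (h : Substantial ℓ δ (fun n => ∑ i ∈ s, ‖x i n‖)) : ∃ i ∈ s, Substantial ℓ δ (x i) := by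
  rcases s.eq_empty_or_nonempty with rfl | hne
  · obtain ⟨n, hn⟩ := (h.ne_zero hs).exists
    simp at hn
  have h1 : ∀ n, ∃ i ∈ s, ∀ j ∈ s, ‖x j n‖ ≤ ‖x i n‖ := fun n => s.exists_max_image _ hne
  have h2 : ∀ᶠ n in (ℓ : Filter ℕ), ∃ i ∈ (s : Set ι), ∀ j ∈ s, ‖x j n‖ ≤ ‖x i n‖ :=
    Eventually.of_forall h1
  rw [Ultrafilter.eventually_exists_mem_iff s.finite_toSet] at h2
  obtain ⟨i, hi, h3⟩ := h2
  refine ⟨i, hi, h.of_le_mul hs (Subpoly.const hs (s.card : ℝ)) (h3.mono fun n hn => ?_)⟩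
  rw [Real.norm_of_nonneg (Finset.sum_nonneg fun _ _ => norm_nonneg _), Real.norm_natCast]
  calc _ ≤ ∑ j ∈ s, ‖x i n‖ := Finset.sum_le_sum hn
    _ = _ := by simp

theorem exists_mem_substantial_det (hs : IsScale ℓ δ) {V : Type*} [NormedAddCommGroup V]
    [NormedSpace 𝕜 V] [FiniteDimensional 𝕜 V] (I : AddSubmonoid (ℕ → V →L[𝕜] V))
    (h1 : (1 : ℕ → V →L[𝕜] V) ∈ hull 𝕜 ℓ δ (I : Set (ℕ → V →L[𝕜] V))) :
    ∃ M ∈ I, Substantial ℓ δ (fun n => LinearMap.det (M n : V →ₗ[𝕜] V)) := by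
  have key : ∀ E ∈ hull 𝕜 ℓ δ (I : Set (ℕ → V →L[𝕜] V)), ∀ M₀ : ℕ → V →L[𝕜] V,
      Substantial ℓ δ (fun n => LinearMap.det ((M₀ n + E n : V →L[𝕜] V) : V →ₗ[𝕜] V)) →
      ∃ M ∈ I, Substantial ℓ δ (fun n => LinearMap.det ((M₀ n + M n : V →L[𝕜] V) : V →ₗ[𝕜] V)) := by
    intro E hE
    induction hE using AddSubmonoid.closure_induction with
    | zero => exact fun M₀ h => ⟨0, zero_mem _, h⟩
    | add a b _ _ ha hb =>
      intro M₀ h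
      obtain ⟨M, hM, h⟩ := ha (M₀ + b) (by
        have e : ∀ n, M₀ n + (a n + b n) = (M₀ + b) n + a n := fun n => by
          rw [Pi.add_apply]; abel
        simpa only [Pi.add_apply a b, e] using h)
      obtain ⟨M', hM', h⟩ := hb (M₀ + M) (by
        simpa only [Pi.add_apply, add_assoc, add_comm, add_left_comm] using h)
      exact ⟨M + M', add_mem hM hM', by simpa only [Pi.add_apply, add_assoc] using h⟩
    | mem a ha =>
      obtain ⟨c, hc, r, hr, rfl⟩ := ha
      intro M₀ h
      have h2 : Substantial ℓ δ (fun n => ∑ k ∈ Finset.range (Module.finrank 𝕜 V + 1),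
          ‖LinearMap.det ((M₀ n + k • r n : V →L[𝕜] V) : V →ₗ[𝕜] V)‖) := by
        have hz : Subpoly ℓ δ (fun n => (1 + Module.finrank 𝕜 V + ‖c n‖ : ℝ) ^ Module.finrank 𝕜 V) :=
          ((Subpoly.const hs (1 + Module.finrank 𝕜 V : ℝ)).add hs hc.norm).pow hs _
        refine h.of_le_mul hs hz (Eventually.of_forall fun n => ?_)
        refine (norm_det_add_smul_le (M₀ n) (r n) (c n : 𝕜)).trans ?_
        rw [RCLike.norm_ofReal, ← Real.norm_eq_abs]
        gcongr
        · exact Real.le_norm_self _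
        · exact Real.le_norm_self _
      obtain ⟨k, -, h3⟩ := Substantial.exists_of_sum hs h2
      exact ⟨k • r, nsmul_mem hr k, h3⟩
  obtain ⟨M, hM, h⟩ := key 1 h1 0 (by
    have := fun (η : ℝ) (hη : 0 < η) => hs.const_le 1 hη
    intro η hη
    filter_upwards [hs.le_one] with n hn
    have h3 : LinearMap.det (((0 : ℕ → V →L[𝕜] V) n + (1 : ℕ → V →L[𝕜] V) n : V →L[𝕜] V) : V →ₗ[𝕜] V) = 1 := by
      simp only [Pi.zero_apply, Pi.one_apply, zero_add]
      exact LinearMap.det_id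
    rw [h3, norm_one]
    exact Real.rpow_le_one (hs.pos n).le hn hη.le)
  exact ⟨M, hM, by simpa using! h⟩

variable {V : Type*} [NormedAddCommGroup V] [NormedSpace ℝ V] [FiniteDimensional ℝ V]
  [NormedSpace 𝕜 V] [FiniteDimensional 𝕜 V] {H : ℕ → Set V}

/-- Sequences of vectors whose adjoint operators almost preserve `H`. -/
def GoodSeq (ad : V →L[𝕜] V →L[𝕜] V) (hs : IsScale ℓ δ) (hH : Tame ℓ δ H) (w : ℕ → V) : Prop :=
  Subpoly ℓ δ w ∧ (fun n => ad (w n)) ∈ goodRing 𝕜 hs hH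

variable {ad : V →L[𝕜] V →L[𝕜] V} {hs : IsScale ℓ δ} {hH : Tame ℓ δ H}

theorem GoodSeq.add {w w' : ℕ → V} (h : GoodSeq ad hs hH w) (h' : GoodSeq ad hs hH w') :
    GoodSeq ad hs hH (fun n => w n + w' n) :=
  ⟨h.1.add hs h'.1, by simpa using! add_mem h.2 h'.2⟩

theorem GoodSeq.neg {w : ℕ → V} (h : GoodSeq ad hs hH w) :
    GoodSeq ad hs hH (fun n => -w n) :=
  ⟨h.1.neg, by simpa only [map_neg] using! neg_mem h.2⟩

theorem GoodSeq.sub {w w' : ℕ → V} (h : GoodSeq ad hs hH w) (h' : GoodSeq ad hs hH w') :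
    GoodSeq ad hs hH (fun n => w n - w' n) := by
  simpa [sub_eq_add_neg] using h.add h'.neg

theorem subpoly_mem_hull_goodRing
    (hgen : ∀ S : Set (V →L[𝕜] V), 1 ∈ S → (∀ v, ad v ∈ S) → (∀ a ∈ S, ∀ b ∈ S, a + b ∈ S) →
      (∀ a ∈ S, ∀ b ∈ S, a * b ∈ S) → (∀ c : ℝ, ∀ a ∈ S, (c : 𝕜) • a ∈ S) → S = Set.univ)
    (hy : ∀ v : V, (fun _ => v) ∈ hull 𝕜 ℓ δ {w | GoodSeq ad hs hH w})
    {Φ : ℕ → V →L[𝕜] V} (hΦ : Subpoly ℓ δ Φ) :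
    Φ ∈ hull 𝕜 ℓ δ (goodRing 𝕜 hs hH : Set (ℕ → V →L[𝕜] V)) := by
  refine mem_hull_of_const hs (fun G => ?_) hΦ
  have := hgen {G | (fun _ => G) ∈ hull 𝕜 ℓ δ (goodRing 𝕜 hs hH : Set (ℕ → V →L[𝕜] V))}
    (mem_hull hs (one_mem _)) (fun v => ?_) (fun a ha b hb => (hull 𝕜 ℓ δ _).add_mem (x := fun _ => a) (y := fun _ => b) ha hb)
    (fun a ha b hb => ?_)
    (fun c a ha => ?_)
  · exact this.symm.subset (Set.mem_univ G)
  · exact hull_linear hs (fun _ => (ad : V →ₗ[𝕜] V →L[𝕜] V)) (fun a ha => ha.2) (hy v)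
  · exact hull_bilin hs (fun _ => LinearMap.mul 𝕜 (V →L[𝕜] V)) (fun a ha b hb => mul_mem ha hb) ha hb
  · exact smul_mem_hull_of_mem hs (Subpoly.const hs c) ha

/-- The commutator-like pairing `Φ(·) Ξ(x) - Φ(x) Ξ(·)`, which vanishes at `x`. -/
noncomputable def elimination (x : V) :
    (V →L[𝕜] V →L[𝕜] V) →ₗ[𝕜] (V →L[𝕜] V →L[𝕜] V) →ₗ[𝕜] (V →L[𝕜] V →L[𝕜] V) :=
  LinearMap.mk₂ 𝕜 (fun Φ Ξ => LinearMap.toContinuousLinearMap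
    { toFun := fun v => Φ v * Ξ x - Φ x * Ξ v
      map_add' := fun v w => by rw [map_add, map_add, add_mul, mul_add]; abel
      map_smul' := fun c v => by simp [smul_sub] })
    (fun P P' Q => by ext v w; simp; abel) (fun c P Q => by ext v w; simp [smul_sub])
    (fun P Q Q' => by ext v w; simp; abel) (fun c P Q => by ext v w; simp [smul_sub])

theorem elimination_apply (x : V) (Φ Ξ : V →L[𝕜] V →L[𝕜] V) (v : V) :
    elimination x Φ Ξ v = Φ v * Ξ x - Φ x * Ξ v := rfl

theorem Subpoly.smulRight_one (hs : IsScale ℓ δ) {l : ℕ → V →L[𝕜] 𝕜} (hl : Subpoly ℓ δ l) :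
    Subpoly ℓ δ (fun n => (l n).smulRight (1 : V →L[𝕜] V)) :=
  Subpoly.of_mul_le (E := V →L[𝕜] V →L[𝕜] V) hs hl (Subpoly.const hs (1 : V →L[𝕜] V))
    (Eventually.of_forall fun n => (ContinuousLinearMap.norm_smulRight_apply _ _).le)

theorem mem_hull_of_forall_apply_eq_zero {ι : Type*} [DecidableEq ι]
    (hinj : ∀ v, ad v = 0 → v = 0)
    (hR : ∀ Φ : ℕ → V →L[𝕜] V, Subpoly ℓ δ Φ →
      Φ ∈ hull 𝕜 ℓ δ (goodRing 𝕜 hs hH : Set (ℕ → V →L[𝕜] V)))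
    {x : ι → ℕ → V} (hx : ∀ i, GoodSeq ad hs hH (x i)) {l : ι → ℕ → V →L[𝕜] 𝕜}
    (hl : ∀ i, Subpoly ℓ δ (l i)) (hlx : ∀ i j n, l i n (x j n) = if i = j then 1 else 0)
    (s : Finset ι) {Φ : ℕ → V →L[𝕜] V →L[𝕜] V} (hΦ : Subpoly ℓ δ Φ)
    (hΦs : ∀ j ∈ s, ∀ n, Φ n (x j n) = 0) :
    Φ ∈ hull 𝕜 ℓ δ {Ψ : ℕ → V →L[𝕜] V →L[𝕜] V |
      (∀ w, GoodSeq ad hs hH w → (fun n => Ψ n (w n)) ∈ goodRing 𝕜 hs hH) ∧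
      ∀ j ∈ s, ∀ n, Ψ n (x j n) = 0} := by
  induction s using Finset.induction_on generalizing Φ with
  | empty =>
    have key : ∀ A : ℕ → V →L[𝕜] V, Subpoly ℓ δ A → ∀ X ∈ AddSubmonoid.closure
        {x | ∃ P Q, x = sandwich ad P Q}, (fun n => (ContinuousLinearMap.mul 𝕜 (V →L[𝕜] V) (A n)).comp X) ∈
        hull 𝕜 ℓ δ {Ψ : ℕ → V →L[𝕜] V →L[𝕜] V |
          (∀ w, GoodSeq ad hs hH w → (fun n => Ψ n (w n)) ∈ goodRing 𝕜 hs hH) ∧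
          ∀ j ∈ (∅ : Finset ι), ∀ n, Ψ n (x j n) = 0} := by
      intro A hA X hX
      induction hX using AddSubmonoid.closure_induction with
      | zero => simp only [ContinuousLinearMap.comp_zero]; exact zero_mem _
      | add a b _ _ ha hb => simp only [ContinuousLinearMap.comp_add]; exact add_mem ha hb
      | mem X hX =>
        obtain ⟨P, Q, rfl⟩ := hX
        have hmem := hull_bilin hs (fun _ => sandwich ad) (K := {Ψ : ℕ → V →L[𝕜] V →L[𝕜] V |
          (∀ w, GoodSeq ad hs hH w → (fun n => Ψ n (w n)) ∈ goodRing 𝕜 hs hH) ∧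
          ∀ j ∈ (∅ : Finset ι), ∀ n, Ψ n (x j n) = 0})
          (fun a ha b hb => ⟨fun w hw => mul_mem (mul_mem ha hw.2) hb, by simp⟩)
          (hR (fun n => A n * P) (hA.mul hs (Subpoly.const hs P)))
          (hR (fun n => Q) (Subpoly.const hs Q))
        convert hmem using 2 with n
        ext v w
        simp [sandwich_apply]
    let b := Module.finBasis 𝕜 V
    have hsum : Φ = ∑ i, fun n => (ContinuousLinearMap.mul 𝕜 (V →L[𝕜] V) (Φ n (b i))).comp
        ((LinearMap.toContinuousLinearMap (b.coord i)).smulRight (1 : V →L[𝕜] V)) := by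
      ext n v w
      rw [Finset.sum_apply]
      have hv : Φ n v = ∑ i, b.repr v i • Φ n (b i) := by
        conv_lhs => rw [← b.sum_repr v]
        simp only [map_sum, map_smul]
      rw [hv]
      simp [_root_.sum_apply]
    rw [hsum]
    refine sum_mem fun i _ => key _ (hΦ.clm_apply hs (Subpoly.const hs (b i))) _
      (smulRight_one_mem_span_sandwich hinj _)
  | insert k s hk ih =>
    have h1 := ih hΦ fun j hj => hΦs j (Finset.mem_insert_of_mem hj)
    have h2 := ih (Φ := fun n => (l k n).smulRight (1 : V →L[𝕜] V))
      ((hl k).smulRight_one hs)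
      (fun j hj n => by
        have : k ≠ j := fun h => hk (h ▸ hj)
        simp [hlx, this])
    have h3 := hull_bilin hs (fun n => elimination (x k n)) (K := {Ψ : ℕ → V →L[𝕜] V →L[𝕜] V |
      (∀ w, GoodSeq ad hs hH w → (fun n => Ψ n (w n)) ∈ goodRing 𝕜 hs hH) ∧
      ∀ j ∈ insert k s, ∀ n, Ψ n (x j n) = 0}) (fun a ha b hb => ⟨fun w hw => ?_, fun j hj n => ?_⟩)
      h1 h2
    · convert h3 using 2 with n
      ext v w
      simp [elimination_apply, hlx, hΦs k (Finset.mem_insert_self _ _)]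
    · exact sub_mem (mul_mem (ha.1 w hw) (hb.1 _ (hx k))) (mul_mem (ha.1 _ (hx k)) (hb.1 w hw))
    · rw [elimination_apply]
      rcases Finset.mem_insert.1 hj with rfl | hj
      · exact sub_self _
      · rw [ha.2 j hj, hb.2 j hj, zero_mul, mul_zero, sub_zero]

end Elimination

section Homotheties

open Filter

variable {ℓ : Ultrafilter ℕ} {δ : ℕ → ℝ}
variable {𝕜 : Type*} [RCLike 𝕜]
variable {V : Type*} [NormedAddCommGroup V] [NormedSpace ℝ V] [FiniteDimensional ℝ V]
  [NormedSpace 𝕜 V] [FiniteDimensional 𝕜 V] {H : ℕ → Set V}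
variable {ad : V →L[𝕜] V →L[𝕜] V} {hs : IsScale ℓ δ} {hH : Tame ℓ δ H}

theorem dual_smul_one_mem_goodRing {ι : Type*} [Fintype ι] [DecidableEq ι]
    (hinj : ∀ v, ad v = 0 → v = 0)
    (hR : ∀ Φ : ℕ → V →L[𝕜] V, Subpoly ℓ δ Φ →
      Φ ∈ hull 𝕜 ℓ δ (goodRing 𝕜 hs hH : Set (ℕ → V →L[𝕜] V)))
    {x : ι → ℕ → V} (hx : ∀ i, GoodSeq ad hs hH (x i)) {l : ι → ℕ → V →L[𝕜] 𝕜}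
    (hl : ∀ i, Subpoly ℓ δ (l i)) (hlx : ∀ i j n, l i n (x j n) = if i = j then 1 else 0)
    (hsum : ∀ n v, ∑ i, l i n v • x i n = v) (i : ι) {w : ℕ → V} (hw : GoodSeq ad hs hH w) :
    (fun n => l i n (w n) • (1 : V →L[𝕜] V)) ∈ goodRing 𝕜 hs hH := by
  have h1 := mem_hull_of_forall_apply_eq_zero hinj hR hx hl hlx (Finset.univ.erase i)
    ((hl i).smulRight_one hs) (fun j hj n => by
      have : i ≠ j := (Finset.ne_of_mem_erase hj).symm
      simp [hlx, this])
  let I : AddSubmonoid (ℕ → V →L[𝕜] V) :=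
    { carrier := {M | M ∈ goodRing 𝕜 hs hH ∧ ∀ w, GoodSeq ad hs hH w →
        (fun n => l i n (w n) • M n) ∈ goodRing 𝕜 hs hH}
      zero_mem' := ⟨zero_mem _, fun w hw => by
        simp only [Pi.zero_apply, smul_zero]; exact zero_mem _⟩
      add_mem' := fun {a b} ha hb => ⟨add_mem ha.1 hb.1, fun w hw => by
        simp only [Pi.add_apply, smul_add]
        exact add_mem (ha.2 w hw) (hb.2 w hw)⟩ }
  have h2 := hull_linear hs (fun n => (ContinuousLinearMap.apply 𝕜 (V →L[𝕜] V) (x i n) :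
    (V →L[𝕜] V →L[𝕜] V) →ₗ[𝕜] (V →L[𝕜] V))) (K := (I : Set (ℕ → V →L[𝕜] V))) (fun Ψ hΨ => by
      refine ⟨hΨ.1 _ (hx i), fun w hw => ?_⟩
      have : (fun n => l i n (w n) • Ψ n (x i n)) = fun n => Ψ n (w n) := by
        ext1 n
        conv_rhs => rw [← hsum n (w n), map_sum]
        rw [Finset.sum_eq_single i (fun j _ hj => ?_) (by simp)]
        · rw [map_smul]
        · rw [map_smul, hΨ.2 j (Finset.mem_erase.2 ⟨hj, Finset.mem_univ _⟩) n, smul_zero]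
      change (fun n => l i n (w n) • Ψ n (x i n)) ∈ _
      rw [this]
      exact hΨ.1 w hw) h1
  have h3 : (1 : ℕ → V →L[𝕜] V) ∈ hull 𝕜 ℓ δ (I : Set (ℕ → V →L[𝕜] V)) := by
    convert h2 using 1
    ext n v
    simp [hlx]
  obtain ⟨M, hM, hdet⟩ := exists_mem_substantial_det hs I h3
  obtain ⟨K, hK, hinv⟩ := exists_inverse_bound hs (mem_goodRing.1 hM.1).1 hdet
  exact smul_one_mem_goodRing hM.1 hK hinv ((hl i).clm_apply hs hw.1) (hM.2 w hw)

theorem eventually_functionals {ι : Type*} [Fintype ι]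
    {x : ι → ℕ → V} (hx : ∀ i, Subpoly ℓ δ (x i)) {l : ι → ℕ → V →L[𝕜] 𝕜}
    (hl : ∀ i, Subpoly ℓ δ (l i)) (hsum : ∀ n v, ∑ i, l i n v • x i n = v)
    (hw : ∀ i, ∀ w : ℕ → V, (∀ n, w n ∈ H n + H n) →
      (fun n => l i n (w n) • (1 : V →L[𝕜] V)) ∈ goodRing 𝕜 hs hH)
    [Nonempty ι] {η : ℝ} (hη : 0 < η) :
    ∀ᶠ n in (ℓ : Filter ℕ), Functionals 𝕜 (δ n) (δ n ^ (-η)) (H n) (fun i => l i n) := by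
  have h1 : ∀ᶠ n in (ℓ : Filter ℕ), ∀ i, ‖l i n‖ ≤ δ n ^ (-η) :=
    eventually_all.2 fun i => hl i η hη
  have h2 : ∀ᶠ n in (ℓ : Filter ℕ), ∑ i, ‖x i n‖ ≤ δ n ^ (-η) :=
    (Subpoly.sum hs Finset.univ (fun i _ => (hx i).norm) η hη).mono fun n h =>
      (Real.le_norm_self _).trans h
  have h3 : ∀ i, ∀ᶠ n in (ℓ : Filter ℕ), ∀ w ∈ H n + H n,
      Cov (δ n) (δ n ^ (-η)) ((fun v => l i n w • v) '' H n) (H n) := fun i => by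
    by_contra hcon
    have hne : ∀ n, ∃ w ∈ H n + H n, (¬ ∀ w ∈ H n + H n,
        Cov (δ n) (δ n ^ (-η)) ((fun v => l i n w • v) '' H n) (H n)) →
        ¬ Cov (δ n) (δ n ^ (-η)) ((fun v => l i n w • v) '' H n) (H n) := fun n => by
      by_cases h : ∀ w ∈ H n + H n, Cov (δ n) (δ n ^ (-η)) ((fun v => l i n w • v) '' H n) (H n)
      · exact ⟨0 + 0, Set.add_mem_add (hH.zero_mem n) (hH.zero_mem n), fun h' => (h' h).elim⟩
      · obtain ⟨w, hw, hc⟩ := not_forall₂.1 h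
        exact ⟨w, hw, fun _ => hc⟩
    choose w hwm hwc using hne
    apply hcon
    filter_upwards [(mem_goodRing.1 (hw i w hwm)).2 η hη] with n hn
    by_contra hc
    exact hwc n hc hn
  filter_upwards [h1, h2, eventually_all.2 h3] with n h1 h2 h3
  refine ⟨fun i v => (l i n).le_of_opNorm_le (h1 i) v, fun v => ?_, h3⟩
  obtain ⟨i, -, hi⟩ := Finset.exists_max_image Finset.univ (fun i => ‖l i n v‖) Finset.univ_nonempty
  refine ⟨i, ?_⟩
  calc ‖v‖ = ‖∑ i, l i n v • x i n‖ := by rw [hsum]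
    _ ≤ ∑ j, ‖l i n v‖ * ‖x j n‖ := norm_sum_le_of_le _ fun j hj => by
        rw [norm_smul]
        exact mul_le_mul_of_nonneg_right (hi j hj) (norm_nonneg _)
    _ = (∑ j, ‖x j n‖) * ‖l i n v‖ := by rw [← Finset.mul_sum, mul_comm]
    _ ≤ _ := by gcongr

theorem exists_operators
    (hR : ∀ Φ : ℕ → V →L[𝕜] V, Subpoly ℓ δ Φ →
      Φ ∈ hull 𝕜 ℓ δ (goodRing 𝕜 hs hH : Set (ℕ → V →L[𝕜] V))) :
    ∃ (J : Type) (_ : Fintype J) (r : J → ℕ → V →L[𝕜] V), ∀ η : ℝ, 0 < η →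
      ∀ᶠ n in (ℓ : Filter ℕ), Operators (δ n) (δ n ^ (-η)) (H n) (fun j => r j n) := by
  let b := Module.finBasis 𝕜 (V →L[𝕜] V)
  let t : Fin (Module.finrank 𝕜 (V →L[𝕜] V)) × Bool → (V →L[𝕜] V) → ℝ := fun p G =>
    if p.2 then RCLike.im (b.repr G p.1) else RCLike.re (b.repr G p.1)
  let e : Fin (Module.finrank 𝕜 (V →L[𝕜] V)) × Bool → (V →L[𝕜] V) := fun p =>
    if p.2 then (RCLike.I : 𝕜) • b p.1 else b p.1
  have hte : ∀ G, G = ∑ p, (t p G : 𝕜) • e p := fun G => by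
    rw [Fintype.sum_prod_type]
    conv_lhs => rw [← b.sum_repr G]
    refine Finset.sum_congr rfl fun i _ => ?_
    rw [Fintype.sum_bool]
    simp only [t, e, if_true, Bool.false_eq_true, if_false]
    rw [smul_smul, ← add_smul]
    congr 1
    conv_lhs => rw [← RCLike.re_add_im (b.repr G i)]
    exact add_comm _ _
  let T := LinearMap.toContinuousLinearMap b.equivFun.toLinearMap
  have ht : ∀ p G, |t p G| ≤ ‖T‖ * ‖G‖ := fun p G => by
    have h1 : ‖b.repr G p.1‖ ≤ ‖T‖ * ‖G‖ :=
      (norm_le_pi_norm (T G) p.1).trans (T.le_opNorm G)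
    simp only [t]
    split_ifs
    · exact (RCLike.abs_im_le_norm _).trans h1
    · exact (RCLike.abs_re_le_norm _).trans h1
  choose J hJ c r hc hr hsum using fun p => exists_sum_of_mem_hull (hR _ (Subpoly.const hs (e p)))
  refine ⟨Σ p, J p, inferInstance, fun q => r q.1 q.2, fun η hη => ?_⟩
  have h1 : ∀ᶠ n in (ℓ : Filter ℕ), ∀ q : Σ p, J p, ‖r q.1 q.2 n‖ ≤ δ n ^ (-η) :=
    eventually_all.2 fun q => (mem_goodRing.1 (hr q.1 q.2)).1 η hη
  have h2 : ∀ᶠ n in (ℓ : Filter ℕ), ∀ q : Σ p, J p,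
      Cov (δ n) (δ n ^ (-η)) (r q.1 q.2 n '' H n) (H n) :=
    eventually_all.2 fun q => (mem_goodRing.1 (hr q.1 q.2)).2 η hη
  have h3 : ∀ᶠ n in (ℓ : Filter ℕ), ∀ q : Σ p, J p, ‖‖T‖ * ‖c q.1 q.2 n‖‖ ≤ δ n ^ (-η) :=
    eventually_all.2 fun q => (Subpoly.const hs ‖T‖).mul hs (hc q.1 q.2).norm η hη
  filter_upwards [h1, h2, h3] with n h1 h2 h3
  refine ⟨h1, h2, fun G => ⟨fun q => t q.1 G * c q.1 q.2 n, ?_, fun q => ?_⟩⟩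
  · rw [Fintype.sum_sigma]
    conv_lhs => rw [hte G]
    refine Finset.sum_congr rfl fun p _ => ?_
    rw [hsum p n, Finset.smul_sum]
    refine Finset.sum_congr rfl fun j _ => ?_
    rw [smul_smul, RCLike.ofReal_mul]
  · rw [abs_mul]
    calc _ ≤ ‖T‖ * ‖G‖ * |c q.1 q.2 n| := by gcongr; exact ht _ _
      _ = (‖T‖ * ‖c q.1 q.2 n‖) * ‖G‖ := by rw [Real.norm_eq_abs]; ring
      _ ≤ _ := by gcongr; exact (Real.le_norm_self _).trans (h3 q)

end Homotheties

section CoefficientField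

open Polynomial

variable {K : Type*} [Field K] {O : Subring K} {m : Ideal O}

theorem aeval_coe_mem (k : Subfield K) (hk : k.toSubring ≤ O) (y : O) (s : k[X]) :
    aeval (y : K) s = (((s.map (Subring.inclusion hk : k →+* O)).eval y : O) : K) := by
  rw [aeval_def, eval_map, ← Subring.coe_subtype, hom_eval₂]
  rfl

theorem mem_of_forall_eval_notMem {k : Subfield K} (hk : k.toSubring ≤ O)
    (hmax : ∀ k' : Subfield K, k ≤ k' → k'.toSubring ≤ O → k' ≤ k)
    (hunit : ∀ x : O, x ∉ m → ∃ y : O, x * y = 1) (y : O)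
    (hy : ∀ s : k[X], (s.map (Subring.inclusion hk : k →+* O)).eval y ∈ m →
      (s.map (Subring.inclusion hk : k →+* O)).eval y = 0) : (y : K) ∈ k := by
  let F : IntermediateField k K := IntermediateField.adjoin k {(y : K)}
  have h1 : k ≤ F.toSubfield := fun x hx => F.algebraMap_mem ⟨x, hx⟩
  refine hmax F.toSubfield h1 (fun x hx => ?_) (IntermediateField.mem_adjoin_simple_self k (y : K))
  obtain ⟨r, s, rfl⟩ := (IntermediateField.mem_adjoin_simple_iff k x).1 hx
  rw [aeval_coe_mem k hk, aeval_coe_mem k hk]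
  set a := (r.map (Subring.inclusion hk : k →+* O)).eval y
  set b := (s.map (Subring.inclusion hk : k →+* O)).eval y with hb
  by_cases hbm : b ∈ m
  · have hb0 : b = 0 := hy s hbm
    rw [hb0]; simp [O.zero_mem]
  · obtain ⟨c, hc⟩ := hunit b hbm
    have hc' : (b : K) * c = 1 := by exact_mod_cast congrArg Subtype.val hc
    have : (a : K) / b = a * c := by
      rw [div_eq_mul_inv, inv_eq_of_mul_eq_one_right hc']
    rw [this]
    exact O.mul_mem a.2 c.2

theorem exists_coefficient_field [CharZero K] (hm : (1 : O) ∉ m)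
    (hunit : ∀ x : O, x ∉ m → ∃ y : O, x * y = 1)
    (hensel : ∀ (q : O[X]) (x : O), q.eval x ∈ m → q.derivative.eval x ∉ m →
      ∃ y : O, q.eval y = 0 ∧ y - x ∈ m) (k₀ : Subfield K) (hk₀ : k₀.toSubring ≤ O) :
    ∃ k : Subfield K, k₀ ≤ k ∧ k.toSubring ≤ O ∧ ∀ x : O, ∃ y : O, (y : K) ∈ k ∧ y - x ∈ m := by
  obtain ⟨k, hk₀k, hk⟩ := zorn_le_nonempty₀ {k : Subfield K | k.toSubring ≤ O}
    (fun c hc hch y hy => ⟨sSup c, fun x hx => by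
      have hx' : x ∈ sSup c := hx
      rw [Subfield.mem_sSup_of_directedOn ⟨y, hy⟩ hch.directedOn] at hx'
      obtain ⟨s, hs, hxs⟩ := hx'
      exact hc hs hxs, fun z hz => le_sSup hz⟩) k₀ hk₀
  have hkO : k.toSubring ≤ O := hk.1
  have hmax : ∀ k' : Subfield K, k ≤ k' → k'.toSubring ≤ O → k' ≤ k := fun k' h h' => hk.2 h' h
  refine ⟨k, hk₀k, hkO, fun x => ?_⟩
  set φ : k →+* O := Subring.inclusion hkO with hφ
  by_cases hx : ∀ s : k[X], (s.map φ).eval x ∈ m → (s.map φ).eval x = 0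
  · exact ⟨x, mem_of_forall_eval_notMem hkO hmax hunit x hx, by simp⟩
  push Not at hx
  obtain ⟨s₀, hs₀, hs₀'⟩ := hx
  have hex : ∃ N, ∃ s : k[X], s ≠ 0 ∧ (s.map φ).eval x ∈ m ∧ s.natDegree = N :=
    ⟨_, s₀, by rintro rfl; simp at hs₀', hs₀, rfl⟩
  classical
  obtain ⟨p, hp0, hpm, hpN⟩ := Nat.find_spec hex
  have hmin : ∀ s : k[X], s ≠ 0 → (s.map φ).eval x ∈ m → p.natDegree ≤ s.natDegree :=
    fun s h h' => hpN ▸ Nat.find_min' hex ⟨s, h, h', rfl⟩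
  have hdeg : p.natDegree ≠ 0 := fun h => by
    rw [natDegree_eq_zero] at h
    obtain ⟨c, rfl⟩ := h
    have hc : c ≠ 0 := by rintro rfl; simp at hp0
    rw [map_C, eval_C] at hpm
    apply hm
    have := m.mul_mem_left (φ c⁻¹) hpm
    rwa [← map_mul, inv_mul_cancel₀ hc, map_one] at this
  have hder : (p.map φ).derivative.eval x ∉ m := fun h => by
    rw [derivative_map] at h
    have h2 : derivative p ≠ 0 := fun h0 => hdeg (derivative_eq_zero.1 h0)
    exact absurd (hmin _ h2 h) (not_le.2 (natDegree_derivative_lt hdeg))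
  obtain ⟨y, hy0, hyx⟩ := hensel _ x hpm hder
  refine ⟨y, mem_of_forall_eval_notMem hkO hmax hunit y fun s hs => ?_, hyx⟩
  have h1 : (s.map φ).eval y = ((s % p).map φ).eval y := by
    conv_lhs => rw [← EuclideanDomain.div_add_mod s p]
    rw [Polynomial.map_add, Polynomial.map_mul, eval_add, eval_mul, hy0, zero_mul, zero_add]
  change (s.map φ).eval y ∈ m at hs
  change (s.map φ).eval y = 0
  rw [h1] at hs ⊢
  have h2 : ((s % p).map φ).eval x ∈ m := by
    obtain ⟨c, hc⟩ := sub_dvd_eval_sub y x ((s % p).map φ)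
    have h3 : ((s % p).map φ).eval y - ((s % p).map φ).eval x ∈ m := by
      rw [hc]; exact m.mul_mem_right _ hyx
    simpa using m.sub_mem hs h3
  have h4 : s % p = 0 := by
    by_contra h
    exact absurd (hmin _ h h2) (not_le.2 (natDegree_mod_lt s hdeg))
  rw [h4]; simp

end CoefficientField

section Residues

open Filter

variable {ℓ : Ultrafilter ℕ} {δ : ℕ → ℝ}

/-- Sequences bounded by some positive power of the scale. -/
def Negligible (ℓ : Ultrafilter ℕ) (δ : ℕ → ℝ) {E : Type*} [Norm E] (x : ℕ → E) : Prop :=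
  ∃ η : ℝ, 0 < η ∧ ∀ᶠ n in (ℓ : Filter ℕ), ‖x n‖ ≤ δ n ^ η

variable {E F G : Type*} [SeminormedAddCommGroup E] [SeminormedAddCommGroup F]
  [SeminormedAddCommGroup G]

theorem Negligible.of_mul_le (hs : IsScale ℓ δ) {x : ℕ → E} {y : ℕ → F} {z : ℕ → G}
    (hy : Subpoly ℓ δ y) (hz : Negligible ℓ δ z) (h : ∀ᶠ n in (ℓ : Filter ℕ), ‖x n‖ ≤ ‖y n‖ * ‖z n‖) :
    Negligible ℓ δ x := by
  obtain ⟨η, hη, hz⟩ := hz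
  refine ⟨η / 2, by positivity, ?_⟩
  filter_upwards [hy (η / 2) (by positivity), hz, h] with n h1 h2 h3
  have := hs.pos n
  calc ‖x n‖ ≤ δ n ^ (-(η / 2)) * δ n ^ η := h3.trans (by gcongr)
    _ = _ := by rw [← Real.rpow_add this]; congr 1; ring

theorem Negligible.of_le {x : ℕ → E} {y : ℕ → F} (hy : Negligible ℓ δ y)
    (h : ∀ᶠ n in (ℓ : Filter ℕ), ‖x n‖ ≤ ‖y n‖) : Negligible ℓ δ x := by
  obtain ⟨η, hη, hy⟩ := hy
  exact ⟨η, hη, by filter_upwards [hy, h] with n h1 h2 using h2.trans h1⟩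

theorem negligible_zero (hs : IsScale ℓ δ) : Negligible ℓ δ (fun _ => (0 : E)) :=
  ⟨1, one_pos, Eventually.of_forall fun n => by simpa using (hs.pos n).le⟩

theorem Negligible.add (hs : IsScale ℓ δ) {x y : ℕ → E} (hx : Negligible ℓ δ x)
    (hy : Negligible ℓ δ y) : Negligible ℓ δ (fun n => x n + y n) := by
  obtain ⟨η, hη, hx⟩ := hx
  obtain ⟨η', hη', hy⟩ := hy
  have hμ : 0 < min η η' := lt_min hη hη'
  refine Negligible.of_mul_le hs (Subpoly.const hs (2 : ℝ)) (z := fun n => δ n ^ min η η')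
    ⟨min η η', hμ, Eventually.of_forall fun n => ?_⟩ ?_
  · rw [Real.norm_of_nonneg (Real.rpow_nonneg (hs.pos n).le _)]
  · filter_upwards [hx, hy, hs.le_one] with n h1 h2 h3
    have hp := hs.pos n
    rw [Real.norm_of_nonneg (Real.rpow_nonneg (hs.pos n).le _)]
    have h4 : δ n ^ η ≤ δ n ^ min η η' := Real.rpow_le_rpow_of_exponent_ge hp h3 (min_le_left _ _)
    have h5 : δ n ^ η' ≤ δ n ^ min η η' := Real.rpow_le_rpow_of_exponent_ge hp h3 (min_le_right _ _)
    have h6 := norm_add_le (x n) (y n)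
    rw [Real.norm_ofNat]
    linarith

theorem Negligible.subpoly (hs : IsScale ℓ δ) {x : ℕ → E} (hx : Negligible ℓ δ x) : Subpoly ℓ δ x := by
  obtain ⟨η, hη, hx⟩ := hx
  intro η' hη'
  filter_upwards [hx, hs.le_one] with n h1 h3
  exact h1.trans (Real.rpow_le_rpow_of_exponent_ge (hs.pos n) h3 (by linarith))

theorem substantial_of_not_negligible {x : ℕ → E} (hx : ¬ Negligible ℓ δ x) : Substantial ℓ δ x := by
  intro η hη
  have : ¬ ∀ᶠ n in (ℓ : Filter ℕ), ‖x n‖ ≤ δ n ^ η := fun h => hx ⟨η, hη, h⟩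
  rw [← Ultrafilter.eventually_not] at this
  exact this.mono fun n h => (not_le.1 h).le

theorem Substantial.not_negligible (hs : IsScale ℓ δ) {x : ℕ → E} (hx : Substantial ℓ δ x) :
    ¬ Negligible ℓ δ x := by
  rintro ⟨η, hη, h⟩
  obtain ⟨n, h1, h2, h3⟩ := ((hx (η / 2) (by positivity)).and (h.and (hs.const_le 2 (half_pos hη)))).exists
  have hp := hs.pos n
  have h4 : δ n ^ η = δ n ^ (η / 2) * δ n ^ (η / 2) := by rw [← Real.rpow_add hp]; congr 1; ring
  have h5 : 0 < δ n ^ (η / 2) := Real.rpow_pos_of_pos hp _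
  rw [Real.rpow_neg hp.le] at h3
  have h6 : δ n ^ (η / 2) ≤ 1 / 2 := by
    rw [le_inv_comm₀ (by norm_num) h5] at h3; linarith
  nlinarith [h1.trans h2]

/-- The ring of subpolynomial real sequences. -/
def subpolyRing (hs : IsScale ℓ δ) : Subring (ℕ → ℝ) where
  carrier := {x | Subpoly ℓ δ x}
  zero_mem' := Subpoly.const hs (0 : ℝ)
  one_mem' := Subpoly.const hs (1 : ℝ)
  add_mem' := fun ha hb => Subpoly.add hs ha hb
  mul_mem' := fun ha hb => Subpoly.mul hs ha hb
  neg_mem' := fun ha => Subpoly.neg ha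

theorem exists_root_of_taylor (p : Polynomial ℝ) {x u P D k₁ k₂ : ℝ} (hupos : 0 < u) (hu2 : u ≤ 1 / 2)
    (a1 : p.eval (x + u ^ 4) = P + D * u ^ 4 + k₁ * (u ^ 4) ^ 2)
    (a2 : p.eval (x - u ^ 4) = P + D * (-u ^ 4) + k₂ * (-u ^ 4) ^ 2) (h0 : |P| ≤ u ^ 8)
    (h1 : u ≤ |D|) (hb₁ : |k₁| ≤ u⁻¹) (hb₂ : |k₂| ≤ u⁻¹) : ∃ t, |t - x| ≤ u ^ 4 ∧ p.eval t = 0 := by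
  have b : ∀ c : ℝ, |c| ≤ u⁻¹ → |c * (u ^ 4) ^ 2| ≤ u ^ 7 := fun c hc => by
    rw [abs_mul, abs_of_pos (by positivity : 0 < (u ^ 4) ^ 2)]
    calc _ ≤ u⁻¹ * (u ^ 4) ^ 2 := by gcongr
      _ = _ := by field_simp
  have b1 := abs_le.1 (b _ hb₁)
  have b2 := abs_le.1 (b _ hb₂)
  have b3 := abs_le.1 h0
  have b4 : u ^ 8 + u ^ 7 ≤ u * u ^ 4 := by
    have e : u ^ 8 + u ^ 7 = u * u ^ 4 * (u ^ 3 + u ^ 2) := by ring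
    have : u ^ 3 + u ^ 2 ≤ 1 := by nlinarith
    rw [e]
    exact mul_le_of_le_one_right (by positivity) this
  have hivt := intermediate_value_uIcc (p.continuous.continuousOn (s := Set.uIcc (x - u ^ 4) (x + u ^ 4)))
  simp only [a1, a2] at hivt
  have h0mem : (0 : ℝ) ∈ Set.uIcc (P + D * (-u ^ 4) + k₂ * (-u ^ 4) ^ 2)
      (P + D * u ^ 4 + k₁ * (u ^ 4) ^ 2) := by
    rw [Set.mem_uIcc, neg_sq, mul_neg]
    rcases le_total 0 D with hD | hD
    · rw [abs_of_nonneg hD] at h1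
      have : u * u ^ 4 ≤ D * u ^ 4 := by gcongr
      left; constructor <;> linarith [b1.1, b1.2, b2.1, b2.2, b3.1, b3.2]
    · rw [abs_of_nonpos hD] at h1
      have : u * u ^ 4 ≤ -D * u ^ 4 := by gcongr
      rw [neg_mul] at this
      right; constructor <;> linarith [b1.1, b1.2, b2.1, b2.2, b3.1, b3.2]
  obtain ⟨t, ht, ht0⟩ := hivt h0mem
  refine ⟨t, ?_, ht0⟩
  rw [Set.uIcc_of_le (by linarith [pow_pos hupos 4])] at ht
  rw [abs_le]; constructor <;> linarith [ht.1, ht.2]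

theorem exists_root_near (hs : IsScale ℓ δ) (Q : Polynomial (subpolyRing hs)) (x : subpolyRing hs)
    (h0 : Negligible ℓ δ (Q.eval x).1) (h1 : ¬ Negligible ℓ δ (Q.derivative.eval x).1) :
    ∃ y : subpolyRing hs, (∀ᶠ n in (ℓ : Filter ℕ), (Q.eval y).1 n = 0) ∧
      Negligible ℓ δ (fun n => (y : ℕ → ℝ) n - (x : ℕ → ℝ) n) := by
  obtain ⟨η, hη, h0⟩ := h0
  replace h1 := substantial_of_not_negligible h1
  let ψ : ∀ n, subpolyRing hs →+* ℝ := fun n => (Pi.evalRingHom (fun _ => ℝ) n).comp (subpolyRing hs).subtype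
  have hev : ∀ (y : subpolyRing hs) n, (Q.eval y).1 n = (Q.map (ψ n)).eval ((y : ℕ → ℝ) n) := by
    intro y n
    have := Polynomial.eval₂_hom (p := Q) (ψ n) y
    rw [Polynomial.eval_map]
    exact this.symm
  have hmem : Negligible ℓ δ (fun n => δ n ^ (4 * (η / 8))) := ⟨4 * (η / 8), by positivity,
    Eventually.of_forall fun n => by rw [Real.norm_of_nonneg (Real.rpow_nonneg (hs.pos n).le _)]⟩
  let h : subpolyRing hs := ⟨fun n => δ n ^ (4 * (η / 8)), hmem.subpoly hs⟩
  obtain ⟨k₁, hk₁⟩ := Polynomial.binomExpansion Q x h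
  obtain ⟨k₂, hk₂⟩ := Polynomial.binomExpansion Q x (-h)
  have key : ∀ᶠ n in (ℓ : Filter ℕ), ∃ t, |t - (x : ℕ → ℝ) n| ≤ δ n ^ (4 * (η / 8)) ∧
      (Q.map (ψ n)).eval t = 0 := by
    filter_upwards [h0, h1 (η / 8) (by positivity), k₁.2 (η / 8) (by positivity),
      k₂.2 (η / 8) (by positivity), hs.const_le 2 (show 0 < η / 8 by positivity)] with n h0 h1 hb₁ hb₂ h2
    have hp := hs.pos n
    set u := δ n ^ (η / 8) with hu
    have hupos : 0 < u := Real.rpow_pos_of_pos hp _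
    have e4 : δ n ^ (4 * (η / 8)) = u ^ 4 := by
      rw [hu, ← Real.rpow_natCast, ← Real.rpow_mul hp.le]; congr 1; push_cast; ring
    have e8 : δ n ^ η = u ^ 8 := by
      rw [hu, ← Real.rpow_natCast, ← Real.rpow_mul hp.le]; congr 1; push_cast; ring
    rw [Real.rpow_neg hp.le, ← hu] at hb₁ hb₂ h2
    have hu2 : u ≤ 1 / 2 := by
      rw [le_inv_comm₀ (by norm_num) hupos] at h2; linarith
    have a1 : (Q.eval (x + h)).1 n = (Q.eval x).1 n +
        (Q.derivative.eval x).1 n * u ^ 4 + (k₁ : ℕ → ℝ) n * (u ^ 4) ^ 2 := by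
      rw [hk₁, ← e4]; rfl
    have a2 : (Q.eval (x + -h)).1 n = (Q.eval x).1 n +
        (Q.derivative.eval x).1 n * (-u ^ 4) + (k₂ : ℕ → ℝ) n * (-u ^ 4) ^ 2 := by
      rw [hk₂, ← e4]; rfl
    rw [hev] at a1 a2
    have c1 : ((x + h : subpolyRing hs) : ℕ → ℝ) n = (x : ℕ → ℝ) n + u ^ 4 := by rw [← e4]; rfl
    have c2 : ((x + -h : subpolyRing hs) : ℕ → ℝ) n = (x : ℕ → ℝ) n - u ^ 4 := by
      rw [← e4, sub_eq_add_neg]; rfl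
    rw [c1] at a1
    rw [c2] at a2
    rw [e8] at h0
    rw [e4]
    exact exists_root_of_taylor _ hupos hu2 a1 a2 h0 h1 hb₁ hb₂
  classical
  let y : ℕ → ℝ := fun n => if hn : ∃ t, |t - (x : ℕ → ℝ) n| ≤ δ n ^ (4 * (η / 8)) ∧
      (Q.map (ψ n)).eval t = 0 then hn.choose else 0
  have hy : ∀ᶠ n in (ℓ : Filter ℕ), |y n - (x : ℕ → ℝ) n| ≤ δ n ^ (4 * (η / 8)) ∧
      (Q.map (ψ n)).eval (y n) = 0 := by
    filter_upwards [key] with n hn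
    simp only [y, dif_pos hn]
    exact hn.choose_spec
  have hyx : Negligible ℓ δ (fun n => y n - (x : ℕ → ℝ) n) :=
    ⟨4 * (η / 8), by positivity, hy.mono fun n hn => hn.1⟩
  have hyS : Subpoly ℓ δ y := by
    have := (hyx.subpoly hs).add hs x.2
    simpa using this
  exact ⟨⟨y, hyS⟩, hy.mono fun n hn => by rw [hev]; exact hn.2, hyx⟩

end Residues

section GermField

open Filter

variable {ℓ : Ultrafilter ℕ} {δ : ℕ → ℝ}

theorem germ_negligible_iff {x y : ℕ → ℝ} (h : (x : Germ (ℓ : Filter ℕ) ℝ) = y) :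
    Negligible ℓ δ x ↔ Negligible ℓ δ y := by
  have h := Germ.coe_eq.1 h
  exact ⟨fun hx => hx.of_le (h.mono fun n hn => by rw [hn]),
    fun hx => hx.of_le (h.mono fun n hn => by rw [hn])⟩

theorem germ_subpoly_iff {x y : ℕ → ℝ} (h : (x : Germ (ℓ : Filter ℕ) ℝ) = y) :
    Subpoly ℓ δ x ↔ Subpoly ℓ δ y := by
  have h := Germ.coe_eq.1 h
  exact ⟨fun hx => hx.of_le (h.mono fun n hn => by rw [hn]),
    fun hx => hx.of_le (h.mono fun n hn => by rw [hn])⟩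

/-- The germs of subpolynomial sequences contain a field of representatives for the residue field
modulo negligible sequences, which can be chosen to contain the real constants. -/
theorem exists_germ_coefficient_field (hs : IsScale ℓ δ) :
    ∃ k : Subfield (Germ (ℓ : Filter ℕ) ℝ), (∀ c : ℝ, ((fun _ => c : ℕ → ℝ) : Germ (ℓ : Filter ℕ) ℝ) ∈ k) ∧
      (∀ f : ℕ → ℝ, (f : Germ (ℓ : Filter ℕ) ℝ) ∈ k → Subpoly ℓ δ f) ∧
      ∀ f : ℕ → ℝ, Subpoly ℓ δ f → ∃ g : ℕ → ℝ, (g : Germ (ℓ : Filter ℕ) ℝ) ∈ k ∧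
        Negligible ℓ δ (fun n => g n - f n) := by
  let K := Germ (ℓ : Filter ℕ) ℝ
  let c : (ℕ → ℝ) →+* K := Germ.coeRingHom (ℓ : Filter ℕ)
  let O : Subring K := (subpolyRing hs).map c
  have hO : ∀ f : ℕ → ℝ, c f ∈ O ↔ Subpoly ℓ δ f := by
    intro f
    refine ⟨?_, fun hf => ⟨f, hf, rfl⟩⟩
    rintro ⟨g, hg, hgf⟩
    exact (germ_subpoly_iff hgf).1 hg
  let m : Ideal O :=
    { carrier := {x | ∃ f : ℕ → ℝ, c f = x.1 ∧ Negligible ℓ δ f}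
      zero_mem' := ⟨fun _ => 0, rfl, negligible_zero hs⟩
      add_mem' := by
        rintro x y ⟨f, hf, hf'⟩ ⟨g, hg, hg'⟩
        refine ⟨fun n => f n + g n, ?_, hf'.add hs hg'⟩
        change c (f + g) = x.1 + y.1
        rw [map_add, hf, hg]
      smul_mem' := by
        rintro x y ⟨f, hf, hf'⟩
        obtain ⟨g, hg, hg'⟩ := x.2
        refine ⟨fun n => g n * f n, ?_, Negligible.of_mul_le hs hg hf' (Eventually.of_forall fun n => (norm_mul _ _).le)⟩
        change c (g * f) = x.1 * y.1
        rw [map_mul, hf, hg'] }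
  have hmem : ∀ (x : O) (f : ℕ → ℝ), c f = x.1 → (x ∈ m ↔ Negligible ℓ δ f) := by
    intro x f hf
    refine ⟨?_, fun h => ⟨f, hf, h⟩⟩
    rintro ⟨g, hg, hgn⟩
    exact (germ_negligible_iff (hg.trans hf.symm)).1 hgn
  let φ : subpolyRing hs →+* O := (c.comp (subpolyRing hs).subtype).codRestrict O
    fun x => ⟨x.1, x.2, rfl⟩
  have hφ : ∀ x : subpolyRing hs, (φ x).1 = c x.1 := fun x => rfl
  have hφs : Function.Surjective φ := by
    rintro ⟨x, f, hf, hx⟩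
    exact ⟨⟨f, hf⟩, Subtype.ext hx⟩
  have hm1 : (1 : O) ∉ m := by
    rw [hmem 1 1 (map_one c)]
    refine Substantial.not_negligible hs fun η hη => ?_
    filter_upwards [hs.le_one] with n hn
    simpa using Real.rpow_le_one (hs.pos n).le hn hη.le
  have hunit : ∀ x : O, x ∉ m → ∃ y : O, x * y = 1 := by
    intro x hx
    obtain ⟨f, rfl⟩ := hφs x
    rw [hmem _ f.1 (hφ f).symm] at hx
    have hsub := substantial_of_not_negligible hx
    have hinv := hsub.inv hs
    refine ⟨φ ⟨_, hinv⟩, ?_⟩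
    refine Subtype.ext ?_
    change c f.1 * c _ = c 1
    rw [← map_mul]
    refine Germ.coe_eq.2 ?_
    filter_upwards [hsub.ne_zero hs] with n hn
    exact mul_inv_cancel₀ hn
  have hensel : ∀ (q : Polynomial O) (x : O), q.eval x ∈ m → q.derivative.eval x ∉ m →
      ∃ y : O, q.eval y = 0 ∧ y - x ∈ m := by
    intro q x h0 h1
    obtain ⟨Q, rfl⟩ := Polynomial.map_surjective φ hφs q
    obtain ⟨x, rfl⟩ := hφs x
    have ev : ∀ (P : Polynomial (subpolyRing hs)) x, (P.map φ).eval (φ x) = φ (P.eval x) := by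
      intro P x
      rw [Polynomial.eval_map, Polynomial.eval₂_hom]
    rw [ev, hmem _ _ (hφ _).symm] at h0
    rw [Polynomial.derivative_map, ev, hmem _ _ (hφ _).symm] at h1
    obtain ⟨y, hy, hyx⟩ := exists_root_near hs Q x h0 h1
    refine ⟨φ y, ?_, ?_⟩
    · rw [ev]
      exact Subtype.ext (Germ.coe_eq.2 hy)
    · rw [← map_sub, hmem _ _ (hφ _).symm]
      exact hyx
  let κ : ℝ →+* K := c.comp (Pi.constRingHom ℕ ℝ)
  obtain ⟨k, hk0, hkO, hk⟩ := exists_coefficient_field hm1 hunit hensel κ.fieldRange (by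
    rintro x ⟨r, rfl⟩
    exact (hO _).2 (Subpoly.const hs r))
  refine ⟨k, fun r => hk0 ⟨r, rfl⟩, fun f hf => (hO f).1 (hkO hf), fun f hf => ?_⟩
  obtain ⟨y, hy, hyf⟩ := hk (φ ⟨f, hf⟩)
  obtain ⟨g, rfl⟩ := hφs y
  refine ⟨g.1, hy, ?_⟩
  rw [← map_sub, hmem _ _ (hφ _).symm] at hyf
  exact hyf

end GermField

section Lift

open Filter

variable {ℓ : Ultrafilter ℕ} {δ : ℕ → ℝ}

/-- The ideal of negligible sequences. -/
def negligibleIdeal (hs : IsScale ℓ δ) : Ideal (subpolyRing hs) where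
  carrier := {x | Negligible ℓ δ x.1}
  zero_mem' := negligible_zero hs
  add_mem' := fun ha hb => Negligible.add hs ha hb
  smul_mem' := fun c _ hx => Negligible.of_mul_le hs c.2 hx
    (Eventually.of_forall fun _ => (norm_mul _ _).le)

theorem negligible_det_sub (hs : IsScale ℓ δ) {ι : Type*} [Fintype ι] [DecidableEq ι]
    {M N : ι → ι → ℕ → ℝ} (hM : ∀ i j, Subpoly ℓ δ (M i j)) (hN : ∀ i j, Subpoly ℓ δ (N i j))
    (h : ∀ i j, Negligible ℓ δ (fun n => M i j n - N i j n)) :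
    Negligible ℓ δ (fun n => (Matrix.of fun i j => M i j n).det - (Matrix.of fun i j => N i j n).det) := by
  let M' : Matrix ι ι (subpolyRing hs) := Matrix.of fun i j => ⟨M i j, hM i j⟩
  let N' : Matrix ι ι (subpolyRing hs) := Matrix.of fun i j => ⟨N i j, hN i j⟩
  have key : M'.det - N'.det ∈ negligibleIdeal hs := by
    rw [← Ideal.Quotient.eq, RingHom.map_det, RingHom.map_det]
    congr 1
    ext i j
    exact Ideal.Quotient.eq.2 (h i j)
  let ψ : ∀ n, subpolyRing hs →+* ℝ := fun n => (Pi.evalRingHom (fun _ => ℝ) n).comp (subpolyRing hs).subtype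
  have e : ∀ (P : Matrix ι ι (subpolyRing hs)) n, P.det.1 n = (Matrix.of fun i j => (P i j).1 n).det :=
    fun P n => RingHom.map_det (ψ n) P
  refine Negligible.of_le (y := (M'.det - N'.det).1) key (Eventually.of_forall fun n => ?_)
  change _ ≤ ‖M'.det.1 n - N'.det.1 n‖
  rw [e, e]
  rfl

section Representatives

variable (k : Subfield (Germ (ℓ : Filter ℕ) ℝ))

/-- A sequence representing a given element of a field of germs. -/
noncomputable def rep (a : k) : ℕ → ℝ := Quotient.out a.1

variable {k}

theorem rep_germ (a : k) : (rep k a : Germ (ℓ : Filter ℕ) ℝ) = a := Quotient.out_eq' a.1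

theorem rep_eq {a : k} {f : ℕ → ℝ} (h : (f : Germ (ℓ : Filter ℕ) ℝ) = a) :
    ∀ᶠ n in (ℓ : Filter ℕ), rep k a n = f n :=
  Germ.coe_eq.1 ((rep_germ a).trans h.symm)

theorem rep_mul (a b : k) : ∀ᶠ n in (ℓ : Filter ℕ), rep k (a * b) n = rep k a n * rep k b n :=
  rep_eq (f := rep k a * rep k b) (by rw [Germ.coe_mul, rep_germ, rep_germ]; rfl)

theorem rep_sum {ι : Type*} (s : Finset ι) (a : ι → k) :
    ∀ᶠ n in (ℓ : Filter ℕ), rep k (∑ i ∈ s, a i) n = ∑ i ∈ s, rep k (a i) n := by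
  have := rep_eq (a := ∑ i ∈ s, a i) (f := ∑ i ∈ s, rep k (a i)) (by
    have := map_sum (Germ.coeRingHom (ℓ : Filter ℕ)) (fun i => rep k (a i)) s
    refine this.trans ?_
    rw [AddSubmonoidClass.coe_finsetSum]
    exact Finset.sum_congr rfl fun i _ => rep_germ _)
  simpa using this

theorem rep_det {ι : Type*} [Fintype ι] [DecidableEq ι] (M : Matrix ι ι k) :
    ∀ᶠ n in (ℓ : Filter ℕ), rep k M.det n = (Matrix.of fun i j => rep k (M i j) n).det := by
  let M' : Matrix ι ι (ℕ → ℝ) := Matrix.of fun i j => rep k (M i j)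
  have h1 : (Germ.coeRingHom (ℓ : Filter ℕ)) M'.det = (M.det : k) := by
    rw [RingHom.map_det]
    refine Eq.trans ?_ (RingHom.map_det k.subtype M).symm
    congr 1
    ext i j
    exact rep_germ _
  filter_upwards [rep_eq h1] with n hn
  rw [hn]
  exact RingHom.map_det (Pi.evalRingHom (fun _ => ℝ) n) M'

theorem rep_substantial (hs : IsScale ℓ δ)
    (hk : ∀ f : ℕ → ℝ, (f : Germ (ℓ : Filter ℕ) ℝ) ∈ k → Subpoly ℓ δ f) {a : k} (ha : a ≠ 0) :
    ¬ Negligible ℓ δ (rep k a) := by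
  intro h
  have h1 : Negligible ℓ δ (fun _ => (1 : ℝ)) := by
    refine Negligible.of_mul_le hs (hk (rep k a⁻¹) (by rw [rep_germ]; exact a⁻¹.2)) h ?_
    filter_upwards [rep_mul a⁻¹ a, rep_eq (a := a⁻¹ * a) (f := fun _ => 1) (by
      rw [inv_mul_cancel₀ ha]; rfl)] with n h1 h2
    rw [← norm_mul, ← h1, h2]
  refine Substantial.not_negligible hs (fun η hη => ?_) h1
  filter_upwards [hs.le_one] with n hn
  simpa using Real.rpow_le_one (hs.pos n).le hn hη.le

end Representatives

variable {V : Type*} [NormedAddCommGroup V] [NormedSpace ℝ V] {d : ℕ} (b : Module.Basis (Fin d) ℝ V)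
  (k : Subfield (Germ (ℓ : Filter ℕ) ℝ))

/-- The sequence of vectors whose coordinates represent given germs. -/
noncomputable def realize (s : Fin d → k) (n : ℕ) : V := ∑ i, rep k (s i) n • b i

theorem realize_sum_smul {ι : Type*} [Fintype ι] (β : ι → k) (w : ι → Fin d → k) :
    ∀ᶠ n in (ℓ : Filter ℕ), realize b k (∑ j, β j • w j) n = ∑ j, rep k (β j) n • realize b k (w j) n := by
  have h1 := eventually_all.2 fun i => rep_sum (ℓ := ℓ) Finset.univ fun j => β j * w j i
  have h2 := eventually_all.2 fun i => eventually_all.2 fun j => rep_mul (ℓ := ℓ) (β j) (w j i)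
  filter_upwards [h1, h2] with n h1 h2
  simp only [realize, Finset.sum_apply, Pi.smul_apply, smul_eq_mul, h1, h2, Finset.sum_smul,
    Finset.smul_sum, smul_smul]
  exact Finset.sum_comm

theorem realize_subpoly (hs : IsScale ℓ δ)
    (hk : ∀ f : ℕ → ℝ, (f : Germ (ℓ : Filter ℕ) ℝ) ∈ k → Subpoly ℓ δ f) (s : Fin d → k) :
    Subpoly ℓ δ (realize b k s) :=
  Subpoly.sum hs Finset.univ fun i _ => Subpoly.smul hs (hk _ (by rw [rep_germ]; exact (s i).2))
    (Subpoly.const hs (b i))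

/-- The extension of a bilinear map to vectors with coordinates in a field of germs. -/
noncomputable def extendBilin (B : V →L[ℝ] V →L[ℝ] V)
    (hc : ∀ c : ℝ, ((fun _ => c : ℕ → ℝ) : Germ (ℓ : Filter ℕ) ℝ) ∈ k) :
    (Fin d → k) →ₗ[k] (Fin d → k) →ₗ[k] (Fin d → k) :=
  LinearMap.mk₂ k (fun s t => ∑ p : Fin d × Fin d, (s p.1 * t p.2) •
      fun l => (⟨_, hc (b.repr (B (b p.1) (b p.2)) l)⟩ : k))
    (by intros; simp only [Pi.add_apply, add_mul, add_smul, Finset.sum_add_distrib])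
    (by intros; simp only [Pi.smul_apply, smul_eq_mul, Finset.smul_sum, smul_smul, mul_assoc])
    (by intros; simp only [Pi.add_apply, mul_add, add_smul, Finset.sum_add_distrib])
    (by intros; simp only [Pi.smul_apply, smul_eq_mul, Finset.smul_sum, smul_smul, mul_left_comm])

theorem realize_extendBilin (B : V →L[ℝ] V →L[ℝ] V)
    (hc : ∀ c : ℝ, ((fun _ => c : ℕ → ℝ) : Germ (ℓ : Filter ℕ) ℝ) ∈ k) (s t : Fin d → k) :
    ∀ᶠ n in (ℓ : Filter ℕ), realize b k (extendBilin b k B hc s t) n =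
      B (realize b k s n) (realize b k t n) := by
  have h1 := realize_sum_smul b k (fun p : Fin d × Fin d => s p.1 * t p.2)
    (fun p l => (⟨_, hc (b.repr (B (b p.1) (b p.2)) l)⟩ : k))
  have h2 := eventually_all.2 fun p : Fin d × Fin d => rep_mul (ℓ := ℓ) (s p.1) (t p.2)
  have h3 := eventually_all.2 fun p : Fin d × Fin d => eventually_all.2 fun l => rep_eq (ℓ := ℓ)
    (a := (⟨_, hc (b.repr (B (b p.1) (b p.2)) l)⟩ : k)) rfl
  filter_upwards [h1, h2, h3] with n h1 h2 h3
  refine h1.trans ?_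
  have e : ∀ p : Fin d × Fin d, realize b k
      (fun l => (⟨_, hc (b.repr (B (b p.1) (b p.2)) l)⟩ : k)) n = B (b p.1) (b p.2) := by
    intro p
    simp only [realize, h3]
    exact b.sum_repr _
  simp only [e, h2]
  simp only [realize, map_sum, map_smul, _root_.sum_apply, _root_.smul_apply, Finset.smul_sum, smul_smul]
  rw [Fintype.sum_prod_type, Finset.sum_comm]
  refine Finset.sum_congr rfl fun i _ => Finset.sum_congr rfl fun j _ => ?_
  rw [mul_comm]

end Lift

section LiftGood

open Filter

variable {ℓ : Ultrafilter ℕ} {δ : ℕ → ℝ}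

theorem Negligible.sum (hs : IsScale ℓ δ) {E ι : Type*} [SeminormedAddCommGroup E] (s : Finset ι)
    {x : ι → ℕ → E} (h : ∀ i ∈ s, Negligible ℓ δ (x i)) :
    Negligible ℓ δ (fun n => ∑ i ∈ s, x i n) := by
  classical
  induction s using Finset.induction_on with
  | empty => simpa using negligible_zero hs
  | insert a s ha ih =>
    simp only [Finset.sum_insert ha]
    exact (h a (by simp)).add hs (ih fun i hi => h i (by simp [hi]))

variable {V : Type*} [NormedAddCommGroup V] [NormedSpace ℝ V] [FiniteDimensional ℝ V] {d : ℕ}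
  (b : Module.Basis (Fin d) ℝ V) (k : Subfield (Germ (ℓ : Filter ℕ) ℝ))

theorem subpoly_coord (hs : IsScale ℓ δ) {x : ℕ → V} (hx : Subpoly ℓ δ x) (i : Fin d) :
    Subpoly ℓ δ (fun n => b.repr (x n) i) :=
  Subpoly.clm_apply (𝕜 := ℝ) hs (Subpoly.const hs (LinearMap.toContinuousLinearMap (b.coord i))) hx

theorem negligible_coord (hs : IsScale ℓ δ) {x : ℕ → V} (hx : Negligible ℓ δ x) (i : Fin d) :
    Negligible ℓ δ (fun n => b.repr (x n) i) :=
  Negligible.of_mul_le hs (Subpoly.const hs (LinearMap.toContinuousLinearMap (b.coord i))) hx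
    (Eventually.of_forall fun n =>
      (LinearMap.toContinuousLinearMap (b.coord i)).le_opNorm (x n))

theorem repr_realize (s : Fin d → k) (n : ℕ) (i : Fin d) :
    b.repr (realize b k s n) i = rep k (s i) n := by
  simp [realize, Finsupp.single_apply]

theorem exists_realize (hs : IsScale ℓ δ)
    (hk : ∀ f : ℕ → ℝ, Subpoly ℓ δ f → ∃ g : ℕ → ℝ, (g : Germ (ℓ : Filter ℕ) ℝ) ∈ k ∧
        Negligible ℓ δ (fun n => g n - f n)) {x : ℕ → V} (hx : Subpoly ℓ δ x) :
    ∃ s : Fin d → k, Negligible ℓ δ (fun n => x n - realize b k s n) := by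
  choose g hg hgx using fun i => hk _ (subpoly_coord b hs hx i)
  let s : Fin d → k := fun i => ⟨_, hg i⟩
  refine ⟨s, ?_⟩
  have h1 : Negligible ℓ δ (fun n => ∑ i, (g i n - b.repr (x n) i) • b i) :=
    Negligible.sum hs _ fun i _ => Negligible.of_mul_le hs (Subpoly.const hs (b i)) (hgx i)
      (Eventually.of_forall fun n => by rw [norm_smul, mul_comm])
  refine h1.of_le ?_
  filter_upwards [eventually_all.2 fun i => rep_eq (ℓ := ℓ) (a := s i) rfl] with n hn
  have e : x n - realize b k s n = -∑ i, (g i n - b.repr (x n) i) • b i := by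
    simp only [sub_smul, Finset.sum_sub_distrib, realize, hn, b.sum_repr]
    abel
  rw [e, norm_neg]

theorem negligible_bilin_sub (hs : IsScale ℓ δ) (B : V →L[ℝ] V →L[ℝ] V) {x y u v : ℕ → V}
    (hy : Subpoly ℓ δ y) (hu : Subpoly ℓ δ u) (hxu : Negligible ℓ δ (fun n => x n - u n))
    (hyv : Negligible ℓ δ (fun n => y n - v n)) :
    Negligible ℓ δ (fun n => B (x n) (y n) - B (u n) (v n)) := by
  have h1 : Negligible ℓ δ (fun n => B (x n - u n) (y n)) :=
    Negligible.of_mul_le hs (Subpoly.mul hs (Subpoly.const hs ‖B‖) hy.norm) hxu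
      (Eventually.of_forall fun n => by
        refine (B.le_opNorm₂ _ _).trans (le_of_eq ?_)
        change _ = ‖(‖B‖ * ‖y n‖ : ℝ)‖ * ‖x n - u n‖
        rw [Real.norm_of_nonneg (by positivity)]; ring)
  have h2 : Negligible ℓ δ (fun n => B (u n) (y n - v n)) :=
    Negligible.of_mul_le hs (Subpoly.mul hs (Subpoly.const hs ‖B‖) hu.norm) hyv
      (Eventually.of_forall fun n => by
        refine (B.le_opNorm₂ _ _).trans (le_of_eq ?_)
        change _ = ‖(‖B‖ * ‖u n‖ : ℝ)‖ * ‖y n - v n‖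
        rw [Real.norm_of_nonneg (by positivity)])
  refine (h1.add hs h2).of_le (Eventually.of_forall fun n => le_of_eq ?_)
  simp only [map_sub, _root_.sub_apply]
  congr 1
  abel

theorem mem_closed_of_span {B : V →L[ℝ] V →L[ℝ] V} {ι : Type*} {w : ι → V}
    (h : ∀ i j, B (w i) (w j) ∈ Submodule.span ℝ (Set.range w)) :
    ∀ v ∈ Submodule.span ℝ (Set.range w), ∀ v' ∈ Submodule.span ℝ (Set.range w),
      B v v' ∈ Submodule.span ℝ (Set.range w) := by
  intro v hv v' hv'
  induction hv using Submodule.span_induction with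
  | zero => simp
  | add x y _ _ hx hy => rw [map_add]; exact add_mem hx hy
  | smul c x _ hx => rw [map_smul]; exact Submodule.smul_mem _ _ hx
  | mem x hx =>
    obtain ⟨i, rfl⟩ := hx
    induction hv' using Submodule.span_induction with
    | zero => simp
    | add x y _ _ hx hy => rw [map_add]; exact add_mem hx hy
    | smul c x _ hx => rw [map_smul]; exact Submodule.smul_mem _ _ hx
    | mem x hx => obtain ⟨j, rfl⟩ := hx; exact h i j

theorem span_realize_eq_top (hs : IsScale ℓ δ)
    (hc : ∀ c : ℝ, ((fun _ => c : ℕ → ℝ) : Germ (ℓ : Filter ℕ) ℝ) ∈ k)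
    (hk : ∀ f : ℕ → ℝ, Subpoly ℓ δ f → ∃ g : ℕ → ℝ, (g : Germ (ℓ : Filter ℕ) ℝ) ∈ k ∧
        Negligible ℓ δ (fun n => g n - f n))
    (hk' : ∀ f : ℕ → ℝ, (f : Germ (ℓ : Filter ℕ) ℝ) ∈ k → Subpoly ℓ δ f)
    (B : V →L[ℝ] V →L[ℝ] V) {G : Set (ℕ → V)} (hG : ∀ x ∈ G, Subpoly ℓ δ x)
    (hGB : ∀ x ∈ G, ∀ y ∈ G, (fun n => B (x n) (y n)) ∈ G) {A : ℕ → Set V}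
    (hA : ∀ n, (A n).Nonempty) (hAG : ∀ a : ℕ → V, (∀ n, a n ∈ A n) → a ∈ G) {θ : ℕ → ℝ}
    (hθ : Substantial ℓ δ θ)
    (hfar : ∀ n, ∀ W : Submodule ℝ V, W ≠ ⊤ → (∀ v ∈ W, ∀ w ∈ W, B v w ∈ W) →
      ∃ a ∈ A n, ∀ w ∈ W, |θ n| ≤ ‖a - w‖) :
    Submodule.span k {s : Fin d → k | ∃ x ∈ G, Negligible ℓ δ (fun n => x n - realize b k s n)} = ⊤ := by
  set P := {s : Fin d → k | ∃ x ∈ G, Negligible ℓ δ (fun n => x n - realize b k s n)} with hP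
  set W := Submodule.span k P with hW
  by_contra htop
  have hbr : ∀ s ∈ W, ∀ t ∈ W, extendBilin b k B hc s t ∈ W := by
    intro s hs' t ht
    have := Submodule.apply_mem_map₂ (extendBilin b k B hc) hs' ht
    rw [hW, Submodule.map₂_span_span] at this
    refine Submodule.span_mono ?_ this
    rintro _ ⟨s, ⟨x, hx, hxs⟩, t, ⟨y, hy, hyt⟩, rfl⟩
    refine ⟨_, hGB x hx y hy, ?_⟩
    have h1 := negligible_bilin_sub hs B (hG y hy) (realize_subpoly b k hs hk' s) hxs hyt
    refine h1.of_le ?_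
    filter_upwards [realize_extendBilin b k B hc s t] with n hn
    rw [hn]
  let w := Module.finBasis k W
  let r := Module.finrank k W
  have hr : r < d := by
    have := Submodule.finrank_lt htop
    simpa using this
  have hexp : ∀ s ∈ W, ∃ β : Fin r → k, s = ∑ j, β j • (w j : Fin d → k) := by
    intro s hs'
    refine ⟨fun j => w.repr ⟨s, hs'⟩ j, ?_⟩
    have := congrArg Subtype.val (w.sum_repr ⟨s, hs'⟩)
    rw [AddSubmonoidClass.coe_finsetSum] at this
    exact this.symm
  let S : ℕ → Submodule ℝ V := fun n => Submodule.span ℝ (Set.range fun j => realize b k (w j) n)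
  have hmemS : ∀ s ∈ W, ∀ᶠ n in (ℓ : Filter ℕ), realize b k s n ∈ S n := by
    intro s hs'
    obtain ⟨β, rfl⟩ := hexp s hs'
    filter_upwards [realize_sum_smul b k β fun j => (w j : Fin d → k)] with n hn
    rw [hn]
    exact Submodule.sum_mem _ fun j _ => Submodule.smul_mem _ _ (Submodule.subset_span ⟨j, rfl⟩)
  have hclosed : ∀ᶠ n in (ℓ : Filter ℕ), ∀ v ∈ S n, ∀ v' ∈ S n, B v v' ∈ S n := by
    have h1 := eventually_all.2 fun i => eventually_all.2 fun j =>
      hmemS _ (hbr (w i) (w i).2 (w j) (w j).2)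
    have h2 := eventually_all.2 fun i => eventually_all.2 fun j =>
      realize_extendBilin b k B hc (w i) (w j)
    filter_upwards [h1, h2] with n h1 h2
    exact mem_closed_of_span fun i j => by rw [← h2 i j]; exact h1 i j
  have hStop : ∀ n, S n ≠ ⊤ := by
    intro n h
    have h1 := finrank_range_le_card (R := ℝ) fun j => realize b k (w j : Fin d → k) n
    rw [Set.finrank] at h1
    change Module.finrank ℝ (S n) ≤ _ at h1
    rw [h, finrank_top, Module.finrank_eq_card_basis b, Fintype.card_fin, Fintype.card_fin] at h1
    omega
  have hsel : ∀ n, ∃ a ∈ A n, (∀ v ∈ S n, ∀ v' ∈ S n, B v v' ∈ S n) →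
      ∀ w ∈ S n, |θ n| ≤ ‖a - w‖ := by
    intro n
    by_cases hn : ∀ v ∈ S n, ∀ v' ∈ S n, B v v' ∈ S n
    · obtain ⟨a, ha, h⟩ := hfar n (S n) (hStop n) hn
      exact ⟨a, ha, fun _ => h⟩
    · obtain ⟨a, ha⟩ := hA n
      exact ⟨a, ha, fun h => absurd h hn⟩
  choose a haA ha using hsel
  obtain ⟨s, hsa⟩ := exists_realize b k hs hk (hG a (hAG a haA))
  have hsW : s ∈ W := Submodule.subset_span ⟨a, hAG a haA, hsa⟩
  refine hθ.not_negligible hs (hsa.of_le ?_)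
  filter_upwards [hclosed, hmemS s hsW] with n h1 h2
  exact ha n h1 _ h2

theorem exists_good_substantial_det (hs : IsScale ℓ δ)
    (B : V →L[ℝ] V →L[ℝ] V) {G : Set (ℕ → V)} (hG : ∀ x ∈ G, Subpoly ℓ δ x)
    (hGB : ∀ x ∈ G, ∀ y ∈ G, (fun n => B (x n) (y n)) ∈ G) {A : ℕ → Set V}
    (hA : ∀ n, (A n).Nonempty) (hAG : ∀ a : ℕ → V, (∀ n, a n ∈ A n) → a ∈ G) {θ : ℕ → ℝ}
    (hθ : Substantial ℓ δ θ)
    (hfar : ∀ n, ∀ W : Submodule ℝ V, W ≠ ⊤ → (∀ v ∈ W, ∀ w ∈ W, B v w ∈ W) →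
      ∃ a ∈ A n, ∀ w ∈ W, |θ n| ≤ ‖a - w‖) :
    ∃ y : Fin d → ℕ → V, (∀ i, y i ∈ G) ∧ Substantial ℓ δ (fun n => b.det fun i => y i n) := by
  obtain ⟨k, hc, hk', hk⟩ := exists_germ_coefficient_field hs
  have htop := span_realize_eq_top b k hs hc hk hk' B hG hGB hA hAG hθ hfar
  obtain ⟨T, hTP, hTspan, hTli⟩ := exists_linearIndependent k
    {s : Fin d → k | ∃ x ∈ G, Negligible ℓ δ (fun n => x n - realize b k s n)}
  rw [htop] at hTspan
  let bT : Module.Basis T k (Fin d → k) := Module.Basis.mk hTli (by simp [hTspan])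
  let e : T ≃ Fin d := bT.indexEquiv (Pi.basisFun k (Fin d))
  let s : Fin d → Fin d → k := fun i => (e.symm i : Fin d → k)
  choose y hyG hy using fun i => hTP (e.symm i).2
  refine ⟨y, hyG, substantial_of_not_negligible fun hneg => ?_⟩
  have hdet : (Matrix.of fun i j => s j i).det ≠ 0 := by
    have h1 : LinearIndependent k s := hTli.comp _ e.symm.injective
    have h2 := Matrix.linearIndependent_rows_iff_isUnit.1 (show LinearIndependent k (Matrix.of s).row from h1)
    rw [Matrix.isUnit_iff_isUnit_det] at h2
    have h3 : (Matrix.of fun i j => s j i) = (Matrix.of s).transpose := rfl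
    rw [h3, Matrix.det_transpose]
    exact h2.ne_zero
  have hdiff := negligible_det_sub hs (M := fun i j => rep k (s j i))
    (N := fun i j n => b.repr (y j n) i)
    (fun i j => hk' _ (by rw [rep_germ]; exact (s j i).2)) (fun i j => subpoly_coord b hs (hG _ (hyG j)) i)
    (fun i j => by
      refine (negligible_coord b hs (hy j) i).of_le (Eventually.of_forall fun n => ?_)
      rw [map_sub, Finsupp.sub_apply, repr_realize, norm_sub_rev])
  refine rep_substantial hs hk' hdet ((hdiff.add hs hneg).of_le ?_)
  filter_upwards [rep_det (ℓ := ℓ) (Matrix.of fun i j => s j i)] with n hn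
  rw [hn]
  refine le_of_eq (congrArg _ ?_)
  have : b.det (fun i => y i n) = (Matrix.of fun i j => b.repr (y j n) i).det := by
    rw [Module.Basis.det_apply]; rfl
  rw [this, sub_add_cancel]
  rfl

end LiftGood

section GoodBasis

open Filter

variable {ℓ : Ultrafilter ℕ} {δ : ℕ → ℝ}

theorem exists_dual_of_substantial_det (hs : IsScale ℓ δ) {𝕜 : Type*} [RCLike 𝕜] {V : Type*}
    [NormedAddCommGroup V] [NormedSpace 𝕜 V] [FiniteDimensional 𝕜 V] {ι : Type*} [Fintype ι]
    [DecidableEq ι] (b : Module.Basis ι 𝕜 V) {y : ι → ℕ → V} (hy : ∀ i, Subpoly ℓ δ (y i))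
    (hdet : Substantial ℓ δ (fun n => b.det fun i => y i n)) :
    ∃ (x : ι → ℕ → V) (l : ι → ℕ → V →L[𝕜] 𝕜), (∀ i, ∀ᶠ n in (ℓ : Filter ℕ), x i n = y i n) ∧
      (∀ i, Subpoly ℓ δ (l i)) ∧ (∀ i j n, l i n (x j n) = if i = j then 1 else 0) ∧
      ∀ n v, ∑ i, l i n v • x i n = v := by
  classical
  let x : ι → ℕ → V := fun i n => if b.det (fun i => y i n) = 0 then b i else y i n
  have hxy : ∀ᶠ n in (ℓ : Filter ℕ), ∀ i, x i n = y i n := by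
    filter_upwards [hdet.ne_zero hs] with n hn i
    simp [x, hn]
  have hx : ∀ i, Subpoly ℓ δ (x i) := fun i =>
    (hy i).of_le (hxy.mono fun n hn => by rw [hn])
  have hx0 : ∀ n, b.det (fun i => x i n) ≠ 0 := by
    intro n
    by_cases h : b.det (fun i => y i n) = 0
    · have : (fun i => x i n) = b := by ext i; simp [x, h]
      rw [this, b.det_self]
      exact one_ne_zero
    · have : (fun i => x i n) = fun i => y i n := by ext i; simp [x, h]
      rwa [this]
  have hbas : ∀ n, ∃ B : Module.Basis ι 𝕜 V, ∀ i, B i = x i n := by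
    intro n
    obtain ⟨h1, h2⟩ := (Module.Basis.is_basis_iff_det b).2 (isUnit_iff_ne_zero.2 (hx0 n))
    exact ⟨Module.Basis.mk h1 h2.ge, fun i => by simp⟩
  choose B hB using hbas
  let l : ι → ℕ → V →L[𝕜] 𝕜 := fun i n => LinearMap.toContinuousLinearMap ((B n).coord i)
  have hl : ∀ i n v, l i n v = (B n).repr v i := fun i n v => rfl
  have hsum : ∀ n v, ∑ i, l i n v • x i n = v := fun n v => by
    simp only [hl, ← hB]; exact (B n).sum_repr v
  let lb : ι → V →L[𝕜] 𝕜 := fun i => LinearMap.toContinuousLinearMap (b.coord i)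
  have hlb : ∀ i v, lb i v = b.repr v i := fun i v => rfl
  let r : ℕ → V →L[𝕜] V := fun n => ∑ i, (lb i).smulRight (x i n)
  have hr : Subpoly ℓ δ r := Subpoly.sum hs _ fun i _ =>
    Subpoly.of_mul_le hs (Subpoly.const hs (lb i)) (hx i)
      (Eventually.of_forall fun n => (ContinuousLinearMap.norm_smulRight_apply _ _).le)
  have hrapp : ∀ n v, r n v = ∑ i, b.repr v i • x i n := fun n v => by
    simp [r, _root_.sum_apply, hlb]
  have hrb : ∀ n i, r n (b i) = x i n := fun n i => by
    simp [hrapp, Finsupp.single_apply]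
  have hrdet : ∀ n, LinearMap.det (r n : V →ₗ[𝕜] V) = b.det fun i => x i n := by
    intro n
    have := b.det_comp (r n : V →ₗ[𝕜] V) b
    rw [b.det_self, mul_one] at this
    rw [← this]
    congr 1
    ext i
    exact hrb n i
  obtain ⟨K, hK, hKr⟩ := exists_inverse_bound hs hr (by
    intro η hη
    filter_upwards [hdet η hη, hxy] with n h1 h2
    rw [hrdet]
    simpa only [h2] using h1)
  refine ⟨x, l, fun i => hxy.mono fun n hn => hn i, fun i => ?_, fun i j n => ?_, hsum⟩
  · refine Subpoly.of_mul_le hs (Subpoly.const hs (lb i)) hK ?_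
    filter_upwards [hKr] with n hn
    refine ContinuousLinearMap.opNorm_le_bound _ (by positivity) fun v => ?_
    have e1 : r n (∑ j, l j n v • b j) = v := by
      rw [map_sum]
      simp only [map_smul, hrb, hsum]
    have e2 : lb i (∑ j, l j n v • b j) = l i n v := by
      simp [hlb, Finsupp.single_apply]
    have h3 := hn (∑ j, l j n v • b j)
    rw [e1] at h3
    calc ‖l i n v‖ = ‖lb i (∑ j, l j n v • b j)‖ := by rw [e2]
      _ ≤ ‖lb i‖ * ‖∑ j, l j n v • b j‖ := (lb i).le_opNorm _
      _ ≤ ‖lb i‖ * (‖K n‖ * ‖v‖) := by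
        gcongr
        exact h3.trans (by gcongr; exact Real.le_norm_self _)
      _ = _ := by ring
  · rw [hl, ← hB n j, Module.Basis.repr_self, Finsupp.single_apply]
    simp only [eq_comm]

variable {𝕜 : Type*} [RCLike 𝕜]
variable {V : Type*} [NormedAddCommGroup V] [NormedSpace ℝ V] [FiniteDimensional ℝ V]
  [NormedSpace 𝕜 V] [FiniteDimensional 𝕜 V] {H : ℕ → Set V}
variable {ad : V →L[𝕜] V →L[𝕜] V} {hs : IsScale ℓ δ} {hH : Tame ℓ δ H}

theorem GoodSeq.congr {x y : ℕ → V} (hx : GoodSeq ad hs hH x)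
    (h : ∀ᶠ n in (ℓ : Filter ℕ), y n = x n) : GoodSeq ad hs hH y := by
  refine ⟨hx.1.of_le (h.mono fun n hn => by rw [hn]), ?_⟩
  have := mem_goodRing.1 hx.2
  refine mem_goodRing.2 ⟨this.1.of_le (h.mono fun n hn => by rw [hn]),
    this.2.mono (h.mono fun n hn => by rw [hn]) (Eventually.of_forall fun n => subset_rfl)⟩

theorem exists_good_dual_basis [IsScalarTower ℝ 𝕜 V] {d N : ℕ} (b : Module.Basis (Fin d) ℝ V)
    (bK : Module.Basis (Fin N) 𝕜 V) {y : Fin d → ℕ → V} (hy : ∀ i, GoodSeq ad hs hH (y i))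
    (hdet : Substantial ℓ δ (fun n => b.det fun i => y i n)) :
    (∀ v : V, (fun _ => v) ∈ hull 𝕜 ℓ δ {w | GoodSeq ad hs hH w}) ∧
    ∃ (x : Fin N → ℕ → V) (l : Fin N → ℕ → V →L[𝕜] 𝕜), (∀ i, GoodSeq ad hs hH (x i)) ∧
      (∀ i, Subpoly ℓ δ (l i)) ∧ (∀ i j n, l i n (x j n) = if i = j then 1 else 0) ∧
      ∀ n v, ∑ i, l i n v • x i n = v := by
  obtain ⟨x, l, hxy, hl, -, hsum⟩ := exists_dual_of_substantial_det hs b (fun i => (hy i).1) hdet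
  have hx : ∀ i, GoodSeq ad hs hH (x i) := fun i => (hy i).congr (hxy i)
  have hlv : ∀ i v, Subpoly ℓ δ (fun n => l i n v) := fun i v =>
    Subpoly.clm_apply hs (hl i) (Subpoly.const hs v)
  refine ⟨fun v => ?_, ?_⟩
  · have h1 := sum_mem (S := hull 𝕜 ℓ δ {w | GoodSeq ad hs hH w}) (t := Finset.univ)
      (f := fun i n => ((l i n v : ℝ) : 𝕜) • x i n)
      fun i _ => smul_mem_hull (hlv i v) (hx i)
    convert h1 using 1
    ext n
    rw [Finset.sum_apply]
    simp only [← RCLike.real_smul_eq_coe_smul, hsum]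
  · have hone : ∀ n, (1 : 𝕜) = ∑ f : Fin N → Fin d,
        (∏ j, ((l (f j) n (bK j) : ℝ) : 𝕜)) • bK.det fun j => x (f j) n := by
      intro n
      have h1 : (bK : Fin N → V) = fun j => ∑ i, ((l i n (bK j) : ℝ) : 𝕜) • x i n := by
        ext j
        simp only [← RCLike.real_smul_eq_coe_smul, hsum]
      have h2 := bK.det.toMultilinearMap.map_sum (fun j i => ((l i n (bK j) : ℝ) : 𝕜) • x i n)
      rw [← h1] at h2
      refine bK.det_self.symm.trans (h2.trans (Finset.sum_congr rfl fun f _ => ?_))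
      exact bK.det.toMultilinearMap.map_smul_univ _ _
    have hsub : Substantial ℓ δ (fun n => ∑ f : Fin N → Fin d,
        ‖(∏ j, ((l (f j) n (bK j) : ℝ) : 𝕜)) • bK.det fun j => x (f j) n‖) := by
      intro η hη
      filter_upwards [hs.le_one] with n hn
      have h1 := norm_sum_le Finset.univ fun f : Fin N → Fin d =>
        (∏ j, ((l (f j) n (bK j) : ℝ) : 𝕜)) • bK.det fun j => x (f j) n
      rw [← hone n, norm_one] at h1
      exact (Real.rpow_le_one (hs.pos n).le hn hη.le).trans (h1.trans (Real.le_norm_self _))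
    obtain ⟨f, -, hf⟩ := hsub.exists_of_sum hs
    have hprod : ∀ s : Finset (Fin N), Subpoly ℓ δ (fun n => ∏ j ∈ s, l (f j) n (bK j)) := by
      intro s
      induction s using Finset.induction_on with
      | empty => simpa using Subpoly.const hs (1 : ℝ)
      | insert a s ha ih =>
        simp only [Finset.prod_insert ha]
        exact (hlv _ _).mul hs ih
    have hdetK : Substantial ℓ δ (fun n => bK.det fun j => x (f j) n) := by
      refine hf.of_le_mul hs (hprod Finset.univ) (Eventually.of_forall fun n => ?_)
      rw [norm_smul, ← RCLike.ofReal_prod, RCLike.norm_ofReal, Real.norm_eq_abs]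
    obtain ⟨x', l', hxx, h1, h2, h3⟩ := exists_dual_of_substantial_det hs bK (fun j => (hx (f j)).1) hdetK
    exact ⟨x', l', fun i => (hx (f i)).congr (hxx i), h1, h2, h3⟩

theorem exists_functionals_operators [IsScalarTower ℝ 𝕜 V] [Nontrivial V] {d : ℕ}
    (b : Module.Basis (Fin d) ℝ V) {y : Fin d → ℕ → V} (hy : ∀ i, GoodSeq ad hs hH (y i))
    (hdet : Substantial ℓ δ (fun n => b.det fun i => y i n)) (hinj : ∀ v, ad v = 0 → v = 0)
    (hgen : ∀ S : Set (V →L[𝕜] V), 1 ∈ S → (∀ v, ad v ∈ S) → (∀ a ∈ S, ∀ b ∈ S, a + b ∈ S) →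
      (∀ a ∈ S, ∀ b ∈ S, a * b ∈ S) → (∀ c : ℝ, ∀ a ∈ S, (c : 𝕜) • a ∈ S) → S = Set.univ)
    (hHG : ∀ w : ℕ → V, (∀ n, w n ∈ H n + H n) → GoodSeq ad hs hH w) :
    ∃ (N : ℕ) (J : Type) (_ : Fintype J) (l : Fin N → ℕ → V →L[𝕜] 𝕜) (r : J → ℕ → V →L[𝕜] V),
      ∀ η : ℝ, 0 < η → ∀ᶠ n in (ℓ : Filter ℕ),
        Functionals 𝕜 (δ n) (δ n ^ (-η)) (H n) (fun i => l i n) ∧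
        Operators (δ n) (δ n ^ (-η)) (H n) (fun j => r j n) := by
  obtain ⟨hconst, x, l, hx, hl, hlx, hsum⟩ := exists_good_dual_basis b (Module.finBasis 𝕜 V) hy hdet
  have hR : ∀ Φ : ℕ → V →L[𝕜] V, Subpoly ℓ δ Φ →
      Φ ∈ hull 𝕜 ℓ δ (goodRing 𝕜 hs hH : Set (ℕ → V →L[𝕜] V)) :=
    fun Φ hΦ => subpoly_mem_hull_goodRing hgen hconst hΦ
  obtain ⟨J, hJ, r, hr⟩ := exists_operators hR
  have : Nonempty (Fin (Module.finrank 𝕜 V)) := ⟨⟨0, Module.finrank_pos⟩⟩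
  refine ⟨_, J, hJ, l, r, fun η hη => ?_⟩
  exact (eventually_functionals (fun i => (hx i).1) hl hsum (fun i w hw =>
    dual_smul_one_mem_goodRing hinj hR hx hl hlx hsum i (hHG w hw)) hη).and (hr η hη)

end GoodBasis

section Rounding

variable (V : Type*) [NormedAddCommGroup V] [NormedSpace ℝ V] [FiniteDimensional ℝ V]

/-- At every scale, a finite-dimensional space is well approximated by a lattice with few points
in balls of comparable radius. -/
theorem exists_rounding : ∃ (d : ℕ) (C : ℝ) (D : ℕ), 1 ≤ C ∧ ∀ δ : ℝ, 0 < δ →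
    ∃ (ψ : (Fin d → ℤ) →+ V) (φ : V → Fin d → ℤ), (∀ v, ‖v - ψ (φ v)‖ ≤ C * δ) ∧
      ∀ q, ∀ T : Finset (Fin d → ℤ), (∀ p ∈ T, ‖ψ p - ψ q‖ ≤ 2 * (1 + 2 * C) * δ) → T.card ≤ D := by
  let b := Module.finBasis ℝ V
  set C : ℝ := 1 + ∑ i, ‖b i‖ with hC
  have hC1 : 1 ≤ C := by
    have : 0 ≤ ∑ i, ‖b i‖ := Finset.sum_nonneg fun _ _ => norm_nonneg _
    linarith
  let lb : Fin (Module.finrank ℝ V) → V →L[ℝ] ℝ := fun i => LinearMap.toContinuousLinearMap (b.coord i)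
  set R : ℤ := ⌈(∑ i, ‖lb i‖) * (2 * (1 + 2 * C))⌉ with hR
  refine ⟨Module.finrank ℝ V, C, ((2 * R + 1).toNat) ^ Module.finrank ℝ V, hC1, fun δ hδ => ?_⟩
  let ψ : (Fin (Module.finrank ℝ V) → ℤ) →+ V :=
    { toFun := fun p => ∑ i, (δ * (p i : ℝ)) • b i
      map_zero' := by simp
      map_add' := fun p q => by
        simp only [Pi.add_apply, Int.cast_add, mul_add, add_smul, Finset.sum_add_distrib] }
  have hψ : ∀ p, ψ p = ∑ i, (δ * (p i : ℝ)) • b i := fun p => rfl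
  refine ⟨ψ, fun v i => ⌊b.repr v i / δ⌋, fun v => ?_, fun q T hT => ?_⟩
  · have e : v - ψ (fun i => ⌊b.repr v i / δ⌋) = ∑ i, (δ * Int.fract (b.repr v i / δ)) • b i := by
      rw [hψ, sub_eq_iff_eq_add, ← Finset.sum_add_distrib]
      conv_lhs => rw [← b.sum_repr v]
      refine Finset.sum_congr rfl fun i _ => ?_
      rw [← add_smul, ← mul_add, add_comm, Int.floor_add_fract, mul_div_cancel₀ _ hδ.ne']
    rw [e]
    refine (norm_sum_le _ _).trans ?_
    have : ∀ i ∈ Finset.univ, ‖(δ * Int.fract (b.repr v i / δ)) • b i‖ ≤ ‖b i‖ * δ := fun i _ => by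
      rw [norm_smul, Real.norm_of_nonneg (mul_nonneg hδ.le (Int.fract_nonneg _)), mul_comm]
      gcongr
      exact mul_le_of_le_one_right hδ.le (Int.fract_lt_one _).le
    refine (Finset.sum_le_sum this).trans ?_
    rw [← Finset.sum_mul]
    gcongr
    linarith
  · have hsub : T ⊆ Finset.Icc (fun i => q i - R) (fun i => q i + R) := by
      intro p hp
      have h1 : ∀ i, |p i - q i| ≤ R := fun i => by
        have e : lb i (ψ p - ψ q) = δ * ((p i : ℝ) - q i) := by
          change b.repr _ i = _
          rw [hψ, hψ]
          simp [Finsupp.single_apply, mul_sub]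
        have h2 := (lb i).le_opNorm (ψ p - ψ q)
        rw [e, norm_mul, Real.norm_of_nonneg hδ.le] at h2
        have h3 : ‖lb i‖ ≤ ∑ j, ‖lb j‖ :=
          Finset.single_le_sum (f := fun j => ‖lb j‖) (fun j _ => norm_nonneg _) (Finset.mem_univ i)
        have h4 : δ * ‖(p i : ℝ) - q i‖ ≤ δ * ((∑ i, ‖lb i‖) * (2 * (1 + 2 * C))) := by
          refine h2.trans ?_
          calc _ ≤ (∑ j, ‖lb j‖) * (2 * (1 + 2 * C) * δ) :=
                mul_le_mul h3 (hT p hp) (norm_nonneg _) (Finset.sum_nonneg fun _ _ => norm_nonneg _)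
            _ = _ := by ring
        have h5 := (le_of_mul_le_mul_left h4 hδ).trans (Int.le_ceil _)
        rw [Real.norm_eq_abs, ← hR] at h5
        exact_mod_cast h5
      refine Finset.mem_Icc.2 ⟨fun i => ?_, fun i => ?_⟩
      · have := (abs_le.1 (h1 i)).1; simp only; linarith
      · have := (abs_le.1 (h1 i)).2; simp only; linarith
    refine (Finset.card_le_card hsub).trans (le_of_eq ?_)
    rw [Pi.card_Icc]
    have : ∀ i ∈ Finset.univ, (Finset.Icc (q i - R) (q i + R)).card = (2 * R + 1).toNat := fun i _ => by
      rw [Int.card_Icc]; congr 1; ring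
    rw [Finset.prod_congr rfl this, Finset.prod_const, Finset.card_univ, Fintype.card_fin]

variable {V}

theorem card_le_mul_cn {d D : ℕ} {C δ : ℝ} (hδ : 0 < δ) {ψ : (Fin d → ℤ) →+ V}
    (hD : ∀ q, ∀ T : Finset (Fin d → ℤ), (∀ p ∈ T, ‖ψ p - ψ q‖ ≤ 2 * (1 + 2 * C) * δ) → T.card ≤ D)
    {S : Set V} (hS : TB S) (T : Finset (Fin d → ℤ)) (hT : ∀ p ∈ T, ∃ s ∈ S, ‖ψ p - s‖ ≤ 2 * C * δ) :
    T.card ≤ D * cn δ S := by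
  classical
  obtain ⟨F, hF, hnet⟩ := hS.exists_net hδ
  have h1 : ∀ p ∈ T, ∃ x ∈ F, ‖ψ p - x‖ ≤ (1 + 2 * C) * δ := fun p hp => by
    obtain ⟨s, hs, hps⟩ := hT p hp
    obtain ⟨x, hx, hxs⟩ := hnet s hs
    refine ⟨x, hx, ?_⟩
    calc ‖ψ p - x‖ = ‖(ψ p - s) + (s - x)‖ := by congr 1; abel
      _ ≤ _ := norm_add_le _ _
      _ ≤ _ := by linarith
  choose! f hf hfx using h1
  rw [← hF]
  refine Finset.card_le_mul_card_image_of_maps_to hf D fun x hx => ?_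
  rcases (T.filter (fun p => f p = x)).eq_empty_or_nonempty with he | ⟨q, hq⟩
  · simp [he]
  · refine hD q _ fun p hp => ?_
    rw [Finset.mem_filter] at hp hq
    have h2 := hfx p hp.1
    have h3 := hfx q hq.1
    rw [hp.2] at h2
    rw [hq.2] at h3
    calc ‖ψ p - ψ q‖ = ‖(ψ p - x) - (ψ q - x)‖ := by congr 1; abel
      _ ≤ _ := norm_sub_le _ _
      _ ≤ _ := by linarith

variable (V) in
/-- A discretized Plünnecke inequality. -/
theorem exists_pluennecke : ∃ C : ℝ, 1 ≤ C ∧ ∀ δ : ℝ, 0 < δ → ∀ S : Set V, TB S → S.Nonempty →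
    ∀ K : ℝ, (cn δ (S + S) : ℝ) ≤ K * cn δ S →
      (cn δ (((S - S) + (S - S)) + S) : ℝ) ≤ C * K ^ 5 * cn δ S := by
  classical
  obtain ⟨d, C, D, hC, hround⟩ := exists_rounding V
  set g := growth V
  have hC2 : 1 ≤ (2 * C) ^ g := one_le_pow₀ (by linarith)
  have hD1 : (1 : ℝ) ≤ D + 1 := by linarith [(Nat.cast_nonneg D : (0 : ℝ) ≤ D)]
  have hC5 : 1 ≤ (2 * (5 * C)) ^ g := one_le_pow₀ (by linarith)
  refine ⟨(2 * (5 * C)) ^ g * ((D + 1) * (2 * C) ^ g) ^ 5 * (D + 1), ?_, fun δ hδ S hS hne K hK => ?_⟩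
  · exact one_le_mul_of_one_le_of_one_le
      (one_le_mul_of_one_le_of_one_le hC5 (one_le_pow₀ (one_le_mul_of_one_le_of_one_le hD1 hC2))) hD1
  obtain ⟨ψ, φ, hφ, hD⟩ := hround δ hδ
  have hCδ : δ ≤ C * δ := le_mul_of_one_le_left hδ.le hC
  have hfin : (φ '' S).Finite := by
    by_contra hinf
    obtain ⟨T, hT, hcard⟩ := Set.Infinite.exists_subset_card_eq hinf (D * cn δ S + 1)
    have := card_le_mul_cn hδ hD hS T fun p hp => by
      obtain ⟨s, hs, rfl⟩ := hT hp
      exact ⟨s, hs, by rw [norm_sub_rev]; linarith [hφ s]⟩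
    omega
  set T := hfin.toFinset with hT
  have hmem : ∀ s ∈ S, φ s ∈ T := fun s hs => by simpa [hT] using ⟨s, hs, rfl⟩
  have hTmem : ∀ p ∈ T, ∃ s ∈ S, φ s = p := fun p hp => by simpa [hT] using hp
  have hTne : T.Nonempty := by
    obtain ⟨s, hs⟩ := hne
    exact ⟨_, hmem s hs⟩
  have h1 : T.card ≤ D * cn δ S := card_le_mul_cn hδ hD hS T fun p hp => by
    obtain ⟨s, hs, rfl⟩ := hTmem p hp
    exact ⟨s, hs, by rw [norm_sub_rev]; linarith [hφ s]⟩
  have h2 : (T + T).card ≤ D * cn δ (S + S) := card_le_mul_cn hδ hD (hS.add hS) _ fun p hp => by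
    obtain ⟨p', hp', q, hq, rfl⟩ := Finset.mem_add.1 hp
    obtain ⟨s, hs, rfl⟩ := hTmem p' hp'
    obtain ⟨t, ht, rfl⟩ := hTmem q hq
    refine ⟨s + t, Set.add_mem_add hs ht, ?_⟩
    rw [map_add]
    calc ‖ψ (φ s) + ψ (φ t) - (s + t)‖ = ‖(s - ψ (φ s)) + (t - ψ (φ t))‖ := by
          rw [← norm_neg]; congr 1; abel
      _ ≤ _ := norm_add_le _ _
      _ ≤ _ := by linarith [hφ s, hφ t]
  have h3 : (cn δ S : ℝ) ≤ T.card * (2 * C) ^ g := by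
    refine (cn_refine hδ hC hS).trans ?_
    gcongr
    have : IsNet (C * δ) S (T.image ψ) := fun s hs =>
      ⟨ψ (φ s), Finset.mem_image_of_mem _ (hmem s hs), hφ s⟩
    exact (cn_le this).trans Finset.card_image_le
  have h4 : (cn δ (((S - S) + (S - S)) + S) : ℝ) ≤ (3 • T - 2 • T).card * (2 * (5 * C)) ^ g := by
    refine (cn_refine (R := 5 * C) hδ (by linarith) (((hS.sub hS).add (hS.sub hS)).add hS)).trans ?_
    gcongr
    have : IsNet (5 * C * δ) (((S - S) + (S - S)) + S) ((3 • T - 2 • T).image ψ) := by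
      rintro _ ⟨_, ⟨_, ⟨a, ha, b, hb, rfl⟩, _, ⟨a', ha', b', hb', rfl⟩, rfl⟩, c, hc, rfl⟩
      refine ⟨ψ ((φ a + φ a' + φ c) - (φ b + φ b')), Finset.mem_image_of_mem _ ?_, ?_⟩
      · refine Finset.sub_mem_sub ?_ ?_
        · rw [show (3 : ℕ) • T = T + T + T by rw [succ_nsmul, two_nsmul]]
          exact Finset.add_mem_add (Finset.add_mem_add (hmem a ha) (hmem a' ha')) (hmem c hc)
        · rw [two_nsmul]
          exact Finset.add_mem_add (hmem b hb) (hmem b' hb')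
      · simp only [map_sub, map_add]
        calc _ = ‖((a - ψ (φ a)) + (a' - ψ (φ a')) + (c - ψ (φ c))) -
              ((b - ψ (φ b)) + (b' - ψ (φ b')))‖ := by congr 1; abel
          _ ≤ (‖a - ψ (φ a)‖ + ‖a' - ψ (φ a')‖ + ‖c - ψ (φ c)‖) +
              (‖b - ψ (φ b)‖ + ‖b' - ψ (φ b')‖) :=
            (norm_sub_le _ _).trans (add_le_add (norm_add₃_le) (norm_add_le _ _))
          _ ≤ _ := by linarith [hφ a, hφ a', hφ b, hφ b', hφ c]
    exact (cn_le this).trans Finset.card_image_le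
  have h5 : ((3 • T - 2 • T).card : ℝ) ≤ ((T + T).card / T.card) ^ 5 * T.card := by
    have := Finset.pluennecke_ruzsa_inequality_nsmul_sub_nsmul_add hTne T 3 2
    have h := (NNRat.cast_le (K := ℝ)).2 this
    push_cast at h
    exact h
  have hTpos : (0 : ℝ) < T.card := by exact_mod_cast hTne.card_pos
  have hcn : (0 : ℝ) < cn δ S := by linarith [cn_pos' hδ hS hne]
  have hK0 : 0 ≤ K := by
    by_contra h
    have : K * cn δ S < 0 := mul_neg_of_neg_of_pos (not_le.1 h) hcn
    linarith [(Nat.cast_nonneg (cn δ (S + S)) : (0 : ℝ) ≤ _)]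
  have h6 : ((T + T).card : ℝ) / T.card ≤ (D + 1) * (2 * C) ^ g * K := by
    rw [div_le_iff₀ hTpos]
    calc ((T + T).card : ℝ) ≤ D * cn δ (S + S) := by exact_mod_cast h2
      _ ≤ (D + 1) * (K * (T.card * (2 * C) ^ g)) := by
        gcongr
        · linarith
        · exact hK.trans (by gcongr)
      _ = _ := by ring
  calc _ ≤ ((3 • T - 2 • T).card : ℝ) * (2 * (5 * C)) ^ g := h4
    _ ≤ (((D + 1) * (2 * C) ^ g * K) ^ 5 * ((D + 1) * cn δ S)) * (2 * (5 * C)) ^ g := by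
      gcongr
      refine h5.trans ?_
      gcongr
      calc (T.card : ℝ) ≤ D * cn δ S := by exact_mod_cast h1
        _ ≤ _ := by gcongr; linarith
    _ = _ := by ring

end Rounding

section DifferenceSets

open Filter

variable {ℓ : Ultrafilter ℕ} {δ : ℕ → ℝ}
variable {V : Type*} [NormedAddCommGroup V] [NormedSpace ℝ V] [FiniteDimensional ℝ V]
variable {A : ℕ → Set V}

/-- Sets of small doubling have small triple differences. -/
theorem exists_subpoly_cn_triple (hs : IsScale ℓ δ) (htb : ∀ n, TB (A n)) (hne : ∀ n, (A n).Nonempty)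
    (hadd : ∀ η : ℝ, 0 < η → ∀ᶠ n in (ℓ : Filter ℕ),
      (cn (δ n) (A n + A n) : ℝ) ≤ δ n ^ (-η) * cn (δ n) (A n)) :
    ∃ K : ℕ → ℝ, Subpoly ℓ δ K ∧ (∀ n, 0 ≤ K n) ∧
      ∀ n, (cn (δ n) (((A n - A n) + (A n - A n)) + A n) : ℝ) ≤ K n * cn (δ n) (A n) := by
  obtain ⟨C, hC, hP⟩ := exists_pluennecke V
  have hpos : ∀ n, (1 : ℝ) ≤ cn (δ n) (A n) := fun n => cn_pos' (hs.pos n) (htb n) (hne n)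
  have hK : Subpoly ℓ δ (fun n => (cn (δ n) (A n + A n) : ℝ) / cn (δ n) (A n)) := fun η hη => by
    filter_upwards [hadd η hη] with n h1
    rw [Real.norm_of_nonneg (by positivity)]
    exact (div_le_iff₀ (by linarith [hpos n])).2 h1
  refine ⟨fun n => C * ((cn (δ n) (A n + A n) : ℝ) / cn (δ n) (A n)) ^ 5,
    (Subpoly.const hs C).mul hs (hK.pow hs 5), fun n => by positivity, fun n => ?_⟩
  exact hP _ (hs.pos n) _ (htb n) (hne n) _ (by
    rw [div_mul_cancel₀ _ (by linarith [hpos n])])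

theorem tame_sub (hs : IsScale ℓ δ) {R : ℕ → ℝ} (hR : Subpoly ℓ δ R) (hAR : ∀ n, ∀ a ∈ A n, ‖a‖ ≤ R n)
    (hne : ∀ n, (A n).Nonempty)
    (hadd : ∀ η : ℝ, 0 < η → ∀ᶠ n in (ℓ : Filter ℕ),
      (cn (δ n) (A n + A n) : ℝ) ≤ δ n ^ (-η) * cn (δ n) (A n)) :
    Tame ℓ δ (fun n => A n - A n) := by
  have htb : ∀ n, TB (A n) := fun n => tb_of_bounded (hAR n)
  obtain ⟨K, hK, hK0, h⟩ := exists_subpoly_cn_triple hs htb hne hadd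
  refine ⟨fun n => ?_, ?_, ⟨fun n => R n + R n, hR.add hs hR, ?_⟩, ?_⟩
  · obtain ⟨a, ha⟩ := hne n
    exact ⟨a, ha, a, ha, sub_self a⟩
  · rintro n _ ⟨a, ha, b, hb, rfl⟩
    exact ⟨b, hb, a, ha, (neg_sub a b).symm⟩
  · rintro n _ ⟨a, ha, b, hb, rfl⟩
    exact (norm_sub_le _ _).trans (add_le_add (hAR n a ha) (hAR n b hb))
  · refine SetLe.of_cov_mul hs hK (Subpoly.const hs (2 : ℝ)) (Eventually.of_forall fun n => ?_)
    have hpos := cn_pos' (hs.pos n) (htb n) (hne n)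
    have hH := (htb n).sub (htb n)
    refine (ruzsa_cov (hs.pos n) ((hH.add hH).add (htb n)) (htb n) (hne n)).mono le_rfl ?_
      subset_rfl subset_rfl
    exact (div_le_iff₀ (by linarith)).2 (h n)

theorem cn_sub_le (hs : IsScale ℓ δ) (htb : ∀ n, TB (A n)) (hne : ∀ n, (A n).Nonempty)
    (hadd : ∀ η : ℝ, 0 < η → ∀ᶠ n in (ℓ : Filter ℕ),
      (cn (δ n) (A n + A n) : ℝ) ≤ δ n ^ (-η) * cn (δ n) (A n)) {η : ℝ} (hη : 0 < η) :
    ∀ᶠ n in (ℓ : Filter ℕ), (cn (δ n) (A n - A n) : ℝ) ≤ δ n ^ (-η) * cn (δ n) (A n) := by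
  obtain ⟨K, hK, hK0, h⟩ := exists_subpoly_cn_triple hs htb hne hadd
  have hK4 := hK.mul hs (Subpoly.const hs ((2 * 2 : ℝ) ^ growth V))
  filter_upwards [hK4 η hη] with n h1
  have hδ := hs.pos n
  have hH := (htb n).sub (htb n)
  obtain ⟨a, ha⟩ := hne n
  have h2 : Cov (δ n) 1 (A n - A n) (((A n - A n) + (A n - A n)) + A n) :=
    ⟨{-a}, by simp, fun x hx => ⟨-a, by simp, x + (a - a) + a,
      Set.add_mem_add (Set.add_mem_add hx (Set.sub_mem_sub ha ha)) ha, by simpa using hδ.le⟩⟩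
  have h3 := h2.cn_le hδ ((hH.add hH).add (htb n))
  rw [one_mul, ← two_mul] at h3
  calc (cn (δ n) (A n - A n) : ℝ) ≤ cn (2 * δ n) (A n - A n) * (2 * 2) ^ growth V :=
        cn_refine hδ one_le_two hH
    _ ≤ (K n * cn (δ n) (A n)) * (2 * 2) ^ growth V := by gcongr; exact h3.trans (h n)
    _ = (K n * (2 * 2) ^ growth V) * cn (δ n) (A n) := by ring
    _ ≤ _ := by gcongr; exact (Real.le_norm_self _).trans h1

variable {𝕜 : Type*} [RCLike 𝕜] [NormedSpace 𝕜 V] {ad : V →L[𝕜] V →L[𝕜] V}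

theorem goodSeq_of_mem {hs : IsScale ℓ δ} {hH : Tame ℓ δ (fun n => A n - A n)}
    {R : ℕ → ℝ} (hR : Subpoly ℓ δ R) (hAR : ∀ n, ∀ a ∈ A n, ‖a‖ ≤ R n)
    (hne : ∀ n, (A n).Nonempty)
    (hbr : ∀ η : ℝ, 0 < η → ∀ᶠ n in (ℓ : Filter ℕ),
      (cn (δ n) (A n + Set.image2 (fun a b => ad a b) (A n) (A n)) : ℝ) ≤
        δ n ^ (-η) * cn (δ n) (A n)) {a : ℕ → V} (ha : ∀ n, a n ∈ A n) :
    GoodSeq ad hs hH a := by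
  have htb : ∀ n, TB (A n) := fun n => tb_of_bounded (hAR n)
  have haS : Subpoly ℓ δ a := hR.of_le (Eventually.of_forall fun n =>
    (hAR n _ (ha n)).trans (Real.le_norm_self _))
  have hadS : Subpoly ℓ δ (fun n => ad (a n)) := (Subpoly.const hs ad).clm_apply hs haS
  refine ⟨haS, mem_goodRing.2 ⟨hadS, ?_⟩⟩
  have hbd : ∀ n, ∀ s ∈ Set.image2 (fun a b => ad a b) (A n) (A n), ‖s‖ ≤ ‖ad‖ * R n * R n := by
    rintro n _ ⟨x, hx, y, hy, rfl⟩
    refine (ContinuousLinearMap.le_opNorm₂ ad x y).trans ?_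
    have h0 := (norm_nonneg _).trans (hAR n x hx)
    gcongr
    · exact hAR n x hx
    · exact hAR n y hy
  have himg : ∀ n, (fun v => ad (a n) v) '' A n ⊆ Set.image2 (fun a b => ad a b) (A n) (A n) := by
    rintro n _ ⟨x, hx, rfl⟩
    exact ⟨a n, ha n, x, hx, rfl⟩
  have hcov : SetLe ℓ δ (fun n => (fun v => ad (a n) v) '' A n) (fun n => A n - A n) := by
    refine SetLe.of_cov_mul hs (K := fun n =>
      (cn (δ n) (A n + Set.image2 (fun a b => ad a b) (A n) (A n)) : ℝ) / cn (δ n) (A n))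
      (fun η hη => ?_) (Subpoly.const hs (2 : ℝ)) (Eventually.of_forall fun n => ?_)
    · filter_upwards [hbr η hη] with n h1
      rw [Real.norm_of_nonneg (by positivity)]
      exact (div_le_iff₀ (by linarith [cn_pos' (hs.pos n) (htb n) (hne n)])).2 h1
    · have hB := tb_of_bounded (hbd n)
      refine (ruzsa_cov (hs.pos n) ((hB.mono (himg n)).add (htb n)) (htb n) (hne n)).mono le_rfl ?_
        subset_rfl subset_rfl
      gcongr
      refine cn_mono (hs.pos n) ((htb n).add hB) ?_ le_rfl
      rw [add_comm]
      exact Set.add_subset_add_left (himg n)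
  have hneg : SetLe ℓ δ (fun n => -((fun v => ad (a n) v) '' A n)) (fun n => A n - A n) := by
    intro η hη
    filter_upwards [hcov η hη] with n h1
    simpa using h1.neg
  refine ((hcov.add hs hneg).trans hs hH.dbl).mono (Eventually.of_forall fun n => ?_)
    (Eventually.of_forall fun n => subset_rfl)
  rintro _ ⟨_, ⟨x, hx, y, hy, rfl⟩, rfl⟩
  exact ⟨_, ⟨x, hx, rfl⟩, -ad (a n) y, by simpa using ⟨y, hy, rfl⟩, by simp [sub_eq_add_neg]⟩

end DifferenceSets

section GrowthContradiction

open Filter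

variable {ℓ : Ultrafilter ℕ} {δ : ℕ → ℝ}
variable {V : Type*} [NormedAddCommGroup V]

/-- `H` has lower dimension at least `a` at all scales between `δ` and `1`. -/
def LowerDim (ℓ : Ultrafilter ℕ) (δ : ℕ → ℝ) (H : ℕ → Set V) (a : ℝ) : Prop :=
  ∀ η : ℝ, 0 < η → ∀ᶠ n in (ℓ : Filter ℕ), ∀ ρ, δ n ≤ ρ → ρ ≤ 1 →
    ρ ^ (-a) ≤ δ n ^ (-η) * cn ρ (H n)

theorem LowerDim.le (hs : IsScale ℓ δ) {H : ℕ → Set V} {a σ : ℝ} (ha : LowerDim ℓ δ H a)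
    (hupp : ∀ η : ℝ, 0 < η → ∀ᶠ n in (ℓ : Filter ℕ), (cn (δ n) (H n) : ℝ) ≤ δ n ^ (-σ - η)) :
    a ≤ σ := by
  by_contra! hlt
  obtain ⟨n, h1, h2, h3⟩ := ((ha ((a - σ) / 3) (by linarith)).and
    ((hupp ((a - σ) / 3) (by linarith)).and (hs.lim.eventually_lt_const one_pos))).exists
  have hδ := hs.pos n
  have h4 : δ n ^ (-a) ≤ δ n ^ (-((a - σ) / 3) + (-σ - (a - σ) / 3)) := by
    rw [Real.rpow_add hδ]
    exact (h1 _ le_rfl h3.le).trans (by gcongr)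
  have h5 := (Real.rpow_le_rpow_left_iff_of_base_lt_one hδ h3).1 h4
  linarith

theorem LowerDim.exists_drop (hs : IsScale ℓ δ) {H : ℕ → Set V} {κ σ s : ℝ} (hκ : LowerDim ℓ δ H κ)
    (hupp : ∀ η : ℝ, 0 < η → ∀ᶠ n in (ℓ : Filter ℕ), (cn (δ n) (H n) : ℝ) ≤ δ n ^ (-σ - η))
    (hs0 : 0 < s) : ∃ a, κ ≤ a ∧ LowerDim ℓ δ H a ∧ ¬ LowerDim ℓ δ H (a + s) := by
  by_contra! hcon
  have key : ∀ k : ℕ, LowerDim ℓ δ H (κ + k * s) := fun k => by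
    induction k with
    | zero => simpa using hκ
    | succ k ih =>
      have := hcon _ (by have : 0 ≤ (k : ℝ) * s := by positivity
                         linarith) ih
      rwa [show κ + k * s + s = κ + ((k + 1 : ℕ) : ℝ) * s by push_cast; ring] at this
  obtain ⟨k, hk⟩ := exists_nat_gt ((σ - κ) / s)
  rw [div_lt_iff₀ hs0] at hk
  linarith [(key k).le hs hupp]

theorem exists_scale_of_not_lowerDim (hs : IsScale ℓ δ) {H : ℕ → Set V} (htb : ∀ n, TB (H n))
    (hne : ∀ n, (H n).Nonempty) {a : ℝ} (ha : 0 < a) (h : ¬ LowerDim ℓ δ H a) :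
    ∃ τ : ℝ, 0 < τ ∧ ∀ᶠ n in (ℓ : Filter ℕ), ∃ ρ, δ n ≤ ρ ∧ ρ < 1 ∧ ρ ≤ δ n ^ τ ∧
      ρ ^ a * cn ρ (H n) ≤ 1 := by
  unfold LowerDim at h
  push Not at h
  obtain ⟨η, hη, h⟩ := h
  refine ⟨η / a, by positivity, ?_⟩
  filter_upwards [h, hs.lim.eventually_lt_const one_pos] with n h1 hn
  have hδ := hs.pos n
  obtain ⟨ρ, hρ, hρ1, h2⟩ := h1
  have hρ0 : 0 < ρ := hδ.trans_le hρ
  have h3 : 1 ≤ δ n ^ (-η) := Real.one_le_rpow_of_pos_of_le_one_of_nonpos hδ hn.le (by linarith)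
  have h4 : (1 : ℝ) ≤ cn ρ (H n) := cn_pos' hρ0 (htb n) (hne n)
  have h5 : ρ ≤ δ n ^ (η / a) := by
    have h6 : δ n ^ (-η) ≤ ρ ^ (-a) := (le_mul_of_one_le_right (by positivity) h4).trans h2.le
    rw [Real.rpow_neg hδ.le, Real.rpow_neg hρ0.le,
      inv_le_inv₀ (by positivity) (by positivity)] at h6
    rw [div_eq_mul_inv, Real.rpow_mul hδ.le]
    exact (Real.le_rpow_inv_iff_of_pos hρ0.le (by positivity) ha).2 h6
  refine ⟨ρ, hρ, h5.trans_lt (Real.rpow_lt_one hδ.le hn (by positivity)), h5, ?_⟩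
  calc ρ ^ a * cn ρ (H n) ≤ ρ ^ a * ρ ^ (-a) := by
        gcongr
        exact (le_mul_of_one_le_left (by positivity) h3).trans h2.le
    _ = 1 := by rw [← Real.rpow_add hρ0]; simp

variable {𝕜 : Type*} [RCLike 𝕜] [NormedSpace 𝕜 V] [NormedSpace ℝ V] [FiniteDimensional ℝ V]
  [IsScalarTower ℝ 𝕜 V]

theorem Functionals.mono {ι : Type*} {δ δ' M M' : ℝ} {H : Set V} {l : ι → V →L[𝕜] 𝕜}
    (h : Functionals 𝕜 δ M H l) (hδ : δ ≤ δ') (hM : M ≤ M') : Functionals 𝕜 δ' M' H l where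
  bdd i v := (h.bdd i v).trans (by gcongr)
  nondeg v := (h.nondeg v).imp fun i hi => hi.trans (by gcongr)
  cov i w hw := (h.cov i w hw).mono hδ hM subset_rfl subset_rfl

theorem Operators.mono {J : Type*} [Fintype J] {δ δ' M M' : ℝ} {H : Set V} {r : J → V →L[𝕜] V}
    (h : Operators δ M H r) (hδ : δ ≤ δ') (hM : M ≤ M') : Operators δ' M' H r where
  bdd j := (h.bdd j).trans hM
  cov j := (h.cov j).mono hδ hM subset_rfl subset_rfl
  span G := (h.span G).imp fun γ hγ => ⟨hγ.1, fun j => (hγ.2 j).trans (by gcongr)⟩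

/-- Sets with many good multipliers and operators cannot have intermediate dimension. -/
theorem false_of_functionals_operators (hs : IsScale ℓ δ) {H : ℕ → Set V} (hH : Tame ℓ δ H)
    {ι J : Type*} [Fintype J] {l : ι → ℕ → V →L[𝕜] 𝕜} {r : J → ℕ → V →L[𝕜] V}
    (hlr : ∀ η : ℝ, 0 < η → ∀ᶠ n in (ℓ : Filter ℕ),
        Functionals 𝕜 (δ n) (δ n ^ (-η)) (H n) (fun i => l i n) ∧
        Operators (δ n) (δ n ^ (-η)) (H n) (fun j => r j n)) {κ σ : ℝ} (hκ : 0 < κ)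
    (hσ : σ < Module.finrank ℝ V) (hlow : LowerDim ℓ δ H κ)
    (hupp : ∀ η : ℝ, 0 < η → ∀ᶠ n in (ℓ : Filter ℕ), (cn (δ n) (H n) : ℝ) ≤ δ n ^ (-σ - η)) :
    False := by
  set d := Module.finrank ℝ V with hd
  obtain ⟨m, hm⟩ := exists_nat_ge ((16 + 6 * d + 14 * growth V : ℝ) / κ)
  rw [div_le_iff₀' hκ] at hm
  obtain ⟨m2, hm2⟩ := exists_nat_ge
    (((13 + 6 * d + 12 * growth V) * Fintype.card J + 4 + 2 * growth V : ℝ) / κ)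
  rw [div_le_iff₀' hκ] at hm2
  set Q : ℕ := 2 * m + m2 + 8 with hQ
  set E : ℕ := 2 * ((13 + 6 * d + 12 * growth V) * Fintype.card J + 2 + 2 * growth V)
      + 3 + d * (2 * m + m2 + 16) with hE
  obtain ⟨s, hs0, hsE, hsQ⟩ : ∃ s : ℝ, 0 < s ∧ s * E < d - σ ∧ s * Q ≤ 1 := by
    have hdσ : 0 < d - σ := by linarith
    refine ⟨min ((d - σ) / (E + 1)) (1 / (Q + 1)), lt_min (by positivity) (by positivity), ?_, ?_⟩
    · calc _ ≤ (d - σ) / (E + 1) * E := by gcongr; exact min_le_left _ _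
        _ < (d - σ) / (E + 1) * (E + 1) := by gcongr; linarith
        _ = _ := by field_simp
    · calc _ ≤ 1 / ((Q : ℝ) + 1) * Q := by gcongr; exact min_le_right _ _
        _ ≤ 1 / ((Q : ℝ) + 1) * (Q + 1) := by gcongr; linarith
        _ = _ := by field_simp
  obtain ⟨a, hκa, ha, hdrop⟩ := hlow.exists_drop hs hupp hs0
  have haσ := ha.le hs hupp
  obtain ⟨τ, hτ, hρ⟩ := exists_scale_of_not_lowerDim hs hH.tb (fun n => ⟨0, hH.zero_mem n⟩)
    (by linarith) hdrop
  have hη : 0 < τ * s := by positivity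
  obtain ⟨R, hR, hbd⟩ := hH.bdd
  obtain ⟨n, ⟨ρ, hδρ, hρ1, hρτ, hcn⟩, ⟨hl, hr⟩, h10, h3, hRn, hdbl, hlo⟩ := (hρ.and
    ((hlr _ hη).and ((hs.const_le 10 hη).and ((hs.const_le (3 ^ Fintype.card J) hη).and
    ((hR _ hη).and ((hH.dbl _ hη).and (ha _ hη))))))).exists
  have hδ := hs.pos n
  have hρ0 : 0 < ρ := hδ.trans_le hδρ
  have hM : δ n ^ (-(τ * s)) ≤ ρ ^ (-s) := by
    rw [Real.rpow_neg hδ.le, Real.rpow_neg hρ0.le, Real.rpow_mul hδ.le]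
    gcongr
  have hpow : ∀ k : ℕ, (ρ ^ (-s)) ^ k = ρ ^ (-(s * k)) := fun k => by
    rw [← Real.rpow_natCast, ← Real.rpow_mul hρ0.le]; congr 1; ring
  have hscale : Scale ρ (ρ ^ (-s)) a (H n) :=
    { hδ := hρ0
      hM := h10.trans hM
      hα := by linarith
      zero_mem := hH.zero_mem n
      neg_mem := hH.neg_mem n
      bdd := fun h hh => (hbd n h hh).trans ((Real.le_norm_self _).trans (hRn.trans hM))
      dbl := hdbl.mono hδρ hM subset_rfl subset_rfl
      low := fun ρ' h1 h2 => by
        have hρ' : 0 < ρ' := hρ0.trans_le h1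
        have h3 := hlo ρ' (hδρ.trans h1) h2
        calc (1 : ℝ) = ρ' ^ (-a) * ρ' ^ a := by rw [← Real.rpow_add hρ']; simp
          _ ≤ (ρ ^ (-s) * cn ρ' (H n)) * ρ' ^ a := by
            gcongr
            exact h3.trans (by gcongr)
          _ = _ := by ring
      upp := by
        rw [Real.rpow_add hρ0] at hcn
        rw [Real.rpow_neg hρ0.le]
        calc ρ ^ a * cn ρ (H n) = (ρ ^ s)⁻¹ * (ρ ^ a * ρ ^ s * cn ρ (H n)) := by
              field_simp
          _ ≤ (ρ ^ s)⁻¹ * 1 := by gcongr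
          _ = _ := mul_one _ }
  have := hscale.rpow_le (𝕜 := 𝕜) (by linarith) hκa (hl.mono hδρ hM) (hr.mono hδρ hM)
    (h3.trans hM) (m := m) (m2 := m2) hm hm2 (by
      rw [← hQ, hpow]
      nth_rewrite 2 [← Real.rpow_one ρ]
      rw [← Real.rpow_add hρ0]
      exact Real.rpow_le_one hρ0.le hρ1.le (by linarith))
  rw [← hd, ← hE, hpow, ← Real.rpow_natCast ρ d, ← Real.rpow_add hρ0,
    Real.rpow_le_rpow_left_iff_of_base_lt_one hρ0 hρ1] at this
  linarith

end GrowthContradiction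

section SumBracket

open Filter

variable {ℓ : Ultrafilter ℕ} {δ : ℕ → ℝ}
variable {𝕜 : Type*} [RCLike 𝕜] {V : Type*} [NormedAddCommGroup V] [NormedSpace 𝕜 V]
  [NormedSpace ℝ V] [FiniteDimensional ℝ V] [FiniteDimensional 𝕜 V] [IsScalarTower ℝ 𝕜 V]

/-- No sequence of sets can violate the sum-bracket estimate at subpolynomial cost. -/
theorem false_of_small_sum_bracket [Nontrivial V] (hs : IsScale ℓ δ) {ad : V →L[𝕜] V →L[𝕜] V}
    (hjac : ∀ v w, ad (ad v w) = ad v * ad w - ad w * ad v) (hinj : ∀ v, ad v = 0 → v = 0)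
    (hgen : ∀ S : Set (V →L[𝕜] V), 1 ∈ S → (∀ v, ad v ∈ S) → (∀ a ∈ S, ∀ b ∈ S, a + b ∈ S) →
      (∀ a ∈ S, ∀ b ∈ S, a * b ∈ S) → (∀ c : ℝ, ∀ a ∈ S, (c : 𝕜) • a ∈ S) → S = Set.univ)
    {A : ℕ → Set V} (hne : ∀ n, (A n).Nonempty) {R : ℕ → ℝ} (hR : Subpoly ℓ δ R)
    (hAR : ∀ n, ∀ a ∈ A n, ‖a‖ ≤ R n) {κ σ : ℝ} (hκ : 0 < κ) (hσ : σ < Module.finrank ℝ V)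
    (hlow : LowerDim ℓ δ A κ)
    (hupp : ∀ η : ℝ, 0 < η → ∀ᶠ n in (ℓ : Filter ℕ), (cn (δ n) (A n) : ℝ) ≤ δ n ^ (-σ - η))
    {θ : ℕ → ℝ} (hθ : Substantial ℓ δ θ)
    (hfar : ∀ n, ∀ W : Submodule ℝ V, W ≠ ⊤ → (∀ v ∈ W, ∀ w ∈ W, ad v w ∈ W) →
      ∃ a ∈ A n, ∀ w ∈ W, |θ n| ≤ ‖a - w‖)
    (hadd : ∀ η : ℝ, 0 < η → ∀ᶠ n in (ℓ : Filter ℕ),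
      (cn (δ n) (A n + A n) : ℝ) ≤ δ n ^ (-η) * cn (δ n) (A n))
    (hbr : ∀ η : ℝ, 0 < η → ∀ᶠ n in (ℓ : Filter ℕ),
      (cn (δ n) (A n + Set.image2 (fun a b => ad a b) (A n) (A n)) : ℝ) ≤
        δ n ^ (-η) * cn (δ n) (A n)) : False := by
  have htb : ∀ n, TB (A n) := fun n => tb_of_bounded (hAR n)
  have hH := tame_sub hs hR hAR hne hadd
  have hgood : ∀ a : ℕ → V, (∀ n, a n ∈ A n) → GoodSeq ad hs hH a := fun a ha =>
    goodSeq_of_mem hR hAR hne hbr ha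
  have hgoodH : ∀ w : ℕ → V, (∀ n, w n ∈ A n - A n) → GoodSeq ad hs hH w := fun w hw => by
    choose a ha b hb hab using fun n => Set.mem_sub.1 (hw n)
    exact ((hgood a ha).sub (hgood b hb)).congr (Eventually.of_forall fun n => (hab n).symm)
  have hgoodHH : ∀ w : ℕ → V, (∀ n, w n ∈ (A n - A n) + (A n - A n)) → GoodSeq ad hs hH w :=
    fun w hw => by
      choose a ha b hb hab using fun n => Set.mem_add.1 (hw n)
      exact ((hgoodH a ha).add (hgoodH b hb)).congr (Eventually.of_forall fun n => (hab n).symm)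
  have hbracket : ∀ x y : ℕ → V, GoodSeq ad hs hH x → GoodSeq ad hs hH y →
      GoodSeq ad hs hH (fun n => ad (x n) (y n)) := fun x y hx hy => by
    refine ⟨((Subpoly.const hs ad).clm_apply hs hx.1).clm_apply hs hy.1, ?_⟩
    simp only [hjac]
    exact sub_mem (mul_mem hx.2 hy.2) (mul_mem hy.2 hx.2)
  let B : V →L[ℝ] V →L[ℝ] V :=
    (ContinuousLinearMap.restrictScalarsL 𝕜 V V ℝ ℝ).comp (ad.restrictScalars ℝ)
  obtain ⟨y, hy, hdet⟩ := exists_good_substantial_det (Module.finBasis ℝ V) hs B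
    (G := {x | GoodSeq ad hs hH x}) (fun x hx => hx.1) (fun x hx y hy => hbracket x y hx hy) hne
    hgood hθ hfar
  obtain ⟨N, J, _, l, r, hlr⟩ := exists_functionals_operators (Module.finBasis ℝ V) hy hdet hinj
    hgen hgoodHH
  refine false_of_functionals_operators hs hH hlr hκ hσ (fun η hη => ?_) (fun η hη => ?_)
  · filter_upwards [hlow η hη] with n h1 ρ h2 h3
    have hδ := hs.pos n
    have hρ := hδ.trans_le h2
    obtain ⟨a, ha⟩ := hne n
    have h4 : (cn ρ (A n) : ℝ) ≤ cn ρ (A n - A n) := by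
      have hc : Cov 0 1 (A n) (A n - A n) :=
        ⟨{a}, by simp, fun x hx => ⟨a, by simp, x - a, Set.sub_mem_sub hx ha, by simp⟩⟩
      simpa using hc.cn_le hρ ((htb n).sub (htb n))
    exact (h1 ρ h2 h3).trans (by gcongr)
  · filter_upwards [cn_sub_le hs htb hne hadd (half_pos hη), hupp (η / 2) (half_pos hη)] with n h1 h2
    have hδ := hs.pos n
    calc (cn (δ n) (A n - A n) : ℝ) ≤ δ n ^ (-(η / 2)) * δ n ^ (-σ - η / 2) := h1.trans (by gcongr)
      _ = δ n ^ (-σ - η) := by rw [← Real.rpow_add hδ]; congr 1; ring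

end SumBracket

section Centroid

variable (L : Type*) [LieRing L] [LieAlgebra ℝ L]

/-- The associative algebra generated by the inner derivations. -/
abbrev adAlgebra : Subalgebra ℝ (Module.End ℝ L) :=
  Algebra.adjoin ℝ (Set.range fun x : L => (LieAlgebra.ad ℝ L x : Module.End ℝ L))

variable {L}

theorem ad_mem_adAlgebra (x : L) : (LieAlgebra.ad ℝ L x : Module.End ℝ L) ∈ adAlgebra L :=
  Algebra.subset_adjoin ⟨x, rfl⟩

instance isScalarTower_adAlgebra : IsScalarTower ℝ (adAlgebra L) L := ⟨fun _ _ _ => rfl⟩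

theorem end_adAlgebra_lie (f : Module.End (adAlgebra L) L) (x y : L) : f ⁅x, y⁆ = ⁅x, f y⁆ :=
  f.map_smul (⟨_, ad_mem_adAlgebra x⟩ : adAlgebra L) y

theorem end_adAlgebra_lie_left (f : Module.End (adAlgebra L) L) (x y : L) : f ⁅x, y⁆ = ⁅f x, y⁆ := by
  rw [← lie_skew, map_neg, end_adAlgebra_lie, lie_skew]

variable [LieAlgebra.IsSimple ℝ L]

theorem span_lie_eq_top : Submodule.span ℝ {z : L | ∃ x y : L, ⁅x, y⁆ = z} = ⊤ := by
  have h : LieSubmodule.toSubmodule (⁅(⊤ : LieIdeal ℝ L), (⊤ : LieIdeal ℝ L)⁆ : LieIdeal ℝ L) =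
      Submodule.span ℝ {z : L | ∃ x y : L, ⁅x, y⁆ = z} := by
    rw [LieSubmodule.lieIdeal_oper_eq_linear_span']
    simp
  rw [← h]
  rcases LieAlgebra.IsSimple.eq_bot_or_eq_top (R := ℝ) (⁅(⊤ : LieIdeal ℝ L), (⊤ : LieIdeal ℝ L)⁆) with hb | ht
  · exfalso
    refine LieAlgebra.IsSimple.non_abelian (R := ℝ) (L := L) ⟨fun x y => ?_⟩
    rw [LieSubmodule.lie_eq_bot_iff] at hb
    exact hb x trivial y trivial
  · rw [ht]; rfl

theorem end_adAlgebra_mul_comm (f g : Module.End (adAlgebra L) L) : f * g = g * f := by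
  ext z
  have hz : z ∈ Submodule.span ℝ {z : L | ∃ x y : L, ⁅x, y⁆ = z} := by
    rw [span_lie_eq_top]; trivial
  have hr : ∀ (f : Module.End (adAlgebra L) L) (c : ℝ) (v : L), f (c • v) = c • f v := fun f c v => by
    have := f.map_smul (algebraMap ℝ (adAlgebra L) c) v
    rwa [algebraMap_smul, algebraMap_smul] at this
  induction hz using Submodule.span_induction with
  | mem z hz =>
    obtain ⟨x, y, rfl⟩ := hz
    simp only [Module.End.mul_apply]
    rw [end_adAlgebra_lie g, end_adAlgebra_lie_left f, end_adAlgebra_lie_left f, end_adAlgebra_lie g]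
  | zero => simp
  | add a b _ _ ha hb => rw [map_add, ha, hb, map_add]
  | smul c a _ ha =>
    rw [hr, ha, hr]

instance isSimpleModule_adAlgebra : IsSimpleModule (adAlgebra L) L := by
  rw [isSimpleModule_iff]
  have : Nontrivial L := by
    by_contra h
    rw [not_nontrivial_iff_subsingleton] at h
    exact LieAlgebra.IsSimple.non_abelian (R := ℝ) (L := L) ⟨fun x y => Subsingleton.elim _ _⟩
  refine { exists_pair_ne := ⟨⊥, ⊤, bot_ne_top⟩, eq_bot_or_eq_top := fun N => ?_ }
  let I : LieIdeal ℝ L :=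
    { N.restrictScalars ℝ with
      lie_mem := fun {x m} hm => N.smul_mem (⟨_, ad_mem_adAlgebra x⟩ : adAlgebra L) hm }
  have hI : ∀ v, v ∈ I ↔ v ∈ N := fun v => Iff.rfl
  refine (LieAlgebra.IsSimple.eq_bot_or_eq_top (R := ℝ) I).imp (fun h => ?_) (fun h => ?_)
  · ext v; rw [← hI, h]; simp
  · ext v; rw [← hI, h]; simp

/-- `𝕜` acts on `L` as the full commutant of the inner derivations. -/
def IsCentroid (L : Type*) [LieRing L] [LieAlgebra ℝ L] (𝕜 : Type) [RCLike 𝕜] : Prop :=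
  ∃ φ : 𝕜 →ₐ[ℝ] Module.End ℝ L, (∀ (z : 𝕜) (x y : L), φ z ⁅x, y⁆ = ⁅x, φ z y⁆) ∧
    ∀ f : Module.End ℝ L, (∀ z v, f (φ z v) = φ z (f v)) → f ∈ adAlgebra L

theorem isCentroid_of_algEquiv [FiniteDimensional ℝ L] {𝕜 : Type} [RCLike 𝕜]
    (e : 𝕜 ≃ₐ[ℝ] Module.End (adAlgebra L) L) : IsCentroid L 𝕜 := by
  let ρ : Module.End (adAlgebra L) L →ₐ[ℝ] Module.End ℝ L :=
    { toFun := fun f => f.restrictScalars ℝ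
      map_one' := rfl
      map_mul' := fun _ _ => rfl
      map_zero' := rfl
      map_add' := fun _ _ => rfl
      commutes' := fun _ => rfl }
  refine ⟨ρ.comp e.toAlgHom, fun z x y => end_adAlgebra_lie (e z) x y, fun f hf => ?_⟩
  let F : Module.End (Module.End (adAlgebra L) L) L :=
    { toFun := f
      map_add' := map_add f
      map_smul' := fun g v => by
        obtain ⟨z, rfl⟩ := e.surjective g
        exact hf z v }
  obtain ⟨s, hs⟩ := Module.Finite.fg_top (R := ℝ) (M := L)
  obtain ⟨r, hr⟩ := jacobson_density F s
  have : f = (r : Module.End ℝ L) := LinearMap.ext_on hs fun v hv => hr v hv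
  rw [this]
  exact r.2

variable (L) in
theorem isCentroid_real_or_complex [FiniteDimensional ℝ L] : IsCentroid L ℝ ∨ IsCentroid L ℂ := by
  classical
  let : Field (Module.End (adAlgebra L) L) :=
    { Module.End.instDivisionRing with mul_comm := end_adAlgebra_mul_comm }
  let ρ : Module.End (adAlgebra L) L →ₗ[ℝ] Module.End ℝ L :=
    { toFun := fun f => f.restrictScalars ℝ
      map_add' := fun _ _ => rfl
      map_smul' := fun _ _ => rfl }
  have hfin : Module.Finite ℝ (Module.End (adAlgebra L) L) :=
    Module.Finite.of_injective ρ (LinearMap.restrictScalars_injective ℝ)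
  have : Algebra.IsAlgebraic ℝ (Module.End (adAlgebra L) L) := Algebra.IsAlgebraic.of_finite ℝ _
  exact (Real.nonempty_algEquiv_or (Module.End (adAlgebra L) L)).imp
    (fun ⟨e⟩ => isCentroid_of_algEquiv e.symm) (fun ⟨e⟩ => isCentroid_of_algEquiv e.symm)

end Centroid

section Model

variable {L : Type*} [LieRing L] [LieAlgebra ℝ L]

/-- A coordinate model of `L` over its centroid, in which the inner derivations generate all
endomorphisms. -/
structure CentroidModel (L : Type*) [LieRing L] [LieAlgebra ℝ L] (𝕜 V : Type*) [RCLike 𝕜]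
    [NormedAddCommGroup V] [NormedSpace 𝕜 V] [NormedSpace ℝ V] where
  /-- The coordinates. -/
  e : L ≃ₗ[ℝ] V
  /-- The bracket in coordinates. -/
  ad : V →L[𝕜] V →L[𝕜] V
  ad_apply : ∀ x y, ad (e x) (e y) = e ⁅x, y⁆
  gen : ∀ S : Set (V →L[𝕜] V), 1 ∈ S → (∀ v, ad v ∈ S) → (∀ a ∈ S, ∀ b ∈ S, a + b ∈ S) →
      (∀ a ∈ S, ∀ b ∈ S, a * b ∈ S) → (∀ c : ℝ, ∀ a ∈ S, (c : 𝕜) • a ∈ S) → S = Set.univ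

theorem IsCentroid.exists_model [FiniteDimensional ℝ L] {𝕜 : Type} [RCLike 𝕜]
    (h : IsCentroid L 𝕜) : ∃ n : ℕ, Nonempty (CentroidModel L 𝕜 (Fin n → 𝕜)) := by
  obtain ⟨φ, hφ, hcomm⟩ := h
  let : Module 𝕜 L := Module.compHom L φ.toRingHom
  have hsmul : ∀ (z : 𝕜) (v : L), z • v = φ z v := fun z v => rfl
  have : IsScalarTower ℝ 𝕜 L := ⟨fun c z v => by rw [hsmul, hsmul, map_smul]; rfl⟩
  have : Module.Finite 𝕜 L := Module.Finite.of_restrictScalars_finite ℝ 𝕜 L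
  set n := Module.finrank 𝕜 L
  let b := Module.finBasis 𝕜 L
  let e : L ≃ₗ[𝕜] (Fin n → 𝕜) := b.equivFun
  let e' : L ≃ₗ[ℝ] (Fin n → 𝕜) := e.restrictScalars ℝ
  have hlie : ∀ (z : 𝕜) (x y : L), ⁅x, z • y⁆ = z • ⁅x, y⁆ := fun z x y => (hφ z x y).symm
  have hlie' : ∀ (z : 𝕜) (x y : L), ⁅z • x, y⁆ = z • ⁅x, y⁆ := fun z x y => by
    rw [← lie_skew, hlie, ← smul_neg, lie_skew]
  let β : (Fin n → 𝕜) →ₗ[𝕜] (Fin n → 𝕜) →ₗ[𝕜] (Fin n → 𝕜) :=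
    LinearMap.mk₂ 𝕜 (fun v w => e ⁅e.symm v, e.symm w⁆) (fun a b c => by simp) (fun c a b => by
      simp [hlie']) (fun a b c => by simp) (fun c a b => by simp [hlie])
  let ad : (Fin n → 𝕜) →L[𝕜] (Fin n → 𝕜) →L[𝕜] (Fin n → 𝕜) :=
    LinearMap.toContinuousLinearMap (LinearMap.toContinuousLinearMap.toLinearMap ∘ₗ β)
  have had : ∀ v w, ad v w = e ⁅e.symm v, e.symm w⁆ := fun v w => rfl
  refine ⟨n, ⟨⟨e', ad, fun x y => ?_, fun S h1 hv hadd hmul hsm => ?_⟩⟩⟩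
  · rw [had]; simp [e']
  · refine Set.eq_univ_of_forall fun G => ?_
    have key : ∀ f ∈ adAlgebra L, ∃ a ∈ S, ∀ x, e (f x) = a (e x) := fun f hf => by
      induction hf using Algebra.adjoin_induction with
      | mem f hf =>
        obtain ⟨x, rfl⟩ := hf
        exact ⟨_, hv (e x), fun y => by rw [had]; simp⟩
      | algebraMap c =>
        refine ⟨_, hsm c _ h1, fun y => ?_⟩
        have : (algebraMap ℝ (Module.End ℝ L) c) y = (c : 𝕜) • y := by
          rw [Module.algebraMap_end_apply, ← algebraMap_smul 𝕜 c y]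
        rw [this, map_smul]; rfl
      | add f g _ _ ihf ihg =>
        obtain ⟨a, ha, haf⟩ := ihf
        obtain ⟨b, hb, hbg⟩ := ihg
        exact ⟨_, hadd a ha b hb, fun y => by simp [haf, hbg]⟩
      | mul f g _ _ ihf ihg =>
        obtain ⟨a, ha, haf⟩ := ihf
        obtain ⟨b, hb, hbg⟩ := ihg
        exact ⟨_, hmul a ha b hb, fun y => by
          rw [Module.End.mul_apply, haf, hbg]; rfl⟩
    let f : L →ₗ[𝕜] L := e.symm.toLinearMap ∘ₗ G.toLinearMap ∘ₗ e.toLinearMap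
    obtain ⟨a, ha, haf⟩ := key (f.restrictScalars ℝ) (hcomm _ fun z v => f.map_smul z v)
    have : G = a := by
      refine ContinuousLinearMap.ext fun v => ?_
      have := haf (e.symm v)
      simpa [f] using this
    rwa [this]

variable {𝕜 V : Type*} [RCLike 𝕜] [NormedAddCommGroup V] [NormedSpace 𝕜 V] [NormedSpace ℝ V]

namespace CentroidModel

variable (D : CentroidModel L 𝕜 V)

theorem jacobi (v w : V) : D.ad (D.ad v w) = D.ad v * D.ad w - D.ad w * D.ad v := by
  refine ContinuousLinearMap.ext fun u => ?_
  obtain ⟨x, rfl⟩ := D.e.surjective v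
  obtain ⟨y, rfl⟩ := D.e.surjective w
  obtain ⟨z, rfl⟩ := D.e.surjective u
  rw [_root_.sub_apply, mul_apply_eq_comp, mul_apply_eq_comp]
  simp only [D.ad_apply]
  rw [← map_sub, lie_lie]

theorem eq_zero_of_ad_eq_zero [LieAlgebra.IsSimple ℝ L] (v : V) (h : D.ad v = 0) : v = 0 := by
  obtain ⟨x, rfl⟩ := D.e.surjective v
  have hx : ∀ y : L, ⁅x, y⁆ = 0 := fun y => by
    have := D.ad_apply x y
    rw [h] at this
    exact D.e.map_eq_zero_iff.1 (by rw [← this]; rfl)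
  have : x ∈ LieAlgebra.center ℝ L := fun y => by rw [← lie_skew, hx, neg_zero]
  have hb : LieAlgebra.center ℝ L = ⊥ := by
    rcases LieAlgebra.IsSimple.eq_bot_or_eq_top (R := ℝ) (LieAlgebra.center ℝ L) with hb | ht
    · exact hb
    · exact absurd ((LieAlgebra.isLieAbelian_iff_center_eq_top ℝ L).2 ht)
        (LieAlgebra.IsSimple.non_abelian (R := ℝ))
  rw [hb] at this
  rw [(LieSubmodule.mem_bot x).1 this, map_zero]

end CentroidModel

end Model

section Comparison

theorem exists_seminorm_compare {L : Type*} [AddCommGroup L] [Module ℝ L] [FiniteDimensional ℝ L]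
    (nm : Seminorm ℝ L) (hnm : ∀ x : L, nm x = 0 → x = 0) {V : Type*} [NormedAddCommGroup V]
    [NormedSpace ℝ V] [FiniteDimensional ℝ V] (e : L ≃ₗ[ℝ] V) :
    ∃ C : ℝ, 1 ≤ C ∧ (∀ x, nm x ≤ C * ‖e x‖) ∧ ∀ x, ‖e x‖ ≤ C * nm x := by
  let : Norm L := ⟨nm⟩
  have core : NormedSpace.Core ℝ L :=
    { norm_nonneg := fun x => apply_nonneg nm x
      norm_smul := fun c x => map_smul_eq_mul nm c x
      norm_triangle := fun x y => map_add_le_add nm x y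
      norm_eq_zero_iff := fun x => ⟨hnm x, fun h => by rw [h]; exact map_zero nm⟩ }
  let := NormedAddCommGroup.ofCore core
  let := NormedSpace.ofCore core
  let E : L ≃L[ℝ] V := e.toContinuousLinearEquiv
  set a := ‖(E : L →L[ℝ] V)‖
  set b := ‖(E.symm : V →L[ℝ] L)‖
  have ha : 0 ≤ a := norm_nonneg _
  have hb : 0 ≤ b := norm_nonneg _
  refine ⟨1 + a + b, by linarith, fun x => ?_, fun x => ?_⟩
  · have := (E.symm : V →L[ℝ] L).le_opNorm (e x)
    have h2 : E.symm (e x) = x := E.symm_apply_apply x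
    simp only [ContinuousLinearEquiv.coe_coe, h2] at this
    exact this.trans (by gcongr; linarith)
  · exact ((E : L →L[ℝ] V).le_opNorm x).trans (by
      have : 0 ≤ ‖x‖ := norm_nonneg _
      exact mul_le_mul_of_nonneg_right (by linarith) this)

theorem exists_scov_compare {L : Type*} [AddCommGroup L] [Module ℝ L] [FiniteDimensional ℝ L]
    (nm : Seminorm ℝ L) (hnm : ∀ x : L, nm x = 0 → x = 0) {V : Type*} [NormedAddCommGroup V]
    [NormedSpace ℝ V] [FiniteDimensional ℝ V] (e : L ≃ₗ[ℝ] V) :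
    ∃ C : ℝ, 1 ≤ C ∧ (∀ x, nm x ≤ C * ‖e x‖) ∧ (∀ x, ‖e x‖ ≤ C * nm x) ∧
      ∀ δ > 0, ∀ S : Set L, TB (e '' S) → (cn δ (e '' S) : ℝ) ≤ C * SCov nm δ S ∧
        (SCov nm δ S : ℝ) ≤ C * cn δ (e '' S) := by
  classical
  obtain ⟨C, hC, h1, h2⟩ := exists_seminorm_compare nm hnm e
  have hC' : C ≤ C * (2 * C) ^ growth V :=
    le_mul_of_one_le_right (by linarith) (one_le_pow₀ (by linarith))
  have hC'' : (2 * C) ^ growth V ≤ C * (2 * C) ^ growth V := le_mul_of_one_le_left (by positivity) hC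
  refine ⟨C * (2 * C) ^ growth V, hC.trans hC', fun x => (h1 x).trans (by gcongr), fun x =>
    (h2 x).trans (mul_le_mul_of_nonneg_right hC' (apply_nonneg nm x)), fun δ hδ S hS => ?_⟩
  have hnet : ∀ δ > 0, ∃ F : Finset L, F.card ≤ cn (δ / C) (e '' S) ∧ S ⊆ ⋃ x ∈ F, SBall nm x δ :=
    fun δ hδ => by
      obtain ⟨F, hF, hn⟩ := hS.exists_net (δ := δ / C) (by positivity)
      refine ⟨F.image e.symm, Finset.card_image_le.trans hF.le, fun s hs => ?_⟩
      obtain ⟨x, hx, h⟩ := hn (e s) ⟨s, hs, rfl⟩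
      refine Set.mem_iUnion₂.2 ⟨e.symm x, Finset.mem_image_of_mem _ hx, (h1 _).trans ?_⟩
      rw [map_sub, e.apply_symm_apply]
      calc C * ‖e s - x‖ ≤ C * (δ / C) := by gcongr
        _ = δ := by field_simp
  constructor
  · have hne : {N : ℕ | ∃ F : Finset L, F.card ≤ N ∧ S ⊆ ⋃ x ∈ F, SBall nm x δ}.Nonempty := by
      obtain ⟨F, hF, h⟩ := hnet δ hδ
      exact ⟨_, F, hF, h⟩
    obtain ⟨F, hF, hcov⟩ := Nat.sInf_mem hne
    have hn : IsNet (C * δ) (e '' S) (F.image e) := by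
      rintro _ ⟨s, hs, rfl⟩
      obtain ⟨x, hx, h⟩ := Set.mem_iUnion₂.1 (hcov hs)
      refine ⟨e x, Finset.mem_image_of_mem _ hx, ?_⟩
      rw [← map_sub]
      exact (h2 _).trans (mul_le_mul_of_nonneg_left h (by linarith))
    have h3 : cn (C * δ) (e '' S) ≤ SCov nm δ S := (cn_le hn).trans (Finset.card_image_le.trans hF)
    calc (cn δ (e '' S) : ℝ) ≤ cn (C * δ) (e '' S) * (2 * C) ^ growth V := cn_refine hδ hC hS
      _ ≤ SCov nm δ S * (C * (2 * C) ^ growth V) := by gcongr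
      _ = _ := mul_comm _ _
  · obtain ⟨F, hF, h⟩ := hnet δ hδ
    have h3 : SCov nm δ S ≤ cn (δ / C) (e '' S) := Nat.sInf_le ⟨F, hF, h⟩
    have h4 := cn_refine (δ := δ / C) (by positivity) hC hS
    rw [mul_div_cancel₀ δ (by linarith : C ≠ 0)] at h4
    calc (SCov nm δ S : ℝ) ≤ cn (δ / C) (e '' S) := by exact_mod_cast h3
      _ ≤ cn δ (e '' S) * (2 * C) ^ growth V := h4
      _ ≤ cn δ (e '' S) * (C * (2 * C) ^ growth V) := by gcongr
      _ = _ := mul_comm _ _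

end Comparison

section Assembly

open Filter

variable {L : Type*} [LieRing L] [LieAlgebra ℝ L] [FiniteDimensional ℝ L] [LieAlgebra.IsSimple ℝ L]
  {𝕜 V : Type*} [RCLike 𝕜] [NormedAddCommGroup V] [NormedSpace 𝕜 V] [NormedSpace ℝ V]
  [FiniteDimensional ℝ V] [FiniteDimensional 𝕜 V] [IsScalarTower ℝ 𝕜 V]

theorem CentroidModel.sum_bracket_estimate (D : CentroidModel L 𝕜 V)
    (nm : Seminorm ℝ L) (hnm : ∀ x : L, nm x = 0 → x = 0)
    (κ : ℝ) (hκ : 0 < κ) (σ : ℝ) (hσ : σ < (Module.finrank ℝ L : ℝ)) :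
    ∃ ε : ℝ, 0 < ε ∧ ∃ δ₀ : ℝ, 0 < δ₀ ∧ ∀ δ : ℝ, 0 < δ → δ < δ₀ →
      ∀ A : Set L,
        A ⊆ SBall nm 0 (δ ^ (-ε)) →
        (∀ ρ : ℝ, δ ≤ ρ → δ ^ ε * ρ ^ (-κ) ≤ (SCov nm ρ A : ℝ)) →
        (SCov nm δ A : ℝ) ≤ δ ^ (-(σ + ε)) →
        (∀ W : LieSubalgebra ℝ L, W ≠ ⊤ → ∃ a ∈ A, δ ^ ε ≤ SDist nm a (W : Set L)) →
        δ ^ (-ε) * (SCov nm δ A : ℝ) ≤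
          (SCov nm δ (A + A) : ℝ) +
            (SCov nm δ (A + Set.image2 (fun a b => ⁅a, b⁆) A A) : ℝ) := by
  by_contra hcon
  have hex : ∀ n : ℕ, ∃ δ : ℝ, 0 < δ ∧ δ < 1 / ((n : ℝ) + 1) ∧ ∃ A : Set L,
      A ⊆ SBall nm 0 (δ ^ (-(1 / ((n : ℝ) + 1)))) ∧
      (∀ ρ : ℝ, δ ≤ ρ → δ ^ (1 / ((n : ℝ) + 1)) * ρ ^ (-κ) ≤ (SCov nm ρ A : ℝ)) ∧
      (SCov nm δ A : ℝ) ≤ δ ^ (-(σ + 1 / ((n : ℝ) + 1))) ∧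
      (∀ W : LieSubalgebra ℝ L, W ≠ ⊤ →
        ∃ a ∈ A, δ ^ (1 / ((n : ℝ) + 1)) ≤ SDist nm a (W : Set L)) ∧
      (SCov nm δ (A + A) : ℝ) + (SCov nm δ (A + Set.image2 (fun a b => ⁅a, b⁆) A A) : ℝ) <
        δ ^ (-(1 / ((n : ℝ) + 1))) * (SCov nm δ A : ℝ) := fun n => by
    by_contra h
    refine hcon ⟨1 / ((n : ℝ) + 1), by positivity, 1 / ((n : ℝ) + 1), by positivity,
      fun δ h0 h1 A a1 a2 a3 a4 => ?_⟩
    by_contra h2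
    exact h ⟨δ, h0, h1, A, a1, a2, a3, a4, not_le.1 h2⟩
  choose δ hδ0 hδ1 A hball hlow hupp hfar hlt using hex
  set ε : ℕ → ℝ := fun n => 1 / ((n : ℝ) + 1) with hε
  have hε0 : ∀ n, 0 < ε n := fun n => by positivity
  have hε1 : ∀ n, ε n ≤ 1 := fun n => by
    rw [hε]; exact (div_le_one (by positivity)).2 (by linarith [n.cast_nonneg (α := ℝ)])
  have hδle : ∀ n, δ n ≤ 1 := fun n => (hδ1 n).le.trans (hε1 n)
  let ℓ : Ultrafilter ℕ := hyperfilter ℕ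
  have hεlim : Tendsto ε ℓ (nhds 0) := by
    have h : (ℓ : Filter ℕ) ≤ atTop := Nat.hyperfilter_le_atTop
    exact tendsto_one_div_add_atTop_nhds_zero_nat.mono_left h
  have hs : IsScale ℓ δ := ⟨hδ0, tendsto_of_tendsto_of_tendsto_of_le_of_le tendsto_const_nhds hεlim
    (fun n => (hδ0 n).le) (fun n => (hδ1 n).le)⟩
  obtain ⟨C, hC, h1, h2, hcov⟩ := exists_scov_compare nm hnm D.e
  have hC0 : 0 < C := by linarith
  have hsmall : ∀ η : ℝ, 0 < η → ∀ᶠ n in (ℓ : Filter ℕ), C * C * δ n ^ (-ε n) ≤ δ n ^ (-η) :=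
    fun η hη => by
      filter_upwards [hs.const_le (C * C) (half_pos hη), hεlim.eventually_lt_const (half_pos hη)]
        with n c1 c2
      calc C * C * δ n ^ (-ε n) ≤ δ n ^ (-(η / 2)) * δ n ^ (-(η / 2)) := by
            refine mul_le_mul c1 (Real.rpow_le_rpow_of_exponent_ge (hδ0 n) (hδle n) (by linarith))
              (Real.rpow_nonneg (hδ0 n).le _) (Real.rpow_nonneg (hδ0 n).le _)
        _ = δ n ^ (-η) := by rw [← Real.rpow_add (hδ0 n)]; congr 1; ring
  have hsmall1 : ∀ η : ℝ, 0 < η → ∀ᶠ n in (ℓ : Filter ℕ), C * δ n ^ (-ε n) ≤ δ n ^ (-η) :=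
    fun η hη => by
      filter_upwards [hsmall η hη] with n hn
      refine le_trans ?_ hn
      have : 0 < δ n ^ (-ε n) := Real.rpow_pos_of_pos (hδ0 n) _
      gcongr
      nlinarith
  have hnt : Nontrivial L := by
    by_contra h
    rw [not_nontrivial_iff_subsingleton] at h
    exact LieAlgebra.IsSimple.non_abelian (R := ℝ) (L := L) ⟨fun x y => Subsingleton.elim _ _⟩
  have hntV : Nontrivial V := D.e.symm.toEquiv.nontrivial
  have hne : ∀ n, (A n).Nonempty := fun n => by
    obtain ⟨x, hx⟩ := exists_ne (0 : L)
    obtain ⟨a, ha, -⟩ := hfar n ⊥ fun h =>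
      hx ((LieSubalgebra.mem_bot x).1 (h ▸ LieSubalgebra.mem_top x))
    exact ⟨a, ha⟩
  have hAR : ∀ n, ∀ a ∈ D.e '' A n, ‖a‖ ≤ C * δ n ^ (-ε n) := by
    rintro n _ ⟨a, ha, rfl⟩
    have h3 : nm (a - 0) ≤ δ n ^ (-ε n) := hball n ha
    rw [sub_zero] at h3
    exact (h2 a).trans (by gcongr)
  have hadd_im : ∀ n, D.e '' (A n + A n) = D.e '' A n + D.e '' A n := fun n => Set.image_add D.e
  have hbr_im : ∀ n, D.e '' (A n + Set.image2 (fun a b => ⁅a, b⁆) (A n) (A n)) =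
      D.e '' A n + Set.image2 (fun a b => D.ad a b) (D.e '' A n) (D.e '' A n) := fun n => by
    rw [Set.image_add, Set.image_image2, Set.image2_image_left, Set.image2_image_right]
    simp only [D.ad_apply]
  have htb : ∀ n, TB (D.e '' A n) := fun n => tb_of_bounded (hAR n)
  have htb2 : ∀ n, TB (Set.image2 (fun a b => D.ad a b) (D.e '' A n) (D.e '' A n)) := fun n =>
    tb_of_bounded (R := ‖D.ad‖ * (C * δ n ^ (-ε n)) * (C * δ n ^ (-ε n))) (by
      rintro _ ⟨a, ha, b, hb, rfl⟩
      have h3 := hAR n a ha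
      have h4 := hAR n b hb
      have h5 : 0 ≤ C * δ n ^ (-ε n) := (norm_nonneg a).trans h3
      exact (D.ad.le_opNorm₂ a b).trans (by gcongr))
  have hgrow : ∀ S : ℕ → Set L, (∀ n, TB (D.e '' S n)) →
      (∀ n, (SCov nm (δ n) (S n) : ℝ) ≤ δ n ^ (-ε n) * SCov nm (δ n) (A n)) →
      ∀ η : ℝ, 0 < η → ∀ᶠ n in (ℓ : Filter ℕ),
        (cn (δ n) (D.e '' S n) : ℝ) ≤ δ n ^ (-η) * cn (δ n) (D.e '' A n) := fun S hS hle η hη => by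
    filter_upwards [hsmall η hη] with n hn
    have : 0 < δ n ^ (-ε n) := Real.rpow_pos_of_pos (hδ0 n) _
    calc (cn (δ n) (D.e '' S n) : ℝ) ≤ C * SCov nm (δ n) (S n) := (hcov _ (hδ0 n) _ (hS n)).1
      _ ≤ C * (δ n ^ (-ε n) * SCov nm (δ n) (A n)) := by gcongr; exact hle n
      _ ≤ C * (δ n ^ (-ε n) * (C * cn (δ n) (D.e '' A n))) := by
        gcongr; exact (hcov _ (hδ0 n) _ (htb n)).2
      _ = C * C * δ n ^ (-ε n) * cn (δ n) (D.e '' A n) := by ring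
      _ ≤ _ := by gcongr
  refine false_of_small_sum_bracket (ℓ := ℓ) (A := fun n => D.e '' A n) (κ := κ) (σ := σ)
    (R := fun n => C * δ n ^ (-ε n)) (θ := fun n => δ n ^ ε n / C) hs D.jacobi
    D.eq_zero_of_ad_eq_zero D.gen (fun n => (hne n).image _) (fun η hη => ?_) hAR hκ
    (by rw [← D.e.finrank_eq]; exact hσ) (fun η hη => ?_) (fun η hη => ?_) (fun η hη => ?_)
    (fun n W hW hclosed => ?_) ?_ ?_
  · filter_upwards [hsmall1 η hη] with n hn
    have : 0 < δ n ^ (-ε n) := Real.rpow_pos_of_pos (hδ0 n) _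
    rwa [Real.norm_of_nonneg (by positivity)]
  · filter_upwards [hsmall1 η hη] with n hn ρ hρ _
    have h3 := (hlow n ρ hρ).trans (hcov ρ ((hδ0 n).trans_le hρ) _ (htb n)).2
    have h4 : 0 < δ n ^ (-ε n) := Real.rpow_pos_of_pos (hδ0 n) _
    calc ρ ^ (-κ) = δ n ^ (-ε n) * (δ n ^ ε n * ρ ^ (-κ)) := by
          rw [← mul_assoc, ← Real.rpow_add (hδ0 n), neg_add_cancel, Real.rpow_zero, one_mul]
      _ ≤ δ n ^ (-ε n) * (C * cn ρ (D.e '' A n)) := by gcongr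
      _ = C * δ n ^ (-ε n) * cn ρ (D.e '' A n) := by ring
      _ ≤ _ := by gcongr
  · filter_upwards [hsmall1 η hη] with n hn
    calc (cn (δ n) (D.e '' A n) : ℝ) ≤ C * SCov nm (δ n) (A n) := (hcov _ (hδ0 n) _ (htb n)).1
      _ ≤ C * δ n ^ (-(σ + ε n)) := by gcongr; exact hupp n
      _ = C * δ n ^ (-ε n) * δ n ^ (-σ) := by
        rw [mul_assoc, ← Real.rpow_add (hδ0 n)]; congr 2; ring_nf
      _ ≤ δ n ^ (-η) * δ n ^ (-σ) := by
        have : 0 < δ n ^ (-σ) := Real.rpow_pos_of_pos (hδ0 n) _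
        gcongr
      _ = _ := by rw [← Real.rpow_add (hδ0 n)]; congr 1; ring
  · filter_upwards [hsmall1 η hη] with n hn
    have h3 : 0 < δ n ^ ε n := Real.rpow_pos_of_pos (hδ0 n) _
    have h4 : 0 < δ n ^ η := Real.rpow_pos_of_pos (hδ0 n) _
    rw [Real.norm_of_nonneg (by positivity), le_div_iff₀ hC0]
    rw [Real.rpow_neg (hδ0 n).le, Real.rpow_neg (hδ0 n).le, ← div_eq_mul_inv, div_le_iff₀ h3,
      inv_mul_eq_div, le_div_iff₀ h4] at hn
    linarith
  · let W' : LieSubalgebra ℝ L :=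
      { W.comap D.e.toLinearMap with
        lie_mem' := fun {x y} hx hy => by
          have h3 : D.ad (D.e x) (D.e y) ∈ W := hclosed _ hx _ hy
          rw [D.ad_apply] at h3
          exact h3 }
    have hW' : W' ≠ ⊤ := fun h => hW (by
      refine eq_top_iff.2 fun v _ => ?_
      have : D.e.symm v ∈ W' := h ▸ LieSubalgebra.mem_top _
      have h3 : D.e (D.e.symm v) ∈ W := this
      rwa [D.e.apply_symm_apply] at h3)
    obtain ⟨a, ha, had⟩ := hfar n W' hW'
    refine ⟨D.e a, ⟨a, ha, rfl⟩, fun w hw => ?_⟩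
    have h3 : 0 < δ n ^ ε n := Real.rpow_pos_of_pos (hδ0 n) _
    rw [abs_of_nonneg (by positivity), div_le_iff₀ hC0, mul_comm]
    have hmem : nm (a - D.e.symm w) ∈ (fun w => nm (a - w)) '' (W' : Set L) :=
      ⟨D.e.symm w, (by rwa [D.e.apply_symm_apply] : D.e (D.e.symm w) ∈ W), rfl⟩
    have hbdd : BddBelow ((fun w => nm (a - w)) '' (W' : Set L)) :=
      ⟨0, by rintro _ ⟨w, -, rfl⟩; exact apply_nonneg nm _⟩
    refine had.trans ((csInf_le hbdd hmem).trans ((h1 _).trans_eq ?_))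
    rw [map_sub, D.e.apply_symm_apply]
  · simp only [← hadd_im]
    refine hgrow _ (fun n => by rw [hadd_im]; exact (htb n).add (htb n)) fun n => ?_
    exact (le_add_of_nonneg_right (Nat.cast_nonneg _)).trans (hlt n).le
  · simp only [← hbr_im]
    refine hgrow _ (fun n => by rw [hbr_im]; exact (htb n).add (htb2 n)) fun n => ?_
    exact (le_add_of_nonneg_left (Nat.cast_nonneg _)).trans (hlt n).le

end Assembly

/-- **Corollary 1.4** (sum-bracket estimate in simple Lie algebras): for a subset `A` of a
finite-dimensional simple normed real Lie algebra `𝔤` which is non-concentrated, not too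
large and `δ^ε`-away from proper Lie subalgebras,
`N_δ(A + A) + N_δ(A + [A,A]) ≥ δ^{-ε} N_δ(A)`. -/
theorem sum_bracket_estimate_in_simple_Lie_algebras
    {L : Type*} [LieRing L] [LieAlgebra ℝ L] [FiniteDimensional ℝ L]
    [LieAlgebra.IsSimple ℝ L]
    (nm : Seminorm ℝ L) (hnm : ∀ x : L, nm x = 0 → x = 0)
    (κ : ℝ) (hκ : 0 < κ) (σ : ℝ) (hσ : σ < (Module.finrank ℝ L : ℝ)) :
    ∃ ε : ℝ, 0 < ε ∧ ∃ δ₀ : ℝ, 0 < δ₀ ∧ ∀ δ : ℝ, 0 < δ → δ < δ₀ →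
      ∀ A : Set L,
        A ⊆ SBall nm 0 (δ ^ (-ε)) →
        (∀ ρ : ℝ, δ ≤ ρ → δ ^ ε * ρ ^ (-κ) ≤ (SCov nm ρ A : ℝ)) →
        (SCov nm δ A : ℝ) ≤ δ ^ (-(σ + ε)) →
        (∀ W : LieSubalgebra ℝ L, W ≠ ⊤ → ∃ a ∈ A, δ ^ ε ≤ SDist nm a (W : Set L)) →
        δ ^ (-ε) * (SCov nm δ A : ℝ) ≤
          (SCov nm δ (A + A) : ℝ) +
            (SCov nm δ (A + Set.image2 (fun a b => ⁅a, b⁆) A A) : ℝ) := by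
  rcases isCentroid_real_or_complex L with h | h
  · obtain ⟨n, ⟨D⟩⟩ := h.exists_model
    exact D.sum_bracket_estimate nm hnm κ hκ σ hσ
  · obtain ⟨n, ⟨D⟩⟩ := h.exists_model
    exact D.sum_bracket_estimate nm hnm κ hκ σ hσ
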